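/- arXiv:1407.5827 — 12 statements merged into one kernel-verified Lean document; each statement's English description precedes it below -/
import Mathlib

section
/- Let n ≥ 4 be a natural number and let G be a permutation group of degree n, i.e. a subgroup of the symmetric group Sym(Fin n). Then the number k(G) of conjugacy classes of G satisfies k(G) ≤ 5^((n-1)/3); equivalently, k(G)^3 ≤ 5^(n-1). -/
section ClassBounds

open Finset

noncomputable section NumericalBounds

/-- The cube root of five. -/
def cbrtFive : ℝ := 5 ^ (1 / 3 : ℝ)

theorem cbrtFive_pos : 0 < cbrtFive := by
  unfold cbrtFive; positivity

theorem cbrtFive_pow_three : cbrtFive ^ 3 = 5 := by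
  unfold cbrtFive
  rw [← Real.rpow_natCast, ← Real.rpow_mul (by norm_num)]
  norm_num

theorem lt_cbrtFive : 1.7099 < cbrtFive := by
  by_contra! h
  have h1 := pow_le_pow_left₀ cbrtFive_pos.le h 3
  rw [cbrtFive_pow_three] at h1
  norm_num at h1

theorem cbrtFive_lt : cbrtFive < 1.71 := by
  by_contra! h
  have h1 := pow_le_pow_left₀ (by norm_num) h 3
  rw [cbrtFive_pow_three] at h1
  norm_num at h1

/-- The bound for the number of conjugacy classes of a transitive group of the given degree. -/
def classBound : ℕ → ℝ
  | 0 => 1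
  | 1 => 1
  | 2 => 2
  | 3 => 3
  | n + 4 => cbrtFive ^ (n + 3)

/-- The factor lost when the classes of a group are counted together with a point in an orbit
of the given size. -/
def rootFactor : ℕ → ℝ
  | 0 => 1
  | 1 => 1
  | 2 => 1
  | 3 => 4 / 3
  | 4 => 7 / 5
  | _ + 5 => 1.409

theorem classBound_of_four_le {n : ℕ} (hn : 4 ≤ n) : classBound n = cbrtFive ^ (n - 1) := by
  obtain ⟨m, rfl⟩ := Nat.exists_eq_add_of_le' hn
  rfl

theorem classBound_pos (n : ℕ) : 0 < classBound n := by
  have := cbrtFive_pos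
  unfold classBound
  split <;> positivity

theorem rootFactor_pos (n : ℕ) : 0 < rootFactor n := by
  unfold rootFactor
  split <;> norm_num

theorem classBound_le_mul_pow (n : ℕ) (hn : 1 ≤ n) :
    classBound n ≤ 1.1697 * cbrtFive ^ (n - 1) := by
  have h1 := lt_cbrtFive
  match n, hn with
  | 1, _ => norm_num [classBound]
  | 2, _ => norm_num [classBound]; linarith
  | 3, _ => norm_num [classBound]; nlinarith
  | n + 4, _ =>
    have := pow_pos cbrtFive_pos (n + 3)
    simp only [classBound, Nat.add_succ_sub_one]
    linarith

theorem classBound_mul_le (a b : ℕ) : classBound a * classBound b ≤ classBound (a + b) := by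
  have h1 := lt_cbrtFive
  rcases Nat.eq_zero_or_pos a with rfl | ha
  · simp [classBound]
  rcases Nat.eq_zero_or_pos b with rfl | hb
  · simp [classBound]
  by_cases h : 4 ≤ a + b
  · rw [classBound_of_four_le h]
    have e : a + b - 1 = (a - 1) + (b - 1) + 1 := by omega
    rw [e, pow_succ, pow_add]
    have hA := classBound_le_mul_pow a ha
    have hB := classBound_le_mul_pow b hb
    have pa := pow_pos cbrtFive_pos (a - 1)
    have pb := pow_pos cbrtFive_pos (b - 1)
    calc _ ≤ (1.1697 * cbrtFive ^ (a - 1)) * (1.1697 * cbrtFive ^ (b - 1)) := by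
            gcongr
            exact (classBound_pos b).le
      _ = cbrtFive ^ (a - 1) * cbrtFive ^ (b - 1) * (1.1697 * 1.1697) := by ring
      _ ≤ _ := by gcongr; linarith
  · have : (a = 1 ∧ b = 1) ∨ (a = 1 ∧ b = 2) ∨ (a = 2 ∧ b = 1) := by omega
    rcases this with ⟨rfl, rfl⟩ | ⟨rfl, rfl⟩ | ⟨rfl, rfl⟩ <;> norm_num [classBound]

theorem prod_classBound_le (M : Multiset ℕ) : (M.map classBound).prod ≤ classBound M.sum := by
  induction M using Multiset.induction_on with
  | empty => simp [classBound]
  | cons a M ih =>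
    simp only [Multiset.map_cons, Multiset.prod_cons, Multiset.sum_cons]
    exact (mul_le_mul_of_nonneg_left ih (classBound_pos a).le).trans (classBound_mul_le _ _)

theorem classBound_rootFactor_cases (d : ℕ) (hd : 1 ≤ d) :
    (classBound d ≤ 0.6841 * cbrtFive ^ d ∧ rootFactor d = 1) ∨
    (classBound d ≤ 0.6 * cbrtFive ^ d ∧ rootFactor d = 4 / 3) ∨
    (classBound d ≤ 0.58485 * cbrtFive ^ d ∧ 1 ≤ rootFactor d ∧ rootFactor d ≤ 1.409) := by
  have h1 := lt_cbrtFive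
  have h3 := cbrtFive_pow_three
  match d, hd with
  | 1, _ => left; norm_num [classBound, rootFactor]; linarith
  | 2, _ => left; norm_num [classBound, rootFactor]; nlinarith
  | 3, _ => right; left; norm_num [classBound, rootFactor, h3]
  | 4, _ => 
    right; right
    have : cbrtFive ^ 4 = 5 * cbrtFive := by rw [pow_succ, h3]
    norm_num [classBound, rootFactor, h3, this]; linarith
  | n + 5, _ =>
    right; right
    have := pow_pos cbrtFive_pos (n + 4)
    refine ⟨?_, ?_, ?_⟩
    · simp only [classBound]
      rw [pow_succ cbrtFive (n + 4)]
      nlinarith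
    · norm_num [rootFactor]
    · norm_num [rootFactor]

/-- Uniform version of `classBound_rootFactor_cases`. -/
theorem exists_classBound_rootFactor_bounds (d : ℕ) (hd : 1 ≤ d) :
    ∃ γ ε : ℝ, ((γ = 0.6841 ∧ ε = 1) ∨ (γ = 0.6 ∧ ε = 4 / 3) ∨ (γ = 0.58485 ∧ ε = 1.409)) ∧
      classBound d ≤ γ * cbrtFive ^ d ∧ 1 ≤ rootFactor d ∧ rootFactor d ≤ ε := by
  rcases classBound_rootFactor_cases d hd with ⟨h, e⟩ | ⟨h, e⟩ | ⟨h, e, e'⟩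
  · exact ⟨_, _, Or.inl ⟨rfl, rfl⟩, h, e.ge, e.le⟩
  · exact ⟨_, _, Or.inr (Or.inl ⟨rfl, rfl⟩), h, by rw [e]; norm_num, e.le⟩
  · exact ⟨_, _, Or.inr (Or.inr ⟨rfl, rfl⟩), h, e, e'⟩

theorem rootFactor_one_le {d : ℕ} (hd : 1 ≤ d) : 1 ≤ rootFactor d := by
  obtain ⟨γ, ε, -, -, h, -⟩ := exists_classBound_rootFactor_bounds d hd
  exact h

theorem card_le_sum_rootFactor (M : Multiset ℕ) (hM : ∀ d ∈ M, 1 ≤ d) :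
    (M.card : ℝ) ≤ (M.map rootFactor).sum := by
  induction M using Multiset.induction_on with
  | empty => simp
  | cons a M ih =>
    have := ih fun d hd => hM d (Multiset.mem_cons_of_mem hd)
    have := rootFactor_one_le (hM a (Multiset.mem_cons_self a M))
    simp only [Multiset.card_cons, Multiset.map_cons, Multiset.sum_cons]
    push_cast
    linarith

theorem prod_classBound_pos (M : Multiset ℕ) : 0 < (M.map classBound).prod := by
  induction M using Multiset.induction_on with
  | empty => simp
  | cons a M ih => simpa using mul_pos (classBound_pos a) ih

/-- Adding a part does not increase the normalised weight of a multiset of orbit sizes. -/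
theorem prod_mul_add_sum_cons_le {a : ℕ} {M : Multiset ℕ} {t C : ℝ} (ha : 1 ≤ a)
    (hS : 3 ≤ t + (M.map rootFactor).sum)
    (h : (M.map classBound).prod * (t + (M.map rootFactor).sum) ≤ C * cbrtFive ^ M.sum) :
    ((a ::ₘ M).map classBound).prod * (t + ((a ::ₘ M).map rootFactor).sum) ≤
      C * cbrtFive ^ (a ::ₘ M).sum := by
  simp only [Multiset.map_cons, Multiset.prod_cons, Multiset.sum_cons]
  obtain ⟨γ, ε, hγ, hb, h1, h2⟩ := exists_classBound_rootFactor_bounds a ha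
  have hp := prod_classBound_pos M
  set P := (M.map classBound).prod
  set S := (M.map rootFactor).sum
  have ca := pow_pos cbrtFive_pos a
  have key : γ * (t + S + ε) ≤ t + S := by
    rcases hγ with ⟨rfl, rfl⟩ | ⟨rfl, rfl⟩ | ⟨rfl, rfl⟩ <;> linarith
  have γ0 : 0 ≤ γ := by rcases hγ with ⟨rfl, -⟩ | ⟨rfl, -⟩ | ⟨rfl, -⟩ <;> norm_num
  calc classBound a * P * (t + (rootFactor a + S))
      ≤ (γ * cbrtFive ^ a) * P * (t + S + ε) := by
        rw [← add_assoc, add_right_comm]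
        have := rootFactor_pos a
        have : 0 ≤ t + S + rootFactor a := by linarith
        gcongr
    _ = cbrtFive ^ a * P * (γ * (t + S + ε)) := by ring
    _ ≤ cbrtFive ^ a * P * (t + S) := by gcongr
    _ = cbrtFive ^ a * (P * (t + S)) := by ring
    _ ≤ cbrtFive ^ a * (C * cbrtFive ^ M.sum) := by gcongr
    _ = _ := by rw [pow_add]; ring

theorem prod_mul_one_add_sum_le (M : Multiset ℕ) (hM : ∀ d ∈ M, 1 ≤ d) (h0 : 1 ≤ M.card) :
    (M.map classBound).prod * (1 + (M.map rootFactor).sum) ≤ 1.409 * cbrtFive ^ M.sum := by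
  induction M using Multiset.induction_on with
  | empty => simp at h0
  | cons a M ih =>
    have hM' : ∀ d ∈ M, 1 ≤ d := fun d hd => hM d (Multiset.mem_cons_of_mem hd)
    have ha := hM a (Multiset.mem_cons_self a M)
    rcases Nat.lt_or_ge M.card 2 with h2 | h2
    · obtain ⟨γ, ε, hγ, hb, h1, hε⟩ := exists_classBound_rootFactor_bounds a ha
      have ca := pow_pos cbrtFive_pos a
      have ra := rootFactor_pos a
      have ba := classBound_pos a
      obtain h | h : M.card = 0 ∨ M.card = 1 := by omega
      · rw [Multiset.card_eq_zero] at h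
        subst h
        simp only [Multiset.map_cons, Multiset.map_zero, Multiset.prod_cons, Multiset.prod_zero,
          Multiset.sum_cons, Multiset.sum_zero, mul_one, add_zero]
        calc _ ≤ (γ * cbrtFive ^ a) * (1 + ε) := by gcongr; exact ba.le.trans hb
          _ = (γ * (1 + ε)) * cbrtFive ^ a := by ring
          _ ≤ _ := by
            gcongr
            rcases hγ with ⟨rfl, rfl⟩ | ⟨rfl, rfl⟩ | ⟨rfl, rfl⟩ <;> norm_num
      · obtain ⟨b, rfl⟩ := Multiset.card_eq_one.1 h
        obtain ⟨γ', ε', hγ', hb', h1', hε'⟩ :=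
          exists_classBound_rootFactor_bounds b (hM' b (by simp))
        have cb := pow_pos cbrtFive_pos b
        have rb := rootFactor_pos b
        have bb := classBound_pos b
        simp only [Multiset.map_cons, Multiset.map_singleton, Multiset.prod_cons,
          Multiset.prod_singleton, Multiset.sum_cons, Multiset.sum_singleton]
        calc _ ≤ (γ * cbrtFive ^ a) * (γ' * cbrtFive ^ b) * (1 + (ε + ε')) := by
              gcongr
              · exact mul_nonneg (ba.le.trans hb) (bb.le.trans hb')
              · exact ba.le.trans hb
          _ = (γ * γ' * (1 + (ε + ε'))) * cbrtFive ^ (a + b) := by rw [pow_add]; ring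
          _ ≤ _ := by
            refine mul_le_mul_of_nonneg_right ?_ (pow_pos cbrtFive_pos _).le
            rcases hγ with ⟨rfl, rfl⟩ | ⟨rfl, rfl⟩ | ⟨rfl, rfl⟩ <;>
            rcases hγ' with ⟨rfl, rfl⟩ | ⟨rfl, rfl⟩ | ⟨rfl, rfl⟩ <;> norm_num
    · refine prod_mul_add_sum_cons_le ha ?_ (ih hM' (by omega))
      have := card_le_sum_rootFactor M hM'
      have : (2 : ℝ) ≤ M.card := by exact_mod_cast h2
      linarith

theorem prod_mul_sum_le (M : Multiset ℕ) (hM : ∀ d ∈ M, 1 ≤ d) :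
    (M.map classBound).prod * (M.map rootFactor).sum ≤ 0.97 * cbrtFive ^ M.sum := by
  induction M using Multiset.induction_on with
  | empty => norm_num
  | cons a M ih =>
    have hM' : ∀ d ∈ M, 1 ≤ d := fun d hd => hM d (Multiset.mem_cons_of_mem hd)
    have ha := hM a (Multiset.mem_cons_self a M)
    rcases Nat.lt_or_ge M.card 3 with h2 | h2
    · obtain ⟨γ, ε, hγ, hb, h1, hε⟩ := exists_classBound_rootFactor_bounds a ha
      have ca := pow_pos cbrtFive_pos a
      have ra := rootFactor_pos a
      have ba := classBound_pos a
      obtain h | h | h : M.card = 0 ∨ M.card = 1 ∨ M.card = 2 := by omega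
      · rw [Multiset.card_eq_zero] at h
        subst h
        simp only [Multiset.map_cons, Multiset.map_zero, Multiset.prod_cons, Multiset.prod_zero,
          Multiset.sum_cons, Multiset.sum_zero, mul_one, add_zero]
        calc _ ≤ (γ * cbrtFive ^ a) * ε := by gcongr; exact ba.le.trans hb
          _ = (γ * ε) * cbrtFive ^ a := by ring
          _ ≤ _ := by
            gcongr
            rcases hγ with ⟨rfl, rfl⟩ | ⟨rfl, rfl⟩ | ⟨rfl, rfl⟩ <;> norm_num
      · obtain ⟨b, rfl⟩ := Multiset.card_eq_one.1 h
        obtain ⟨γ', ε', hγ', hb', h1', hε'⟩ :=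
          exists_classBound_rootFactor_bounds b (hM' b (by simp))
        have cb := pow_pos cbrtFive_pos b
        have rb := rootFactor_pos b
        have bb := classBound_pos b
        simp only [Multiset.map_cons, Multiset.map_singleton, Multiset.prod_cons,
          Multiset.prod_singleton, Multiset.sum_cons, Multiset.sum_singleton]
        calc _ ≤ (γ * cbrtFive ^ a) * (γ' * cbrtFive ^ b) * (ε + ε') := by
              gcongr
              · exact mul_nonneg (ba.le.trans hb) (bb.le.trans hb')
              · exact ba.le.trans hb
          _ = (γ * γ' * (ε + ε')) * cbrtFive ^ (a + b) := by rw [pow_add]; ring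
          _ ≤ _ := by
            refine mul_le_mul_of_nonneg_right ?_ (pow_pos cbrtFive_pos _).le
            rcases hγ with ⟨rfl, rfl⟩ | ⟨rfl, rfl⟩ | ⟨rfl, rfl⟩ <;>
            rcases hγ' with ⟨rfl, rfl⟩ | ⟨rfl, rfl⟩ | ⟨rfl, rfl⟩ <;> norm_num
      · obtain ⟨b, d, rfl⟩ := Multiset.card_eq_two.1 h
        obtain ⟨γ', ε', hγ', hb', h1', hε'⟩ :=
          exists_classBound_rootFactor_bounds b (hM' b (by simp))
        obtain ⟨γ'', ε'', hγ'', hb'', h1'', hε''⟩ :=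
          exists_classBound_rootFactor_bounds d (hM' d (by simp))
        have cb := pow_pos cbrtFive_pos b
        have rb := rootFactor_pos b
        have bb := classBound_pos b
        have cd := pow_pos cbrtFive_pos d
        have rd := rootFactor_pos d
        have bd := classBound_pos d
        simp only [Multiset.insert_eq_cons, Multiset.map_cons, Multiset.map_singleton,
          Multiset.prod_cons, Multiset.prod_singleton, Multiset.sum_cons, Multiset.sum_singleton]
        have n1 := ba.le.trans hb
        have n2 := bb.le.trans hb'
        have n3 := bd.le.trans hb''
        calc _ ≤ (γ * cbrtFive ^ a) * ((γ' * cbrtFive ^ b) * (γ'' * cbrtFive ^ d)) *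
                (ε + (ε' + ε'')) := by gcongr
          _ = (γ * (γ' * γ'') * (ε + (ε' + ε''))) * cbrtFive ^ (a + (b + d)) := by
            rw [pow_add, pow_add]; ring
          _ ≤ _ := by
            refine mul_le_mul_of_nonneg_right ?_ (pow_pos cbrtFive_pos _).le
            rcases hγ with ⟨rfl, rfl⟩ | ⟨rfl, rfl⟩ | ⟨rfl, rfl⟩ <;>
            rcases hγ' with ⟨rfl, rfl⟩ | ⟨rfl, rfl⟩ | ⟨rfl, rfl⟩ <;>
            rcases hγ'' with ⟨rfl, rfl⟩ | ⟨rfl, rfl⟩ | ⟨rfl, rfl⟩ <;> norm_num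
    · have := prod_mul_add_sum_cons_le (M := M) (t := 0) (C := 0.97) ha ?_ ?_
      · simpa using this
      · have := card_le_sum_rootFactor M hM'
        have : (3 : ℝ) ≤ M.card := by exact_mod_cast h2
        linarith
      · simpa using ih hM'

/-- Case distinction on the parts of a multiset of positive integers. -/
theorem Multiset.eq_zero_or_exists_cons_of_sum (M : Multiset ℕ) (hM : ∀ d ∈ M, 1 ≤ d) (s : ℕ)
    (h : M.sum = s) :
    (s = 0 ∧ M = 0) ∨ ∃ a N, M = a ::ₘ N ∧ 1 ≤ a ∧ a ≤ s ∧ (∀ d ∈ N, 1 ≤ d) ∧ N.sum = s - a := by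
  rcases M.empty_or_exists_mem with rfl | ⟨a, ha⟩
  · left; simpa using h.symm
  · right
    obtain ⟨N, rfl⟩ := Multiset.exists_cons_of_mem ha
    simp only [Multiset.sum_cons] at h
    exact ⟨a, N, rfl, hM a ha, by omega, fun d hd => hM d (Multiset.mem_cons_of_mem hd), by omega⟩

theorem Multiset.mem_of_sum_eq_zero {M : Multiset ℕ} (hM : ∀ d ∈ M, 1 ≤ d)
    (h : M.sum = 0) :
    M ∈ ([0] : List (Multiset ℕ)) := by
  rcases M.eq_zero_or_exists_cons_of_sum hM _ h with ⟨h0, rfl⟩ | ⟨a, N, rfl, ha, ha', hN, hs⟩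
  · simp
  · omega

theorem Multiset.mem_of_sum_eq_one {M : Multiset ℕ} (hM : ∀ d ∈ M, 1 ≤ d)
    (h : M.sum = 1) :
    M ∈ ([{1}] : List (Multiset ℕ)) := by
  rcases M.eq_zero_or_exists_cons_of_sum hM _ h with ⟨h0, rfl⟩ | ⟨a, N, rfl, ha, ha', hN, hs⟩
  · omega
  · interval_cases a
    · have := mem_of_sum_eq_zero hN hs
      fin_cases this; decide

theorem Multiset.mem_of_sum_eq_two {M : Multiset ℕ} (hM : ∀ d ∈ M, 1 ≤ d)
    (h : M.sum = 2) :
    M ∈ ([{2}, {1, 1}] : List (Multiset ℕ)) := by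
  rcases M.eq_zero_or_exists_cons_of_sum hM _ h with ⟨h0, rfl⟩ | ⟨a, N, rfl, ha, ha', hN, hs⟩
  · omega
  · interval_cases a
    · have := mem_of_sum_eq_one hN hs
      fin_cases this; decide
    · have := mem_of_sum_eq_zero hN hs
      fin_cases this; decide

theorem Multiset.mem_of_sum_eq_three {M : Multiset ℕ} (hM : ∀ d ∈ M, 1 ≤ d)
    (h : M.sum = 3) :
    M ∈ ([{3}, {2, 1}, {1, 1, 1}] : List (Multiset ℕ)) := by
  rcases M.eq_zero_or_exists_cons_of_sum hM _ h with ⟨h0, rfl⟩ | ⟨a, N, rfl, ha, ha', hN, hs⟩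
  · omega
  · interval_cases a
    · have := mem_of_sum_eq_two hN hs
      fin_cases this <;> decide
    · have := mem_of_sum_eq_one hN hs
      fin_cases this; decide
    · have := mem_of_sum_eq_zero hN hs
      fin_cases this; decide

theorem Multiset.mem_of_sum_eq_four {M : Multiset ℕ} (hM : ∀ d ∈ M, 1 ≤ d)
    (h : M.sum = 4) :
    M ∈ ([{4}, {3, 1}, {2, 2}, {2, 1, 1}, {1, 1, 1, 1}] : List (Multiset ℕ)) := by
  rcases M.eq_zero_or_exists_cons_of_sum hM _ h with ⟨h0, rfl⟩ | ⟨a, N, rfl, ha, ha', hN, hs⟩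
  · omega
  · interval_cases a
    · have := mem_of_sum_eq_three hN hs
      fin_cases this <;> decide
    · have := mem_of_sum_eq_two hN hs
      fin_cases this <;> decide
    · have := mem_of_sum_eq_one hN hs
      fin_cases this; decide
    · have := mem_of_sum_eq_zero hN hs
      fin_cases this; decide

theorem Multiset.mem_of_sum_eq_five {M : Multiset ℕ} (hM : ∀ d ∈ M, 1 ≤ d)
    (h : M.sum = 5) :
    M ∈ ([{5}, {4, 1}, {3, 2}, {3, 1, 1},
      {2, 2, 1}, {2, 1, 1, 1}, {1, 1, 1, 1, 1}] : List (Multiset ℕ)) := by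
  rcases M.eq_zero_or_exists_cons_of_sum hM _ h with ⟨h0, rfl⟩ | ⟨a, N, rfl, ha, ha', hN, hs⟩
  · omega
  · interval_cases a
    · have := mem_of_sum_eq_four hN hs
      fin_cases this <;> decide
    · have := mem_of_sum_eq_three hN hs
      fin_cases this <;> decide
    · have := mem_of_sum_eq_two hN hs
      fin_cases this <;> decide
    · have := mem_of_sum_eq_one hN hs
      fin_cases this; decide
    · have := mem_of_sum_eq_zero hN hs
      fin_cases this; decide

theorem Multiset.mem_of_sum_eq_six {M : Multiset ℕ} (hM : ∀ d ∈ M, 1 ≤ d)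
    (h : M.sum = 6) :
    M ∈ ([{6}, {5, 1}, {4, 2}, {4, 1, 1}, {3, 3}, {3, 2, 1},
      {3, 1, 1, 1}, {2, 2, 2}, {2, 2, 1, 1}, {2, 1, 1, 1, 1}, {1, 1, 1, 1, 1, 1}] :
        List (Multiset ℕ)) := by
  rcases M.eq_zero_or_exists_cons_of_sum hM _ h with ⟨h0, rfl⟩ | ⟨a, N, rfl, ha, ha', hN, hs⟩
  · omega
  · interval_cases a
    · have := mem_of_sum_eq_five hN hs
      fin_cases this <;> decide
    · have := mem_of_sum_eq_four hN hs
      fin_cases this <;> decide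
    · have := mem_of_sum_eq_three hN hs
      fin_cases this <;> decide
    · have := mem_of_sum_eq_two hN hs
      fin_cases this <;> decide
    · have := mem_of_sum_eq_one hN hs
      fin_cases this; decide
    · have := mem_of_sum_eq_zero hN hs
      fin_cases this; decide

theorem classBound_five : classBound 5 = 5 * cbrtFive := by
  rw [classBound_of_four_le (by norm_num)]; norm_num [pow_succ _ 3, cbrtFive_pow_three]

theorem classBound_six : classBound 6 = 5 * cbrtFive ^ 2 := by
  rw [classBound_of_four_le (by norm_num)]
  rw [show 6 - 1 = 3 + 2 from rfl, pow_add, cbrtFive_pow_three]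

theorem classBound_seven : classBound 7 = 25 := by
  rw [classBound_of_four_le (by norm_num)]
  rw [show 7 - 1 = 3 * 2 from rfl, pow_mul, cbrtFive_pow_three]; norm_num

theorem rootFactor_of_five_le {d : ℕ} (h : 5 ≤ d) : rootFactor d = 1.409 := by
  obtain ⟨d, rfl⟩ := Nat.exists_eq_add_of_le' h
  rfl

theorem prod_mul_one_add_sum_le_rootFactor_mul {d : ℕ} (M : Multiset ℕ) (hM : ∀ a ∈ M, 1 ≤ a)
    (hd : 2 ≤ d) (hs : M.sum = d - 1) :
    (M.map classBound).prod * (1 + (M.map rootFactor).sum) ≤ rootFactor d * classBound d := by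
  rcases Nat.lt_or_ge d 5 with h | h
  · interval_cases d
    · have := Multiset.mem_of_sum_eq_one hM hs
      fin_cases this; norm_num [classBound, rootFactor]
    · have := Multiset.mem_of_sum_eq_two hM hs
      fin_cases this <;> norm_num [classBound, rootFactor]
    · have := Multiset.mem_of_sum_eq_three hM hs
      fin_cases this <;> norm_num [classBound, rootFactor, cbrtFive_pow_three]
  · rw [rootFactor_of_five_le h, classBound_of_four_le (by omega), ← hs]
    refine prod_mul_one_add_sum_le M hM ?_
    rw [Nat.one_le_iff_ne_zero, Ne, Multiset.card_eq_zero]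
    rintro rfl
    simp at hs
    omega

theorem one_add_prod_mul_sum_le_classBound {n : ℕ} (M : Multiset ℕ) (hM : ∀ a ∈ M, 1 ≤ a)
    (hn : 2 ≤ n) (hs : M.sum = n - 1) (h₁ : M ≠ {2, 2}) (h₂ : M ≠ {3, 2}) :
    1 + (M.map classBound).prod * (M.map rootFactor).sum ≤ classBound n := by
  have c₁ := lt_cbrtFive
  have c₂ := cbrtFive_lt
  rcases Nat.lt_or_ge n 8 with h | h
  · interval_cases n
    · have := Multiset.mem_of_sum_eq_one hM hs
      fin_cases this; norm_num [classBound, rootFactor]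
    · have := Multiset.mem_of_sum_eq_two hM hs
      fin_cases this <;> norm_num [classBound, rootFactor]
    · have := Multiset.mem_of_sum_eq_three hM hs
      fin_cases this <;> norm_num [classBound, rootFactor, cbrtFive_pow_three]
    · have := Multiset.mem_of_sum_eq_four hM hs
      rw [classBound_five]
      fin_cases this <;> first
        | exact absurd rfl h₁
        | (norm_num [classBound, rootFactor, cbrtFive_pow_three]; linarith)
    · have := Multiset.mem_of_sum_eq_five hM hs
      rw [classBound_six]
      fin_cases this <;> first
        | exact absurd rfl h₂
        | (norm_num [classBound_five, rootFactor_of_five_le]; nlinarith)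
        | (norm_num [classBound, rootFactor, cbrtFive_pow_three]; nlinarith)
    · have := Multiset.mem_of_sum_eq_six hM hs
      rw [classBound_seven]
      fin_cases this <;> first
        | (norm_num [classBound_six, rootFactor_of_five_le]; nlinarith)
        | (norm_num [classBound_five, rootFactor_of_five_le]
           norm_num [classBound, rootFactor]
           linarith)
        | norm_num [classBound, rootFactor, cbrtFive_pow_three]
  · rw [classBound_of_four_le (by omega)]
    have h₃ := prod_mul_sum_le M hM
    rw [hs] at h₃
    have h₄ : cbrtFive ^ 7 ≤ cbrtFive ^ (n - 1) :=
      pow_le_pow_right₀ (by linarith) (by omega)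
    have h₅ : cbrtFive ^ 7 = 25 * cbrtFive := by
      rw [show 7 = 3 * 2 + 1 from rfl, pow_add, pow_mul, cbrtFive_pow_three]; norm_num
    linarith

end NumericalBounds

section ClassicalDecidability

open scoped Classical

section CommutingPairs

/-- The number of commuting pairs in `A × B`. -/
noncomputable def commCard {P : Type*} [Group P] (A B : Finset P) : ℕ :=
  ∑ a ∈ A, #{b ∈ B | Commute a b}

theorem commCard_comm {P : Type*} [Group P] (A B : Finset P) : commCard A B = commCard B A := by
  simp only [commCard, card_filter]
  rw [sum_comm]
  simp only [commute_iff_eq, eq_comm]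

theorem commCard_le_card_mul_card {P : Type*} [Group P] (A B : Finset P) :
    commCard A B ≤ #A * #B := by
  rw [← smul_eq_mul]
  exact sum_le_card_nsmul _ _ _ fun a _ => card_filter_le _ _

theorem card_conjClasses_le_of_surjective {G Q : Type*} [Group G] [Finite G] [Group Q]
    (φ : G →* Q) (hφ : Function.Surjective φ) :
    Nat.card (ConjClasses Q) ≤ Nat.card (ConjClasses G) :=
  Nat.card_le_card_of_surjective _ (ConjClasses.map_surjective hφ)

variable {P : Type*} [Group P] [Fintype P]

/-- The elements of a subgroup of a finite group, as a finset. -/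
noncomputable def Subgroup.elements (H : Subgroup P) : Finset P := {g | g ∈ H}

@[simp] theorem Subgroup.mem_elements {H : Subgroup P} {g : P} : g ∈ H.elements ↔ g ∈ H := by
  simp [Subgroup.elements]

theorem Subgroup.card_elements (H : Subgroup P) : #H.elements = Nat.card H :=
  (Nat.subtype_card _ fun _ => Subgroup.mem_elements).symm

/-- Passing from a subset of a left coset to the subgroup does not lose commuting pairs. -/
theorem commCard_le_commCard_elements (A X : Finset P) (H : Subgroup P)
    (hX : ∀ x ∈ X, ∀ y ∈ X, x⁻¹ * y ∈ H) : commCard A X ≤ commCard A H.elements := by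
  refine sum_le_sum fun a _ => ?_
  rcases ({x ∈ X | Commute a x} : Finset P).eq_empty_or_nonempty with h | ⟨x, hx⟩
  · simp [h]
  · rw [mem_filter] at hx
    refine card_le_card_of_injOn (fun y => x⁻¹ * y) (fun y hy => ?_)
      (fun y _ z _ h => mul_left_cancel h)
    simp only [mem_coe, mem_filter, Subgroup.mem_elements] at hy ⊢
    exact ⟨hX x hx.1 y hy.1, hx.2.inv_right.mul_right hy.2⟩

theorem card_conjClasses_mul_card (H : Subgroup P) :
    Nat.card (ConjClasses H) * Nat.card H = commCard H.elements H.elements := by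
  rw [← card_comm_eq_card_conjClasses_mul_card, commCard, ← card_sigma, Nat.card_eq_fintype_card,
    Fintype.card_subtype]
  refine card_bij (fun p _ => ⟨p.1, p.2⟩) ?_ ?_ ?_
  · rintro ⟨⟨a, ha⟩, ⟨b, hb⟩⟩ h
    simpa [ha, hb, commute_iff_eq] using h
  · rintro ⟨⟨a, ha⟩, ⟨b, hb⟩⟩ _ ⟨⟨a', ha'⟩, ⟨b', hb'⟩⟩ _ h
    simpa using h
  · rintro ⟨a, b⟩ h
    simp only [mem_sigma, Subgroup.mem_elements, mem_filter] at h
    exact ⟨⟨⟨a, h.1⟩, ⟨b, h.2.1⟩⟩, by simpa [commute_iff_eq] using h.2.2, rfl⟩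

/-- The number of conjugacy classes is at most the product of those of the kernel and the image of
a homomorphism. -/
theorem card_conjClasses_le_mul {Q : Type*} [Group Q] [Fintype Q] (φ : P →* Q) :
    Nat.card (ConjClasses P) ≤ Nat.card (ConjClasses φ.ker) * Nat.card (ConjClasses φ.range) := by
  have htop : Nat.card (ConjClasses P) ≤ Nat.card (ConjClasses (⊤ : Subgroup P)) :=
    card_conjClasses_le_of_surjective (Subgroup.topEquiv (G := P)).toMonoidHom
      (Subgroup.topEquiv (G := P)).surjective
  refine htop.trans (Nat.le_of_mul_le_mul_right ?_ (Nat.card_pos (α := (⊤ : Subgroup P))))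
  have hcard : Nat.card (⊤ : Subgroup P) = Nat.card φ.ker * Nat.card φ.range := by
    rw [← Subgroup.index_ker, Subgroup.card_mul_index, Subgroup.card_top]
  let fib : Q → Finset P := fun q => {a | φ a = q}
  have hfib : ∀ q, ∀ x ∈ fib q, ∀ y ∈ fib q, x⁻¹ * y ∈ φ.ker := by
    intro q x hx y hy
    simp only [fib, mem_filter, mem_univ, true_and] at hx hy
    simp [MonoidHom.mem_ker, hx, hy]
  have key : commCard (⊤ : Subgroup P).elements (⊤ : Subgroup P).elements =
      ∑ q ∈ φ.range.elements, ∑ q' ∈ φ.range.elements with Commute q q',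
        commCard (fib q) (fib q') := by
    have huniv : (⊤ : Subgroup P).elements = univ := by ext; simp
    rw [commCard, huniv, ← sum_fiberwise_of_maps_to (g := φ) (t := φ.range.elements) (by simp)]
    refine sum_congr rfl fun q _ => ?_
    simp only [commCard]
    rw [sum_comm]
    refine sum_congr rfl fun a ha => ?_
    have haq : φ a = q := by simpa [fib] using ha
    rw [card_eq_sum_card_fiberwise (f := φ) (t := {q' ∈ φ.range.elements | Commute q q'})]
    · refine sum_congr rfl fun q' _ => ?_
      congr 1
      ext b
      simp [fib, and_comm]
    · intro b hb
      simp only [mem_coe, mem_filter, mem_univ, true_and, Subgroup.mem_elements] at hb ⊢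
      exact ⟨⟨b, rfl⟩, haq ▸ hb.map φ⟩
  calc _ = _ := card_conjClasses_mul_card _
    _ = _ := key
    _ ≤ ∑ q ∈ φ.range.elements, ∑ q' ∈ φ.range.elements with Commute q q',
        commCard φ.ker.elements φ.ker.elements := by
      refine sum_le_sum fun q _ => sum_le_sum fun q' _ => ?_
      refine (commCard_le_commCard_elements _ _ _ (hfib q')).trans ?_
      rw [commCard_comm]
      exact commCard_le_commCard_elements _ _ _ (hfib q)
    _ = commCard φ.range.elements φ.range.elements * commCard φ.ker.elements φ.ker.elements := by
      simp only [sum_const, smul_eq_mul, ← sum_mul]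
      rfl
    _ = _ := by
      rw [← card_conjClasses_mul_card, ← card_conjClasses_mul_card, hcard]
      ring

/-- If every nontrivial conjugacy class of `G` meets `D`, and `D` is stable under conjugation by
`H`, then the commuting pairs in `H × D` bound the number of classes of `G`. -/
theorem card_conjClasses_mul_le (G H : Subgroup P) (hHG : H ≤ G) (D : Finset P)
    (hD : ∀ g ∈ D, g ∈ G) (hDH : ∀ h ∈ H, ∀ g ∈ D, h * g * h⁻¹ ∈ D)
    (hGD : ∀ g ∈ G, g ≠ 1 → ∃ u ∈ G, u * g * u⁻¹ ∈ D) :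
    Nat.card (ConjClasses G) * Nat.card H ≤ Nat.card H + commCard H.elements D := by
  let f : P → ConjClasses G := fun g =>
    if h : g ∈ G then ConjClasses.mk ⟨g, h⟩ else ConjClasses.mk 1
  have hf : ∀ g (h : g ∈ G), f g = ConjClasses.mk ⟨g, h⟩ := fun g h => dif_pos h
  have hconj : ∀ u ∈ G, ∀ g ∈ G, f (u * g * u⁻¹) = f g := by
    intro u hu g hg
    rw [hf g hg, hf _ (G.mul_mem (G.mul_mem hu hg) (G.inv_mem hu)), ConjClasses.mk_eq_mk_iff_isConj,
      isConj_comm, isConj_iff]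
    exact ⟨⟨u, hu⟩, rfl⟩
  have hclass : ∀ κ : ConjClasses G, κ ≠ ConjClasses.mk 1 →
      Nat.card H ≤ ∑ g ∈ D with f g = κ, #{h ∈ H.elements | Commute g h} := by
    intro κ hκ
    obtain ⟨⟨g, hg⟩, rfl⟩ := ConjClasses.mk_surjective κ
    have hg1 : g ≠ 1 := by rintro rfl; exact hκ rfl
    obtain ⟨u, hu, hug⟩ := hGD g hg hg1
    set g₀ := u * g * u⁻¹
    have hfg₀ : f g₀ = f g := hconj u hu g hg
    rw [← Subgroup.card_elements, ← hf g hg, card_eq_sum_card_fiberwise (f := fun h => h * g₀ * h⁻¹)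
      (t := {x ∈ D | f x = f g})]
    · refine sum_le_sum fun x _ => ?_
      rcases ({h ∈ H.elements | h * g₀ * h⁻¹ = x} : Finset P).eq_empty_or_nonempty with h0 | ⟨v, hv⟩
      · simp [h0]
      · simp only [mem_filter, Subgroup.mem_elements] at hv
        refine card_le_card_of_injOn (fun y => y * v⁻¹) (fun y hy => ?_)
          (fun y _ z _ h => mul_right_cancel h)
        simp only [mem_coe, mem_filter, Subgroup.mem_elements] at hy ⊢
        refine ⟨H.mul_mem hy.1 (H.inv_mem hv.1), ?_⟩
        rw [commute_iff_eq]
        nth_rw 1 [← hy.2]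
        rw [← hv.2]
        group
    · intro h hh
      simp only [mem_coe, mem_filter, Subgroup.mem_elements] at hh ⊢
      exact ⟨hDH h hh _ hug, (hconj h (hHG hh) _ (hD _ hug)).trans hfg₀⟩
  have hsum : commCard H.elements D =
      ∑ κ : ConjClasses G, ∑ g ∈ D with f g = κ, #{h ∈ H.elements | Commute g h} := by
    rw [commCard_comm, commCard, sum_fiberwise]
  rw [hsum, ← add_sum_erase _ _ (mem_univ (ConjClasses.mk 1)), Nat.card_eq_fintype_card,
    ← card_univ, ← card_erase_add_one (mem_univ (ConjClasses.mk (1 : G))), add_mul, one_mul]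
  have := card_nsmul_le_sum (univ.erase (ConjClasses.mk (1 : G))) _ _
    fun κ hκ => hclass κ (ne_of_mem_erase hκ)
  rw [smul_eq_mul] at this
  omega

end CommutingPairs

section Orbits

open Equiv

variable {α : Type*}

/-- The stabilizer of `y` in `H`. -/
def pointStab (H : Subgroup (Perm α)) (y : α) : Subgroup (Perm α) :=
  H ⊓ MulAction.stabilizer (Perm α) y

theorem mem_pointStab {H : Subgroup (Perm α)} {y : α} {g : Perm α} :
    g ∈ pointStab H y ↔ g ∈ H ∧ g y = y := by
  simp [pointStab]

theorem pointStab_le (H : Subgroup (Perm α)) (y : α) : pointStab H y ≤ H := inf_le_left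

/-- `S` is invariant under `H`. -/
def IsStable (H : Subgroup (Perm α)) (S : Finset α) : Prop := ∀ h ∈ H, ∀ x ∈ S, h x ∈ S

theorem IsStable.mono {J H : Subgroup (Perm α)} {S : Finset α} (h : IsStable H S) (hJ : J ≤ H) :
    IsStable J S := fun g hg => h g (hJ hg)

theorem IsStable.inter {H : Subgroup (Perm α)} {S T : Finset α} (h : IsStable H S)
    (h' : IsStable H T) : IsStable H (S ∩ T) := by
  intro g hg x hx
  rw [mem_inter] at hx ⊢
  exact ⟨h g hg x hx.1, h' g hg x hx.2⟩

theorem isStable_singleton {H : Subgroup (Perm α)} {y : α} (h : ∀ g ∈ H, g y = y) :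
    IsStable H {y} := by
  intro g hg x hx
  rw [mem_singleton] at hx ⊢
  rw [hx, h g hg]

variable [Fintype α]

/-- The orbit of `y` under `H`. -/
noncomputable def permOrbit (H : Subgroup (Perm α)) (y : α) : Finset α := {z | ∃ h ∈ H, h y = z}

theorem mem_permOrbit {H : Subgroup (Perm α)} {y z : α} :
    z ∈ permOrbit H y ↔ ∃ h ∈ H, h y = z := by
  simp [permOrbit]

theorem self_mem_permOrbit (H : Subgroup (Perm α)) (y : α) : y ∈ permOrbit H y :=
  mem_permOrbit.2 ⟨1, H.one_mem, rfl⟩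

theorem card_permOrbit_pos (H : Subgroup (Perm α)) (y : α) : 0 < #(permOrbit H y) :=
  card_pos.2 ⟨y, self_mem_permOrbit H y⟩

theorem permOrbit_eq_of_mem {H : Subgroup (Perm α)} {y z : α} (h : z ∈ permOrbit H y) :
    permOrbit H z = permOrbit H y := by
  obtain ⟨g, hg, rfl⟩ := mem_permOrbit.1 h
  ext w
  simp only [mem_permOrbit]
  constructor
  · rintro ⟨k, hk, rfl⟩
    exact ⟨k * g, H.mul_mem hk hg, rfl⟩
  · rintro ⟨k, hk, rfl⟩
    exact ⟨k * g⁻¹, H.mul_mem hk (H.inv_mem hg), by simp⟩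

theorem permOrbit_eq_iff {H : Subgroup (Perm α)} {y z : α} :
    permOrbit H z = permOrbit H y ↔ z ∈ permOrbit H y :=
  ⟨fun h => h ▸ self_mem_permOrbit H z, permOrbit_eq_of_mem⟩

theorem isStable_permOrbit (H : Subgroup (Perm α)) (y : α) : IsStable H (permOrbit H y) := by
  intro h hh x hx
  rw [← permOrbit_eq_iff] at hx ⊢
  rw [← hx, permOrbit_eq_iff]
  exact mem_permOrbit.2 ⟨h, hh, rfl⟩

theorem IsStable.compl {H : Subgroup (Perm α)} {S : Finset α} (h : IsStable H S) :
    IsStable H Sᶜ := by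
  intro g hg x hx
  rw [mem_compl] at hx ⊢
  exact fun h' => hx (by simpa using h _ (H.inv_mem hg) _ h')

theorem IsStable.sdiff {H : Subgroup (Perm α)} {S T : Finset α} (h : IsStable H S)
    (h' : IsStable H T) : IsStable H (S \ T) := by
  rw [sdiff_eq_inter_compl]
  exact h.inter h'.compl

theorem isStable_univ (H : Subgroup (Perm α)) : IsStable H univ := fun _ _ _ _ => mem_univ _

theorem IsStable.permOrbit_subset {H : Subgroup (Perm α)} {S : Finset α} (h : IsStable H S)
    {x : α} (hx : x ∈ S) : permOrbit H x ⊆ S := by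
  intro z hz
  obtain ⟨g, hg, rfl⟩ := mem_permOrbit.1 hz
  exact h g hg x hx

/-- The elements of `H` that map `y` to `z`. -/
noncomputable def transporter (H : Subgroup (Perm α)) (y z : α) : Finset (Perm α) :=
  {h ∈ H.elements | h y = z}

theorem mem_transporter {H : Subgroup (Perm α)} {y z : α} {g : Perm α} :
    g ∈ transporter H y z ↔ g ∈ H ∧ g y = z := by
  simp [transporter]

theorem inv_mul_mem_pointStab {H : Subgroup (Perm α)} {y z : α} :
    ∀ g ∈ transporter H y z, ∀ k ∈ transporter H y z, g⁻¹ * k ∈ pointStab H y := by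
  intro g hg k hk
  rw [mem_transporter] at hg hk
  refine mem_pointStab.2 ⟨H.mul_mem (H.inv_mem hg.1) hk.1, ?_⟩
  rw [Perm.mul_apply, hk.2, ← hg.2]
  simp

theorem card_transporter {H : Subgroup (Perm α)} {y z : α} (hz : z ∈ permOrbit H y) :
    #(transporter H y z) = Nat.card (pointStab H y) := by
  obtain ⟨g, hg, rfl⟩ := mem_permOrbit.1 hz
  rw [← Subgroup.card_elements]
  refine card_bij' (fun k _ => g⁻¹ * k) (fun k _ => g * k) ?_ ?_ ?_ ?_
  · intro k hk
    exact Subgroup.mem_elements.2 (inv_mul_mem_pointStab g (mem_transporter.2 ⟨hg, rfl⟩) k hk)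
  · intro k hk
    rw [Subgroup.mem_elements, mem_pointStab] at hk
    exact mem_transporter.2 ⟨H.mul_mem hg hk.1, by rw [Perm.mul_apply, hk.2]⟩
  · simp
  · simp

theorem card_permOrbit_mul_card (H : Subgroup (Perm α)) (y : α) :
    #(permOrbit H y) * Nat.card (pointStab H y) = Nat.card H := by
  rw [← Subgroup.card_elements H, card_eq_sum_card_fiberwise (f := fun h : Perm α => h y)
    (t := permOrbit H y), sum_const_nat]
  · intro z hz
    exact card_transporter hz
  · intro h hh
    exact mem_permOrbit.2 ⟨h, by simpa using hh, rfl⟩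

/-- Commuting pairs between a point stabilizer and a coset of it. -/
theorem commCard_transporter (H : Subgroup (Perm α)) (y z : α) :
    commCard (pointStab H y).elements (transporter H y z) =
      commCard (pointStab (pointStab H y) z).elements (transporter H y z) := by
  symm
  refine sum_subset (fun g hg => ?_) fun g hg hg' => ?_
  · rw [Subgroup.mem_elements] at hg ⊢
    exact pointStab_le _ _ hg
  · rw [card_eq_zero, filter_eq_empty_iff]
    intro k hk hgk
    rw [Subgroup.mem_elements] at hg hg'
    rw [mem_transporter] at hk
    refine hg' (mem_pointStab.2 ⟨hg, ?_⟩)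
    have h : (g * k) y = (k * g) y := by rw [hgk.eq]
    rwa [Perm.mul_apply, Perm.mul_apply, hk.2, (mem_pointStab.1 hg).2, hk.2] at h

theorem commCard_transporter_le (H : Subgroup (Perm α)) (y z : α) :
    commCard (pointStab (pointStab H y) z).elements (transporter H y z) ≤
      commCard (pointStab (pointStab H y) z).elements (pointStab H y).elements :=
  commCard_le_commCard_elements _ _ _ inv_mul_mem_pointStab

/-- The orbits of `H` that meet `S`. -/
noncomputable def orbitsOn (H : Subgroup (Perm α)) (S : Finset α) : Finset (Finset α) :=
  S.image (permOrbit H)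

/-- The sizes of the orbits of `H` that meet `S`. -/
noncomputable def orbitSizes (H : Subgroup (Perm α)) (S : Finset α) : Multiset ℕ :=
  (orbitsOn H S).val.map card

/-- The product of the bounds on the number of classes for the orbits of `H` that meet `S`. -/
noncomputable def orbitBound (H : Subgroup (Perm α)) (S : Finset α) : ℝ :=
  ∏ O ∈ orbitsOn H S, classBound #O

theorem prod_map_orbitSizes (H : Subgroup (Perm α)) (S : Finset α) :
    ((orbitSizes H S).map classBound).prod = orbitBound H S := by
  rw [orbitSizes, Multiset.map_map]
  rfl

theorem sum_map_orbitSizes (H : Subgroup (Perm α)) (S : Finset α) (f : ℕ → ℝ) :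
    ((orbitSizes H S).map f).sum = ∑ O ∈ orbitsOn H S, f #O := by
  rw [orbitSizes, Multiset.map_map]
  rfl

theorem one_le_of_mem_orbitSizes {H : Subgroup (Perm α)} {S : Finset α} :
    ∀ d ∈ orbitSizes H S, 1 ≤ d := by
  intro d hd
  simp only [orbitSizes, orbitsOn, Multiset.mem_map, mem_val, mem_image] at hd
  obtain ⟨O, ⟨x, -, rfl⟩, rfl⟩ := hd
  exact card_permOrbit_pos H x

theorem orbitBound_pos (H : Subgroup (Perm α)) (S : Finset α) : 0 < orbitBound H S :=
  prod_pos fun _ _ => classBound_pos _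

theorem sum_div_card_permOrbit {H : Subgroup (Perm α)} {S : Finset α} (h : IsStable H S)
    (f : ℕ → ℝ) :
    ∑ z ∈ S, f #(permOrbit H z) / #(permOrbit H z) = ∑ O ∈ orbitsOn H S, f #O := by
  symm
  refine sum_image' _ fun x hx => ?_
  have heq : ({z ∈ S | permOrbit H z = permOrbit H x} : Finset α) = permOrbit H x := by
    ext z
    rw [mem_filter, permOrbit_eq_iff]
    exact ⟨fun hz => hz.2, fun hz => ⟨h.permOrbit_subset hx hz, hz⟩⟩
  rw [heq, sum_congr rfl fun z hz => by rw [permOrbit_eq_of_mem hz], sum_const, nsmul_eq_mul]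
  have : (#(permOrbit H x) : ℝ) ≠ 0 := by exact_mod_cast (card_permOrbit_pos H x).ne'
  field_simp

theorem sum_orbitSizes {H : Subgroup (Perm α)} {S : Finset α} (h : IsStable H S) :
    (orbitSizes H S).sum = #S := by
  have h₁ := sum_div_card_permOrbit h fun d => d
  have h₂ : ∀ z ∈ S, (#(permOrbit H z) : ℝ) / #(permOrbit H z) = 1 := fun z _ =>
    div_self (by exact_mod_cast (card_permOrbit_pos H z).ne')
  rw [sum_congr rfl h₂] at h₁
  have h₃ : (orbitSizes H S).sum = ∑ O ∈ orbitsOn H S, #O := rfl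
  rw [h₃]
  simp only [sum_const, nsmul_eq_mul, mul_one] at h₁
  exact_mod_cast h₁.symm

theorem orbitBound_union {H : Subgroup (Perm α)} {S T : Finset α} (hS : IsStable H S)
    (hST : Disjoint S T) : orbitBound H (S ∪ T) = orbitBound H S * orbitBound H T := by
  rw [orbitBound, orbitsOn, image_union, prod_union]
  · rfl
  · rw [disjoint_left]
    intro O h₁ h₂
    obtain ⟨x, hx, rfl⟩ := mem_image.1 h₁
    obtain ⟨y, hy, h⟩ := mem_image.1 h₂
    exact disjoint_left.1 hST (hS.permOrbit_subset hx (permOrbit_eq_iff.1 h)) hy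

theorem orbitBound_mul_compl {H : Subgroup (Perm α)} {S : Finset α} (hS : IsStable H S) :
    orbitBound H univ = orbitBound H S * orbitBound H Sᶜ := by
  rw [← orbitBound_union hS disjoint_compl_right, union_compl]

theorem orbitBound_permOrbit (H : Subgroup (Perm α)) (y : α) :
    orbitBound H (permOrbit H y) = classBound #(permOrbit H y) := by
  have : orbitsOn H (permOrbit H y) = {permOrbit H y} := by
    refine eq_singleton_iff_unique_mem.2 ⟨mem_image_of_mem _ (self_mem_permOrbit H y), ?_⟩
    intro O hO
    obtain ⟨x, hx, rfl⟩ := mem_image.1 hO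
    exact permOrbit_eq_of_mem hx
  rw [orbitBound, this, prod_singleton]

theorem orbitBound_le_classBound {H : Subgroup (Perm α)} {S : Finset α} (hS : IsStable H S) :
    orbitBound H S ≤ classBound #S := by
  rw [← prod_map_orbitSizes, ← sum_orbitSizes hS]
  exact prod_classBound_le _

theorem orbitBound_mono {J H : Subgroup (Perm α)} (hJ : J ≤ H) {S : Finset α} (hS : IsStable H S) :
    orbitBound J S ≤ orbitBound H S := by
  induction S using Finset.strongInduction with
  | H S ih =>
    rcases S.eq_empty_or_nonempty with rfl | ⟨x, hx⟩
    · simp [orbitBound, orbitsOn]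
    · have hO := isStable_permOrbit H x
      have hsub := hS.permOrbit_subset hx
      have hrest := ih (S \ permOrbit H x)
        (sdiff_ssubset hsub ⟨x, self_mem_permOrbit H x⟩) (hS.sdiff hO)
      rw [← union_sdiff_of_subset hsub, orbitBound_union hO disjoint_sdiff,
        orbitBound_union (hO.mono hJ) disjoint_sdiff, orbitBound_permOrbit]
      exact mul_le_mul (orbitBound_le_classBound (hO.mono hJ)) hrest (orbitBound_pos _ _).le
        (classBound_pos _).le

theorem orbitBound_eq_one {H : Subgroup (Perm α)} {S : Finset α} (h : ∀ g ∈ H, ∀ x ∈ S, g x = x) :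
    orbitBound H S = 1 := by
  refine prod_eq_one fun O hO => ?_
  obtain ⟨x, hx, rfl⟩ := mem_image.1 hO
  have : permOrbit H x = {x} := by
    ext z
    rw [mem_permOrbit, mem_singleton]
    constructor
    · rintro ⟨g, hg, rfl⟩
      exact h g hg x hx
    · rintro rfl
      exact ⟨1, H.one_mem, rfl⟩
  rw [this]
  simp [classBound]

end Orbits

section PointStabilizers

open Equiv

theorem commCard_eq_sum_fiberwise {P ι : Type*} [Group P] (A : Finset P) {B : Finset P}
    {T : Finset ι} (f : P → ι) (hf : ∀ b ∈ B, f b ∈ T) :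
    commCard A B = ∑ i ∈ T, commCard A {b ∈ B | f b = i} := by
  simp only [commCard_comm A]
  exact (sum_fiberwise_of_maps_to hf _).symm

variable {α : Type*} [Fintype α]

theorem sum_commCard_pointStab_le {J : Subgroup (Perm α)} {S : Finset α} (hS : IsStable J S)
    (hJ : ∀ z ∈ S, (commCard (pointStab J z).elements J.elements : ℝ) ≤
      rootFactor #(permOrbit J z) * orbitBound J univ * Nat.card (pointStab J z)) :
    (∑ z ∈ S, commCard (pointStab J z).elements J.elements : ℝ) ≤
      Nat.card J * orbitBound J univ * ((orbitSizes J S).map rootFactor).sum := by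
  rw [sum_map_orbitSizes, ← sum_div_card_permOrbit hS, mul_sum]
  refine sum_le_sum fun z hz => (hJ z hz).trans_eq ?_
  have h₁ : (#(permOrbit J z) : ℝ) ≠ 0 := by exact_mod_cast (card_permOrbit_pos J z).ne'
  have h₂ : (#(permOrbit J z) : ℝ) * Nat.card (pointStab J z) = Nat.card J := by
    exact_mod_cast card_permOrbit_mul_card J z
  rw [← h₂]
  field_simp

theorem commCard_elements_le {H : Subgroup (Perm α)}
    (hH : (Nat.card (ConjClasses H) : ℝ) ≤ orbitBound H univ) :
    (commCard H.elements H.elements : ℝ) ≤ orbitBound H univ * Nat.card H := by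
  rw [← card_conjClasses_mul_card]
  push_cast
  gcongr

theorem commCard_pointStab_le {H : Subgroup (Perm α)}
    (hP : ∀ K ≤ H, (Nat.card (ConjClasses K) : ℝ) ≤ orbitBound K univ) (y : α) :
    (commCard (pointStab H y).elements H.elements : ℝ) ≤
      rootFactor #(permOrbit H y) * orbitBound H univ * Nat.card (pointStab H y) := by
  induction hm : Nat.card H using Nat.strong_induction_on generalizing H y with
  | _ m ih =>
  subst hm
  have hcard := card_permOrbit_mul_card H y
  set d := #(permOrbit H y) with hd
  have hd0 : 0 < d := card_permOrbit_pos H y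
  set J := pointStab H y with hJ
  have hJH : J ≤ H := pointStab_le H y
  have hJpos : 0 < Nat.card J := Nat.card_pos
  obtain hd1 | hd2 : d = 1 ∨ 2 ≤ d := by omega
  · have hJeq : J = H := Subgroup.eq_of_le_of_card_ge hJH (by rw [← hcard, hd1, one_mul])
    rw [hJeq, hd1]
    simpa [rootFactor] using commCard_elements_le (hP H le_rfl)
  have hlt : Nat.card J < Nat.card H := by nlinarith
  set S := (permOrbit H y).erase y with hS
  have hy : IsStable J {y} := isStable_singleton fun g hg => (mem_pointStab.1 hg).2
  have hO : IsStable H (permOrbit H y) := isStable_permOrbit H y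
  have hSJ : IsStable J S := by
    rw [hS, ← sdiff_singleton_eq_erase]
    exact (hO.mono hJH).sdiff hy
  have hPJ : ∀ K ≤ J, (Nat.card (ConjClasses K) : ℝ) ≤ orbitBound K univ :=
    fun K hK => hP K (hK.trans hJH)
  have hJy : pointStab J y = J := by
    ext g
    rw [mem_pointStab, and_iff_left_iff_imp]
    exact fun hg => (mem_pointStab.1 hg).2
  have hle : (commCard J.elements H.elements : ℝ) ≤
      Nat.card J * orbitBound J univ * (1 + ((orbitSizes J S).map rootFactor).sum) := by
    have h₁ : commCard J.elements H.elements ≤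
        ∑ z ∈ permOrbit H y, commCard (pointStab J z).elements J.elements := by
      rw [commCard_eq_sum_fiberwise (T := permOrbit H y) _ fun h : Perm α => h y]
      · refine sum_le_sum fun z _ => ?_
        change commCard J.elements (transporter H y z) ≤ _
        rw [commCard_transporter]
        exact commCard_transporter_le H y z
      · intro h hh
        exact mem_permOrbit.2 ⟨h, by simpa using hh, rfl⟩
    rw [← add_sum_erase _ _ (self_mem_permOrbit H y), hJy] at h₁
    have h₂ := sum_commCard_pointStab_le hSJ fun z _ => ih _ hlt hPJ z rfl
    have h₃ := commCard_elements_le (hPJ J le_rfl)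
    have h₄ : (commCard J.elements H.elements : ℝ) ≤ commCard J.elements J.elements +
      ∑ z ∈ S, commCard (pointStab J z).elements J.elements := by exact_mod_cast h₁
    push_cast at h₄
    linarith
  have hsum : (orbitSizes J S).sum = d - 1 := by
    rw [sum_orbitSizes hSJ, hS, card_erase_of_mem (self_mem_permOrbit H y)]
  have hM := prod_mul_one_add_sum_le_rootFactor_mul _ one_le_of_mem_orbitSizes hd2 hsum
  rw [prod_map_orbitSizes] at hM
  have hJS : orbitBound J (permOrbit H y) = orbitBound J S := by
    rw [← insert_erase (self_mem_permOrbit H y), insert_eq,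
      orbitBound_union hy (by simp), orbitBound_eq_one, one_mul]
    intro g hg x hx
    rw [mem_singleton.1 hx]
    exact (mem_pointStab.1 hg).2
  have hJu : orbitBound J univ ≤ orbitBound J S * orbitBound H (permOrbit H y)ᶜ := by
    rw [orbitBound_mul_compl (hO.mono hJH), hJS]
    exact mul_le_mul_of_nonneg_left (orbitBound_mono hJH hO.compl) (orbitBound_pos _ _).le
  have hHu : orbitBound H univ = classBound d * orbitBound H (permOrbit H y)ᶜ := by
    rw [orbitBound_mul_compl hO, orbitBound_permOrbit]
  have hE : 0 ≤ ((orbitSizes J S).map rootFactor).sum := by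
    rw [sum_map_orbitSizes]
    exact sum_nonneg fun _ _ => (rootFactor_pos _).le
  have hc := orbitBound_pos H (permOrbit H y)ᶜ
  calc _ ≤ _ := hle
    _ ≤ Nat.card J * (orbitBound J S * orbitBound H (permOrbit H y)ᶜ) *
        (1 + ((orbitSizes J S).map rootFactor).sum) := by gcongr
    _ = (orbitBound J S * (1 + ((orbitSizes J S).map rootFactor).sum)) *
        orbitBound H (permOrbit H y)ᶜ * Nat.card J := by ring
    _ ≤ (rootFactor d * classBound d) * orbitBound H (permOrbit H y)ᶜ * Nat.card J := by gcongr
    _ = _ := by rw [hHu]; ring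

end PointStabilizers

section Transitive

open Equiv

variable {α : Type*} [Fintype α]

theorem exists_mem_apply_eq {G : Subgroup (Perm α)} {p : α} (hG : permOrbit G p = univ) (x y : α) :
    ∃ g ∈ G, g x = y := by
  have hx : permOrbit G x = univ := by
    rw [← hG]
    exact permOrbit_eq_of_mem (hG ▸ mem_univ x)
  exact mem_permOrbit.1 (hx ▸ mem_univ y)

theorem card_conjClasses_mul_card_pointStab_le {G : Subgroup (Perm α)} {p : α}
    (hG : permOrbit G p = univ) :
    Nat.card (ConjClasses G) * Nat.card (pointStab G p) ≤ Nat.card (pointStab G p) +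
      ∑ y ∈ univ.erase p,
        commCard (pointStab (pointStab G p) y).elements (transporter G p y) := by
  refine (card_conjClasses_mul_le G (pointStab G p) (pointStab_le G p)
    {g ∈ G.elements | g p ≠ p} ?_ ?_ ?_).trans_eq ?_
  · intro g hg
    simpa using (mem_filter.1 hg).1
  · intro h hh g hg
    simp only [mem_filter, Subgroup.mem_elements, mem_pointStab] at hh hg ⊢
    refine ⟨G.mul_mem (G.mul_mem hh.1 hg.1) (G.inv_mem hh.1), fun h' => hg.2 ?_⟩
    have h₁ : h⁻¹ p = p := by rw [Perm.inv_eq_iff_eq, hh.2]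
    rw [Perm.mul_apply, Perm.mul_apply, h₁, ← Perm.eq_inv_iff_eq, h₁] at h'
    exact h'
  · intro g hg hg1
    obtain ⟨x, hx⟩ : ∃ x, g x ≠ x := by
      by_contra! h
      exact hg1 (Perm.ext h)
    obtain ⟨u, hu, rfl⟩ := exists_mem_apply_eq hG x p
    refine ⟨u, hu, ?_⟩
    simp only [mem_filter, Subgroup.mem_elements]
    exact ⟨G.mul_mem (G.mul_mem hu hg) (G.inv_mem hu), by simpa using hx⟩
  · congr 1
    rw [commCard_eq_sum_fiberwise (T := univ.erase p) _ fun g : Perm α => g p]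
    · refine sum_congr rfl fun y hy => ?_
      rw [← commCard_transporter]
      congr 1
      ext g
      simp only [mem_filter, Subgroup.mem_elements, mem_transporter, and_assoc]
      refine and_congr_right fun _ => ⟨fun h => h.2, fun h => ⟨h ▸ ne_of_mem_erase hy, h⟩⟩
    · intro g hg
      simpa using (mem_filter.1 hg).2

theorem isStable_erase (G : Subgroup (Perm α)) (p : α) :
    IsStable (pointStab G p) (univ.erase p) := by
  rw [← sdiff_singleton_eq_erase]
  exact (isStable_univ _).sdiff (isStable_singleton fun g hg => (mem_pointStab.1 hg).2)

theorem orbitBound_erase (G : Subgroup (Perm α)) (p : α) :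
    orbitBound (pointStab G p) (univ.erase p) = orbitBound (pointStab G p) univ := by
  conv_rhs => rw [← insert_erase (mem_univ p), insert_eq]
  rw [orbitBound_union (isStable_singleton fun g hg => (mem_pointStab.1 hg).2) (by simp),
    orbitBound_eq_one (S := {p}), one_mul]
  intro g hg x hx
  rw [mem_singleton.1 hx]
  exact (mem_pointStab.1 hg).2

theorem sum_commCard_erase_le {G : Subgroup (Perm α)} {p : α}
    (hP : ∀ K ≤ pointStab G p, (Nat.card (ConjClasses K) : ℝ) ≤ orbitBound K univ) :
    (∑ y ∈ univ.erase p,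
        commCard (pointStab (pointStab G p) y).elements (pointStab G p).elements : ℝ) ≤
      Nat.card (pointStab G p) *
        (((orbitSizes (pointStab G p) (univ.erase p)).map classBound).prod *
        ((orbitSizes (pointStab G p) (univ.erase p)).map rootFactor).sum) := by
  refine (sum_commCard_pointStab_le (isStable_erase G p)
    fun z _ => commCard_pointStab_le hP z).trans_eq ?_
  rw [prod_map_orbitSizes, orbitBound_erase, mul_assoc]

theorem card_conjClasses_le_one_add_prod_mul_sum {G : Subgroup (Perm α)} {p : α}
    (hG : permOrbit G p = univ)
    (hP : ∀ K ≤ pointStab G p, (Nat.card (ConjClasses K) : ℝ) ≤ orbitBound K univ) :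
    (Nat.card (ConjClasses G) : ℝ) ≤
      1 + ((orbitSizes (pointStab G p) (univ.erase p)).map classBound).prod *
        ((orbitSizes (pointStab G p) (univ.erase p)).map rootFactor).sum := by
  have hpos : (0 : ℝ) < Nat.card (pointStab G p) := by exact_mod_cast Nat.card_pos
  refine le_of_mul_le_mul_right ?_ hpos
  have h₁ := (card_conjClasses_mul_card_pointStab_le hG).trans
    (Nat.add_le_add_left (sum_le_sum fun y _ => commCard_transporter_le G p y) _)
  have h₂ := (Nat.cast_le (α := ℝ)).2 h₁
  have h₃ := sum_commCard_erase_le hP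
  push_cast at h₂
  linarith

/-- A bound for the number of classes of a transitive group by the rank and the order of a point
stabilizer. -/
theorem card_conjClasses_le_one_add_rank_mul {G : Subgroup (Perm α)} {p : α}
    (hG : permOrbit G p = univ) :
    Nat.card (ConjClasses G) ≤ 1 + (orbitSizes (pointStab G p) (univ.erase p)).card *
      Nat.card (pointStab G p) := by
  have hpos : 0 < Nat.card (pointStab G p) := Nat.card_pos
  refine Nat.le_of_mul_le_mul_right ?_ hpos
  have h₁ := (card_conjClasses_mul_card_pointStab_le hG).trans
    (Nat.add_le_add_left (sum_le_sum fun y _ => (commCard_transporter_le G p y).trans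
      (commCard_le_card_mul_card _ _)) _)
  refine h₁.trans ?_
  rw [← sum_mul, Subgroup.card_elements, add_mul, one_mul]
  refine Nat.add_le_add_left (Nat.mul_le_mul_right _ (le_of_eq ?_)) _
  have h₂ := sum_div_card_permOrbit (isStable_erase G p) fun _ => 1
  have h₃ : ∑ z ∈ univ.erase p, (Nat.card (pointStab (pointStab G p) z) : ℝ) =
      (∑ z ∈ univ.erase p, (1 : ℝ) / #(permOrbit (pointStab G p) z)) *
        Nat.card (pointStab G p) := by
    rw [sum_mul]
    refine sum_congr rfl fun z _ => ?_
    rw [← card_permOrbit_mul_card (pointStab G p) z]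
    have : (#(permOrbit (pointStab G p) z) : ℝ) ≠ 0 := by
      exact_mod_cast (card_permOrbit_pos _ z).ne'
    push_cast
    field_simp
  rw [h₂, sum_const, nsmul_eq_mul, mul_one] at h₃
  have h₄ : (orbitSizes (pointStab G p) (univ.erase p)).card =
      #(orbitsOn (pointStab G p) (univ.erase p)) := Multiset.card_map _ _
  simp only [Subgroup.card_elements]
  rw [h₄]
  exact_mod_cast h₃

theorem sum_orbitSizes_erase (G : Subgroup (Perm α)) (p : α) :
    (orbitSizes (pointStab G p) (univ.erase p)).sum = Fintype.card α - 1 := by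
  rw [sum_orbitSizes (isStable_erase G p), card_erase_of_mem (mem_univ p), card_univ]

theorem mem_orbitSizes {H : Subgroup (Perm α)} {S : Finset α} {d : ℕ} :
    d ∈ orbitSizes H S ↔ ∃ x ∈ S, #(permOrbit H x) = d := by
  simp [orbitSizes, orbitsOn]

end Transitive

section Exceptional

open Equiv

theorem eq_swap_of_apply_eq {α : Type*} {t : Perm α} {a b : α} (h1 : t ≠ 1)
    (h : ∀ x, x ≠ a → x ≠ b → t x = x) : t = swap a b := by
  have hout : ∀ x, t x ≠ x → x = a ∨ x = b := by
    intro x hx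
    by_contra! h'
    exact hx (h x h'.1 h'.2)
  have himg : ∀ x, t x ≠ x → t x = a ∨ t x = b := fun x hx =>
    hout _ fun h' => hx (t.injective h')
  have hab : t a = b ∧ t b = a := by
    obtain ⟨x, hx⟩ : ∃ x, t x ≠ x := by
      by_contra! h'
      exact h1 (Perm.ext h')
    have hinj := t.injective
    have ha := himg a
    have hb := himg b
    rcases hout x hx with rfl | rfl
    · have hxb : t x = b := (ha hx).resolve_left hx
      refine ⟨hxb, (hb fun h' => hx ?_).resolve_right fun h' => hx ?_⟩ <;>
        exact hxb.trans (hinj (hxb.trans h'.symm)).symm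
    · have hxa : t x = a := (hb hx).resolve_right hx
      refine ⟨(ha fun h' => hx ?_).resolve_left fun h' => hx ?_, hxa⟩ <;>
        exact hxa.trans (hinj (hxa.trans h'.symm)).symm
  ext x
  rcases eq_or_ne x a with rfl | hxa
  · rw [hab.1, swap_apply_left]
  rcases eq_or_ne x b with rfl | hxb
  · rw [hab.2, swap_apply_right]
  rw [h x hxa hxb, swap_apply_of_ne_of_ne hxa hxb]

variable {α : Type*} [Fintype α]

theorem exists_ne_one_of_card {K : Subgroup (Perm α)} (h : 1 < Nat.card K) : ∃ t ∈ K, t ≠ 1 :=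
  K.bot_or_exists_ne_one.resolve_left (K.one_lt_card_iff_ne_bot.1 h)

theorem card_conjClasses_le_of_orbitSizes_eq_two_two {G : Subgroup (Perm α)} {p : α}
    (hG : permOrbit G p = univ)
    (hM : orbitSizes (pointStab G p) (univ.erase p) = {2, 2}) : Nat.card (ConjClasses G) ≤ 7 := by
  have hα : Fintype.card α - 1 = 4 := by rw [← sum_orbitSizes_erase G p, hM]; rfl
  have hk := card_conjClasses_le_one_add_rank_mul hG
  rw [hM] at hk
  simp only [Multiset.insert_eq_cons, Multiset.card_cons, Multiset.card_singleton] at hk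
  rcases Nat.lt_or_ge (Nat.card (pointStab G p)) 4 with h | h
  · omega
  exfalso
  obtain ⟨a, ha, hOa⟩ : ∃ a ∈ univ.erase p, #(permOrbit (pointStab G p) a) = 2 :=
    mem_orbitSizes.1 (by rw [hM]; simp)
  have hcard := card_permOrbit_mul_card (pointStab G p) a
  rw [hOa] at hcard
  obtain ⟨t, ht, ht1⟩ := exists_ne_one_of_card (K := pointStab (pointStab G p) a) (by omega)
  rw [mem_pointStab] at ht
  have htG := (mem_pointStab.1 ht.1).1
  have htO : ∀ x ∈ permOrbit (pointStab G p) a, t x = x := by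
    intro x hx
    have htx := isStable_permOrbit _ a t ht.1 x hx
    rcases eq_or_ne x a with rfl | hxa
    · exact ht.2
    · have h1 : #((permOrbit (pointStab G p) a).erase a) ≤ 1 := by
        rw [card_erase_of_mem (self_mem_permOrbit _ a), hOa]
      refine card_le_one.1 h1 _ (mem_erase.2 ⟨?_, htx⟩) _ (mem_erase.2 ⟨hxa, hx⟩)
      intro h'
      exact hxa (t.injective (h'.trans ht.2.symm))
  have hrest : #(univ.erase p \ permOrbit (pointStab G p) a) = 2 := by
    rw [card_sdiff_of_subset ((isStable_erase G p).permOrbit_subset ha), hOa,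
      card_erase_of_mem (mem_univ p), card_univ]
    omega
  obtain ⟨c, d, hcd, hrest⟩ := card_eq_two.1 hrest
  have hswap : t = swap c d := by
    refine eq_swap_of_apply_eq ht1 fun x hxc hxd => ?_
    by_cases hxp : x = p
    · rw [hxp]
      exact (mem_pointStab.1 ht.1).2
    · by_contra hx
      have : x ∈ univ.erase p \ permOrbit (pointStab G p) a :=
        mem_sdiff.2 ⟨mem_erase.2 ⟨hxp, mem_univ x⟩, fun h' => hx (htO x h')⟩
      rw [hrest] at this
      simp [hxc, hxd] at this
  have htrans : MulAction.IsPretransitive G α := ⟨fun x y => by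
    obtain ⟨g, hg, h⟩ := exists_mem_apply_eq hG x y
    exact ⟨⟨g, hg⟩, h⟩⟩
  have hprim : MulAction.IsPreprimitive G α := by
    refine MulAction.IsPreprimitive.of_prime_card ?_
    rw [Nat.card_eq_fintype_card, show Fintype.card α = 5 by omega]
    norm_num
  have htop := Perm.subgroup_eq_top_of_isPreprimitive_of_isSwap_mem hprim t ⟨c, d, hcd, hswap⟩ htG
  have hsub : univ.erase p ⊆ permOrbit (pointStab G p) a := by
    intro z hz
    refine mem_permOrbit.2 ⟨swap a z, mem_pointStab.2 ⟨htop ▸ Subgroup.mem_top _, ?_⟩,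
      swap_apply_left a z⟩
    exact swap_apply_of_ne_of_ne (ne_of_mem_erase ha).symm (ne_of_mem_erase hz).symm
  have := card_le_card hsub
  rw [hOa, card_erase_of_mem (mem_univ p), card_univ, hα] at this
  omega

/-- The lengths of the orbits of point stabilizers are invariant under the group. -/
theorem card_permOrbit_pointStab_apply {G : Subgroup (Perm α)} {g : Perm α} (hg : g ∈ G) (u v : α) :
    #(permOrbit (pointStab G (g u)) (g v)) = #(permOrbit (pointStab G u) v) := by
  symm
  refine card_bij (fun x _ => g x) ?_ (fun _ _ _ _ h => g.injective h) ?_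
  · intro x hx
    obtain ⟨k, hk, rfl⟩ := mem_permOrbit.1 hx
    rw [mem_pointStab] at hk
    refine mem_permOrbit.2 ⟨g * k * g⁻¹, mem_pointStab.2
      ⟨G.mul_mem (G.mul_mem hg hk.1) (G.inv_mem hg), ?_⟩, ?_⟩
    · simp [hk.2]
    · simp
  · intro x hx
    obtain ⟨k, hk, rfl⟩ := mem_permOrbit.1 hx
    rw [mem_pointStab] at hk
    refine ⟨g⁻¹ (k (g v)), mem_permOrbit.2 ⟨g⁻¹ * k * g, mem_pointStab.2
      ⟨G.mul_mem (G.mul_mem (G.inv_mem hg) hk.1) hg, ?_⟩, ?_⟩, ?_⟩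
    · simp [hk.2]
    · simp
    · simp

theorem card_permOrbit_pointStab_comm {G : Subgroup (Perm α)} {p : α}
    (hG : permOrbit G p = univ) (u v : α) :
    #(permOrbit (pointStab G u) v) = #(permOrbit (pointStab G v) u) := by
  have hu : ∀ x, permOrbit G x = univ := fun x => by
    rw [← hG]; exact permOrbit_eq_of_mem (hG ▸ mem_univ x)
  have h₁ := card_permOrbit_mul_card (pointStab G u) v
  have h₂ := card_permOrbit_mul_card (pointStab G v) u
  have h₃ := card_permOrbit_mul_card G u
  have h₄ := card_permOrbit_mul_card G v
  have h₅ : pointStab (pointStab G u) v = pointStab (pointStab G v) u := by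
    ext g
    simp only [mem_pointStab]
    tauto
  rw [hu] at h₃ h₄
  have hpos : 0 < #(univ : Finset α) := card_pos.2 ⟨p, mem_univ p⟩
  have h₆ : Nat.card (pointStab G u) = Nat.card (pointStab G v) :=
    Nat.eq_of_mul_eq_mul_left hpos (h₃.trans h₄.symm)
  refine Nat.eq_of_mul_eq_mul_right (Nat.card_pos (α := pointStab (pointStab G u) v)) ?_
  rw [h₁, h₅, h₂, h₆]

/-- The number of points whose stabilizer has an orbit of length `d` through a given point does not
depend on the point. -/
theorem card_filter_permOrbit_pointStab {G : Subgroup (Perm α)} {p : α}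
    (hG : permOrbit G p = univ) (d : ℕ) (v : α) :
    #{u | #(permOrbit (pointStab G u) v) = d} = #{u | #(permOrbit (pointStab G p) u) = d} := by
  obtain ⟨g, hg, rfl⟩ := exists_mem_apply_eq hG p v
  symm
  refine card_bij (fun x _ => g x) ?_ (fun _ _ _ _ h => g.injective h) ?_
  · intro x hx
    simp only [mem_filter, mem_univ, true_and] at hx ⊢
    rw [card_permOrbit_pointStab_comm hG, card_permOrbit_pointStab_apply hg, hx]
  · intro x hx
    simp only [mem_filter, mem_univ, true_and] at hx ⊢
    refine ⟨g⁻¹ x, ?_, by simp⟩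
    rw [← hx, card_permOrbit_pointStab_comm hG x, ← card_permOrbit_pointStab_apply hg]
    simp

theorem exists_swap_mem_of_orbitSizes_eq_three_two {H : Subgroup (Perm α)} {p a b z : α}
    (hp : ∀ g ∈ H, g p = p) (hz : #(permOrbit H z) = 3)
    (hcover : ∀ x, x = p ∨ x = a ∨ x = b ∨ x ∈ permOrbit H z)
    (hcard : 7 ≤ Nat.card H) :
    ∃ t ∈ H, t = swap a b ∧ t ≠ 1 ∧ ∀ x ∈ permOrbit H z, t x = x := by
  have h₁ := card_permOrbit_mul_card H z
  rw [hz] at h₁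
  set B := permOrbit H z
  have hzB : z ∈ B := self_mem_permOrbit H z
  have hBz : #(B.erase z) = 2 := by rw [card_erase_of_mem hzB, hz]
  obtain ⟨w, hw⟩ : (B.erase z).Nonempty := card_pos.1 (by omega)
  have hBstab : IsStable (pointStab H z) (B.erase z) := by
    rw [← sdiff_singleton_eq_erase]
    exact ((isStable_permOrbit H z).mono (pointStab_le H z)).sdiff
      (isStable_singleton fun g hg => (mem_pointStab.1 hg).2)
  have h₂ := card_permOrbit_mul_card (pointStab H z) w
  have h₃ := card_le_card (hBstab.permOrbit_subset hw)
  rw [hBz] at h₃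
  have h₄ : 1 < Nat.card (pointStab (pointStab H z) w) := by
    by_contra! h
    have := Nat.mul_le_mul h₃ h
    omega
  obtain ⟨t, ht, ht1⟩ := exists_ne_one_of_card h₄
  rw [mem_pointStab] at ht
  obtain ⟨⟨htH, htz⟩, htw⟩ := And.imp_left mem_pointStab.1 ht
  have htB : ∀ x ∈ B, t x = x := by
    intro x hx
    rcases eq_or_ne x z with rfl | hxz
    · exact htz
    rcases eq_or_ne x w with rfl | hxw
    · exact htw
    have h1 : #((B.erase z).erase w) ≤ 1 := by rw [card_erase_of_mem hw, hBz]
    have hxm := mem_erase.2 ⟨hxz, hx⟩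
    refine card_le_one.1 h1 _ (mem_erase.2 ⟨?_, hBstab t ht.1 x hxm⟩) _
      (mem_erase.2 ⟨hxw, hxm⟩)
    exact fun h' => hxw (t.injective (h'.trans htw.symm))
  refine ⟨t, htH, eq_swap_of_apply_eq ht1 fun x hxa hxb => ?_, ht1, htB⟩
  rcases hcover x with rfl | h | h | h
  · exact hp t htH
  · exact absurd h hxa
  · exact absurd h hxb
  · exact htB x h

theorem card_conjClasses_le_of_orbitSizes_eq_three_two {G : Subgroup (Perm α)} {p : α}
    (hG : permOrbit G p = univ)
    (hP : ∀ K ≤ pointStab G p, (Nat.card (ConjClasses K) : ℝ) ≤ orbitBound K univ)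
    (hM : orbitSizes (pointStab G p) (univ.erase p) = {3, 2}) : Nat.card (ConjClasses G) ≤ 13 := by
  have hα : Fintype.card α - 1 = 5 := by rw [← sum_orbitSizes_erase G p, hM]; rfl
  have hk := card_conjClasses_le_one_add_rank_mul hG
  rw [hM] at hk
  simp only [Multiset.insert_eq_cons, Multiset.card_cons, Multiset.card_singleton] at hk
  rcases Nat.lt_or_ge (Nat.card (pointStab G p)) 7 with h | h
  · omega
  have hstab := isStable_erase G p
  have hsum := sum_commCard_erase_le hP
  have hT := card_conjClasses_mul_card_pointStab_le hG
  have hp : ∀ g ∈ pointStab G p, g p = p := fun g hg => (mem_pointStab.1 hg).2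
  obtain ⟨a₀, ha₀, hA2⟩ : ∃ a ∈ univ.erase p, #(permOrbit (pointStab G p) a) = 2 :=
    mem_orbitSizes.1 (by rw [hM]; simp)
  obtain ⟨z₀, hz₀, hB3⟩ : ∃ z ∈ univ.erase p, #(permOrbit (pointStab G p) z) = 3 :=
    mem_orbitSizes.1 (by rw [hM]; simp)
  have hAS := hstab.permOrbit_subset ha₀
  have hBS := hstab.permOrbit_subset hz₀
  have hAstab := isStable_permOrbit (pointStab G p) a₀
  have hBstab := isStable_permOrbit (pointStab G p) z₀
  set H := pointStab G p with hH
  have hAD : ∀ x ∈ permOrbit H a₀, #(permOrbit H x) = 2 := fun x hx => by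
    rw [permOrbit_eq_of_mem hx, hA2]
  have hBD : ∀ x ∈ permOrbit H z₀, #(permOrbit H x) = 3 := fun x hx => by
    rw [permOrbit_eq_of_mem hx, hB3]
  have hBtrans : ∀ x ∈ permOrbit H z₀, ∀ y ∈ permOrbit H z₀, ∃ h ∈ H, h x = y := by
    intro x hx y hy
    rw [← permOrbit_eq_of_mem hx] at hy
    exact mem_permOrbit.1 hy
  obtain ⟨a, b, hab, hA⟩ := card_eq_two.1 hA2
  set A := permOrbit H a₀
  set B := permOrbit H z₀ with hB
  have hdisj : Disjoint A B := disjoint_left.2 fun x hx hx' => by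
    have := (hAD x hx).symm.trans (hBD x hx')
    omega
  have hAB : A ∪ B = univ.erase p := by
    refine eq_of_subset_of_card_le (union_subset hAS hBS) ?_
    rw [card_union_of_disjoint hdisj, hA2, hB3, card_erase_of_mem (mem_univ p), card_univ, hα]
  have haA : a ∈ A := by simp [hA]
  have hbA : b ∈ A := by simp [hA]
  have hcover : ∀ x, x = p ∨ x ∈ A ∨ x ∈ B := by
    intro x
    rw [or_iff_not_imp_left, ← mem_union, hAB]
    exact fun hx => mem_erase.2 ⟨hx, mem_univ x⟩
  obtain ⟨t, htH, htswap, ht1, htB⟩ := exists_swap_mem_of_orbitSizes_eq_three_two (a := a) (b := b)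
    hp hB3 (fun x => by simpa [hA, or_assoc] using hcover x) h
  have htA : ∀ x, t x ≠ x → x ∈ A := by
    intro x hx
    rcases hcover x with rfl | h | h
    · exact absurd (hp t htH) hx
    · exact h
    · exact absurd (htB x h) hx
  have hfilA : ({u | #(permOrbit H u) = 2} : Finset α) = A := by
    ext x
    rw [mem_filter, and_iff_right (mem_univ x)]
    refine ⟨fun hx => ?_, hAD x⟩
    rcases hcover x with rfl | h | h
    · have : permOrbit H x ⊆ {x} :=
        (isStable_singleton hp).permOrbit_subset (mem_singleton_self x)
      have := card_le_card this
      rw [hx] at this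
      simp at this
    · exact h
    · have := hBD x h
      omega
  have hfil : #{u | #(permOrbit H u) = 2} = 2 := by rw [hfilA, hA2]
  have hncomm : ∀ z ∈ B, ∀ x ∈ transporter G p z, ¬ Commute t x := by
    intro z hz x hx hcomm
    rw [mem_transporter] at hx
    obtain ⟨hxG, rfl⟩ := hx
    have hxa : x a ∈ A := by
      refine htA _ fun h' => hab ?_
      have h'' : (t * x) a = (x * t) a := by rw [hcomm.eq]
      rw [Perm.mul_apply, Perm.mul_apply, h', htswap, swap_apply_left] at h''
      exact x.injective h''
    have hD : #(permOrbit (pointStab G (x p)) (x a)) = 2 := by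
      rw [card_permOrbit_pointStab_apply hxG, ← hH, hAD a haA]
    have hsub : insert p B ⊆ ({u | #(permOrbit (pointStab G u) a) = 2} : Finset α) ∪
        ({u | #(permOrbit (pointStab G u) b) = 2} : Finset α) := by
      intro y hy
      rw [mem_union, mem_filter, mem_filter, and_iff_right (mem_univ y),
        and_iff_right (mem_univ y)]
      rcases mem_insert.1 hy with rfl | hy
      · exact Or.inl (hAD a haA)
      · obtain ⟨h, hh, rfl⟩ := hBtrans _ hz y hy
        have hhA := hAstab h hh _ hxa
        rw [← card_permOrbit_pointStab_apply (mem_pointStab.1 hh).1] at hD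
        rw [hA, mem_insert, mem_singleton] at hhA
        rcases hhA with h' | h' <;> rw [h'] at hD
        · exact Or.inl hD
        · exact Or.inr hD
    have h₁ := card_le_card hsub
    have h₂ := card_union_add_card_inter ({u | #(permOrbit (pointStab G u) a) = 2} : Finset α)
      ({u | #(permOrbit (pointStab G u) b) = 2} : Finset α)
    rw [card_filter_permOrbit_pointStab hG, card_filter_permOrbit_pointStab hG, ← hH, hfil] at h₂
    have h₃ : 0 < #(({u | #(permOrbit (pointStab G u) a) = 2} : Finset α) ∩
      ({u | #(permOrbit (pointStab G u) b) = 2} : Finset α)) :=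
      card_pos.2 ⟨p, by simp [← hH, hAD a haA, hAD b hbA]⟩
    rw [card_insert_of_notMem (fun h' => ne_of_mem_erase (hBS h') rfl), hB3] at h₁
    omega
  have hcentral : ∀ h ∈ H, Commute t h := by
    intro h hh
    have h₁ := hAstab h hh a haA
    have h₂ := hAstab h hh b hbA
    have h₃ : h a ≠ h b := fun h' => hab (h.injective h')
    rw [hA, mem_insert, mem_singleton] at h₁ h₂
    rw [htswap]
    refine (show h * swap a b = swap a b * h from ?_).symm
    rw [mul_swap_eq_swap_mul]
    congr 1
    rcases h₁ with h₁ | h₁ <;> rcases h₂ with h₂ | h₂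
    · exact absurd (h₁.trans h₂.symm) h₃
    · rw [h₁, h₂]
    · rw [h₁, h₂, swap_comm]
    · exact absurd (h₁.trans h₂.symm) h₃
  have hpair : ∀ z ∈ B, commCard (pointStab H z).elements (transporter G p z) + Nat.card H ≤
      commCard (pointStab H z).elements H.elements := by
    intro z hz
    have htz : t ∈ (pointStab H z).elements :=
      Subgroup.mem_elements.2 (mem_pointStab.2 ⟨htH, htB z hz⟩)
    have h₁ : #{x ∈ transporter G p z | Commute t x} = 0 := by
      rw [card_eq_zero, filter_eq_empty_iff]
      exact fun {x} hx => hncomm z hz x hx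
    have h₂ : #{x ∈ H.elements | Commute t x} = Nat.card H := by
      rw [filter_true_of_mem fun x hx => hcentral x (Subgroup.mem_elements.1 hx),
        Subgroup.card_elements]
    have h₃ := commCard_le_commCard_elements ((pointStab H z).elements.erase t)
      (transporter G p z) H inv_mul_mem_pointStab
    rw [commCard, commCard, ← add_sum_erase _ _ htz, ← add_sum_erase _ _ htz, h₁, h₂]
    simp only [commCard] at h₃
    omega
  rw [← hAB, sum_union hdisj] at hT hsum
  have h₁ : ∑ y ∈ A, commCard (pointStab H y).elements (transporter G p y) ≤
      ∑ y ∈ A, commCard (pointStab H y).elements H.elements :=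
    sum_le_sum fun y _ => commCard_transporter_le G p y
  have h₂ := sum_le_sum hpair
  rw [sum_add_distrib, sum_const, hB3, smul_eq_mul] at h₂
  have h₃ : Nat.card (ConjClasses G) * Nat.card H + 3 * Nat.card H ≤ Nat.card H +
    (∑ y ∈ A, commCard (pointStab H y).elements H.elements +
      ∑ y ∈ B, commCard (pointStab H y).elements H.elements) := by omega
  rw [hAB, hM] at hsum
  norm_num [classBound, rootFactor, -Nat.card_eq_fintype_card] at hsum
  have h₄ : ((Nat.card (ConjClasses G) * Nat.card H + 3 * Nat.card H : ℕ) : ℝ) ≤ _ :=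
    Nat.cast_le.2 h₃
  push_cast at h₄
  have h₅ : ((Nat.card (ConjClasses G) * Nat.card H : ℕ) : ℝ) ≤ ((12 * Nat.card H : ℕ) : ℝ) := by
    push_cast
    linarith
  have h₆ := Nat.le_of_mul_le_mul_right (Nat.cast_le.1 h₅) Nat.card_pos
  omega

end Exceptional

theorem card_conjClasses_le_classBound {α : Type*} [Fintype α] {G : Subgroup (Equiv.Perm α)} {p : α}
    (hα : 2 ≤ Fintype.card α) (hG : permOrbit G p = univ)
    (hP : ∀ K ≤ pointStab G p, (Nat.card (ConjClasses K) : ℝ) ≤ orbitBound K univ) :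
    (Nat.card (ConjClasses G) : ℝ) ≤ classBound (Fintype.card α) := by
  have hsum := sum_orbitSizes_erase G p
  have hc := lt_cbrtFive
  by_cases h₁ : orbitSizes (pointStab G p) (univ.erase p) = {2, 2}
  · have hα : Fintype.card α = 5 := by
      rw [h₁] at hsum
      have : (({2, 2} : Multiset ℕ)).sum = 4 := rfl
      omega
    have h : (Nat.card (ConjClasses G) : ℝ) ≤ 7 :=
      mod_cast card_conjClasses_le_of_orbitSizes_eq_two_two hG h₁
    rw [hα, classBound_five]
    linarith
  by_cases h₂ : orbitSizes (pointStab G p) (univ.erase p) = {3, 2}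
  · have hα : Fintype.card α = 6 := by
      rw [h₂] at hsum
      have : (({3, 2} : Multiset ℕ)).sum = 5 := rfl
      omega
    have h : (Nat.card (ConjClasses G) : ℝ) ≤ 13 :=
      mod_cast card_conjClasses_le_of_orbitSizes_eq_three_two hG hP h₂
    rw [hα, classBound_six]
    nlinarith
  · exact (card_conjClasses_le_one_add_prod_mul_sum hG hP).trans
      (one_add_prod_mul_sum_le_classBound _ one_le_of_mem_orbitSizes hα hsum h₁ h₂)

theorem card_conjClasses_le_orbitBound {α : Type*} [Fintype α] (G : Subgroup (Equiv.Perm α)) :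
    (Nat.card (ConjClasses G) : ℝ) ≤ orbitBound G univ := by
  induction hm : Nat.card G using Nat.strong_induction_on generalizing α with
  | _ m ih =>
  subst hm
  by_cases htriv : ∀ g ∈ G, ∀ x ∈ univ, g x = x
  · rw [orbitBound_eq_one htriv]
    have : Subsingleton G := ⟨fun g h => Subtype.ext <| Equiv.ext fun x => by
      rw [htriv g g.2 x (mem_univ x), htriv h h.2 x (mem_univ x)]⟩
    have : Nat.card (ConjClasses G) ≤ Nat.card G :=
      Nat.card_le_card_of_surjective _ ConjClasses.mk_surjective
    have h : Nat.card G = 1 := Nat.card_of_subsingleton 1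
    exact_mod_cast this.trans h.le
  push Not at htriv
  obtain ⟨g₀, hg₀, y, -, hy⟩ := htriv
  have hstab := isStable_permOrbit G y
  have hmem : ∀ g ∈ G, ∀ x, g x ∈ permOrbit G y ↔ x ∈ permOrbit G y := fun g hg x =>
    ⟨fun h => by simpa using hstab _ (G.inv_mem hg) _ h, hstab g hg x⟩
  let φ : G →* Equiv.Perm (permOrbit G y) :=
    { toFun g := (g : Equiv.Perm α).subtypePerm (hmem g g.2)
      map_one' := rfl
      map_mul' _ _ := rfl }
  have hφ : ∀ g x, (φ g x : α) = (g : Equiv.Perm α) x := fun _ _ => rfl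
  have hlarge : 2 ≤ Fintype.card (permOrbit G y) := by
    rw [Fintype.card_coe]
    exact one_lt_card.2 ⟨_, hstab g₀ hg₀ y (self_mem_permOrbit G y), y, self_mem_permOrbit G y, hy⟩
  have hrange : (Nat.card (ConjClasses φ.range) : ℝ) ≤ classBound #(permOrbit G y) := by
    let p : permOrbit G y := ⟨y, self_mem_permOrbit G y⟩
    have htrans : permOrbit φ.range p = univ := by
      refine eq_univ_of_forall fun z => mem_permOrbit.2 ?_
      obtain ⟨g, hg, hgz⟩ := mem_permOrbit.1 z.2
      exact ⟨φ ⟨g, hg⟩, ⟨_, rfl⟩, Subtype.ext hgz⟩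
    rw [← Fintype.card_coe]
    refine card_conjClasses_le_classBound hlarge htrans fun K hK => ih _ ?_ K rfl
    have h₁ := card_permOrbit_mul_card φ.range p
    rw [htrans, card_univ] at h₁
    have h₂ : Nat.card K ≤ Nat.card (pointStab φ.range p) := Subgroup.card_le_of_le hK
    have h₃ : Nat.card φ.range ≤ Nat.card G :=
      Nat.card_le_card_of_surjective _ φ.rangeRestrict_surjective
    have h₄ : 0 < Nat.card (pointStab φ.range p) := Nat.card_pos
    nlinarith
  have hker : (Nat.card (ConjClasses φ.ker) : ℝ) ≤ orbitBound G (permOrbit G y)ᶜ := by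
    let N := φ.ker.map G.subtype
    have hNG : N ≤ G := Subgroup.map_subtype_le _
    have hfix : ∀ g ∈ N, ∀ x ∈ permOrbit G y, g x = x := by
      rintro _ ⟨g, hg, rfl⟩ x hx
      have : φ g ⟨x, hx⟩ = ⟨x, hx⟩ := by rw [MonoidHom.mem_ker.1 hg]; rfl
      exact congrArg Subtype.val this
    have hlt : Nat.card N < Nat.card G := by
      refine (Subgroup.card_le_of_le hNG).lt_of_ne fun h => ?_
      have := Subgroup.eq_of_le_of_card_ge hNG h.ge
      exact hy (hfix g₀ (this ▸ hg₀) y (self_mem_permOrbit G y))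
    have e := φ.ker.equivMapOfInjective G.subtype G.subtype_injective
    have h₁ : Nat.card (ConjClasses φ.ker) ≤ Nat.card (ConjClasses N) :=
      card_conjClasses_le_of_surjective e.symm.toMonoidHom e.symm.surjective
    have h₂ := ih _ hlt N rfl
    rw [orbitBound_mul_compl (hstab.mono hNG), orbitBound_eq_one hfix, one_mul] at h₂
    exact (Nat.cast_le.2 h₁).trans (h₂.trans (orbitBound_mono hNG hstab.compl))
  rw [orbitBound_mul_compl hstab, orbitBound_permOrbit, mul_comm]
  calc (Nat.card (ConjClasses G) : ℝ)
      ≤ Nat.card (ConjClasses φ.ker) * Nat.card (ConjClasses φ.range) :=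
        mod_cast card_conjClasses_le_mul φ
    _ ≤ _ := mul_le_mul hker hrange (Nat.cast_nonneg _) (orbitBound_pos _ _).le

end ClassicalDecidability

end ClassBounds

/-- A permutation group of degree `n ≥ 4` has at most `5^((n-1)/3)` conjugacy
classes; equivalently, `k(G)^3 ≤ 5^(n-1)`. -/
theorem conjClasses_card_le_of_perm_group (n : ℕ) (hn : 4 ≤ n)
    (G : Subgroup (Equiv.Perm (Fin n))) :
    Nat.card (ConjClasses G) ^ 3 ≤ 5 ^ (n - 1) := by
  have h : (Nat.card (ConjClasses G) : ℝ) ≤ cbrtFive ^ (n - 1) := by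
    rw [← classBound_of_four_le hn]
    simpa using (card_conjClasses_le_orbitBound G).trans
      (orbitBound_le_classBound (isStable_univ G))
  have h' := pow_le_pow_left₀ (Nat.cast_nonneg _) h 3
  rw [← pow_mul, mul_comm, pow_mul, cbrtFive_pow_three] at h'
  exact_mod_cast h'
end

section
/- Let G be a finite group and H a subgroup of G. Then k(H) ≤ k(G) · |G : H|, where |G : H| denotes the index of H in G. -/
/-- For a subgroup `H` of a finite group `G`, `k(H) ≤ k(G) · |G : H|`. -/
theorem conjClasses_card_subgroup_le (G : Type*) [Group G] [Finite G]
    (H : Subgroup G) :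
    Nat.card (ConjClasses H) ≤ Nat.card (ConjClasses G) * H.index := by
  refine Nat.le_of_mul_le_mul_right ?_ (Nat.card_pos (α := H))
  rw [mul_assoc, H.index_mul_card, ← card_comm_eq_card_conjClasses_mul_card,
    ← card_comm_eq_card_conjClasses_mul_card]
  refine Nat.card_le_card_of_injective
    (fun p => ⟨(p.1.1, p.1.2), p.2.map H.subtype⟩ :
      {p : H × H // Commute p.1 p.2} → {p : G × G // Commute p.1 p.2}) ?_
  rintro ⟨⟨a, b⟩, _⟩ ⟨⟨c, d⟩, _⟩ h
  simpa using congrArg Subtype.val h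
end

section
/- Let G be a finite group and H a subgroup of G. Then k(G) ≤ k(H) · |G : H|, where |G : H| denotes the index of H in G. -/
theorem Subgroup.card_le_card_subgroupOf_mul_index {G : Type*} [Group G] [Finite G]
    (H K : Subgroup G) : Nat.card K ≤ Nat.card (H.subgroupOf K) * H.index := by
  rw [← (H.subgroupOf K).card_mul_index, ← H.relIndex_top_right]
  refine Nat.mul_le_mul_left _ (relIndex_le_of_le_right le_top ?_)
  rw [relIndex_top_right]
  exact FiniteIndex.index_ne_zero

theorem Subgroup.card_commute_le_card_commute_mul_index {α G : Type*} [Finite α] [Group G]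
    [Finite G] (f : α → G) (H : Subgroup G) :
    Nat.card {p : α × G // Commute (f p.1) p.2} ≤
      Nat.card {p : α × H // Commute (f p.1) (p.2 : G)} * H.index := by
  have := Fintype.ofFinite α
  rw [Nat.card_congr (Equiv.subtypeProdEquivSigmaSubtype fun a g ↦ Commute (f a) g),
    Nat.card_congr (Equiv.subtypeProdEquivSigmaSubtype fun a (h : H) ↦ Commute (f a) (h : G)),
    Nat.card_sigma, Nat.card_sigma, Finset.sum_mul]
  refine Finset.sum_le_sum fun a _ ↦ ?_
  have e₁ : {g : G // Commute (f a) g} ≃ centralizer ({f a} : Set G) :=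
    Equiv.subtypeEquivRight fun g ↦ by
      rw [mem_centralizer_singleton_iff, commute_iff_eq, eq_comm]
  have e₂ : {h : H // Commute (f a) (h : G)} ≃
      H.subgroupOf (centralizer ({f a} : Set G)) :=
    { toFun h := ⟨⟨h.1, mem_centralizer_singleton_iff.2 h.2.eq.symm⟩, h.1.2⟩
      invFun g := ⟨⟨g.1, g.2⟩, (mem_centralizer_singleton_iff.1 g.1.2).symm⟩
      left_inv _ := rfl
      right_inv _ := rfl }
  rw [Nat.card_congr e₁, Nat.card_congr e₂]
  exact card_le_card_subgroupOf_mul_index _ _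

theorem Subgroup.card_comm_le_card_comm_mul_index_sq {G : Type*} [Group G] [Finite G]
    (H : Subgroup G) :
    Nat.card {p : G × G // Commute p.1 p.2} ≤
      Nat.card {p : H × H // Commute p.1 p.2} * H.index ^ 2 := by
  have swap : Nat.card {p : G × H // Commute p.1 (p.2 : G)} =
      Nat.card {p : H × G // Commute (p.1 : G) p.2} :=
    Nat.card_congr ((Equiv.prodComm G H).subtypeEquiv fun p ↦ Commute.symm_iff)
  have coe : Nat.card {p : H × H // Commute (p.1 : G) (p.2 : G)} =
      Nat.card {p : H × H // Commute p.1 p.2} :=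
    Nat.card_congr (Equiv.subtypeEquivRight fun p ↦ by
      simp only [commute_iff_eq, Subtype.ext_iff, coe_mul])
  calc
    Nat.card {p : G × G // Commute p.1 p.2}
      ≤ Nat.card {p : G × H // Commute p.1 (p.2 : G)} * H.index :=
        H.card_commute_le_card_commute_mul_index id
    _ ≤ Nat.card {p : H × H // Commute p.1 p.2} * H.index * H.index := by
        rw [swap, ← coe]
        exact Nat.mul_le_mul_right _ (H.card_commute_le_card_commute_mul_index Subtype.val)
    _ = Nat.card {p : H × H // Commute p.1 p.2} * H.index ^ 2 := by ring

/-- For a subgroup `H` of a finite group `G`, `k(G) ≤ k(H) · |G : H|`. -/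
theorem conjClasses_card_le_subgroup_mul_index (G : Type*) [Group G] [Finite G]
    (H : Subgroup G) :
    Nat.card (ConjClasses G) ≤ Nat.card (ConjClasses H) * H.index := by
  refine Nat.le_of_mul_le_mul_right ?_ (Nat.card_pos (α := G))
  calc
    Nat.card (ConjClasses G) * Nat.card G
      ≤ Nat.card (ConjClasses H) * Nat.card H * H.index ^ 2 := by
        rw [← card_comm_eq_card_conjClasses_mul_card, ← card_comm_eq_card_conjClasses_mul_card]
        exact H.card_comm_le_card_comm_mul_index_sq
    _ = Nat.card (ConjClasses H) * H.index * Nat.card G := by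
        rw [← H.card_mul_index]
        ring
end

section
/- Let G be a finite group and H a subgroup of G. Then k(H) ≤ sqrt(|G| · k(G)); equivalently, k(H)^2 ≤ |G| · k(G). -/
/-- A subgroup of a finite group has at most as many commuting pairs as the whole group. -/
theorem Subgroup.card_comm_le {G : Type*} [Group G] [Finite G] (H : Subgroup G) :
    Nat.card { p : H × H // Commute p.1 p.2 } ≤ Nat.card { p : G × G // Commute p.1 p.2 } := by
  refine Nat.card_le_card_of_injective
    (fun p ↦ ⟨(p.1.1, p.1.2), p.2.map H.subtype⟩) fun p q h ↦ ?_
  have h' := Prod.ext_iff.mp (Subtype.ext_iff.mp h)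
  exact Subtype.ext (Prod.ext (Subtype.ext h'.1) (Subtype.ext h'.2))

/-- For a subgroup `H` of a finite group `G`, `k(H) ≤ √(|G|·k(G))`;
equivalently, `k(H)^2 ≤ |G| · k(G)`. -/
theorem conjClasses_card_subgroup_sq_le (G : Type*) [Group G] [Finite G]
    (H : Subgroup G) :
    Nat.card (ConjClasses H) ^ 2 ≤ Nat.card G * Nat.card (ConjClasses G) := by
  have hH : Nat.card (ConjClasses H) ≤ Nat.card H :=
    Nat.card_le_card_of_surjective ConjClasses.mk ConjClasses.mk_surjective
  calc Nat.card (ConjClasses H) ^ 2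
      ≤ Nat.card (ConjClasses H) * Nat.card H := by rw [sq]; gcongr
    _ ≤ Nat.card (ConjClasses G) * Nat.card G := by
        simpa only [card_comm_eq_card_conjClasses_mul_card] using H.card_comm_le
    _ = Nat.card G * Nat.card (ConjClasses G) := mul_comm _ _
end

section
/- Let G be a finite group and N a normal subgroup of G. Then k(G) ≤ k(N) · k(G/N). -/
/-- The number of commuting pairs is submultiplicative along a normal subgroup. -/
theorem card_commute_le_normal_mul_quotient {G : Type*} [Group G] [Finite G]
    (N : Subgroup G) [N.Normal] :
    Nat.card { p : G × G // Commute p.1 p.2 } ≤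
      Nat.card { p : N × N // Commute p.1 p.2 } *
        Nat.card { p : (G ⧸ N) × (G ⧸ N) // Commute p.1 p.2 } := by
  classical
  -- `s x b` is a lift of `b` commuting with `x`, if there is one
  have hs : ∀ (x : G) (b : G ⧸ N), ∃ y₀ : G, ∀ y : G, Commute x y → (y : G ⧸ N) = b →
      Commute x y₀ ∧ (y₀ : G ⧸ N) = b := fun x b => by
    by_cases h : ∃ y : G, Commute x y ∧ (y : G ⧸ N) = b
    · obtain ⟨y₀, h₀⟩ := h
      exact ⟨y₀, fun _ _ _ => h₀⟩
    · exact ⟨1, fun y hy hb => (h ⟨y, hy, hb⟩).elim⟩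
  choose s hs using hs
  let m : G → G → G := fun x y => (s x (y : G ⧸ N))⁻¹ * y
  have hm_mem : ∀ x y, Commute x y → m x y ∈ N := fun x y h =>
    QuotientGroup.eq.mp (hs x y y h rfl).2
  have hm_comm : ∀ x y, Commute x y → Commute x (m x y) := fun x y h =>
    (hs x y y h rfl).1.inv_right.mul_right h
  have hm_inj : ∀ x y y' : G, (y : G ⧸ N) = (y' : G ⧸ N) → m x y = m x y' → y = y' := fun x y y' h h' => by
    simpa only [m, h, mul_right_inj] using h'
  rw [← Nat.card_prod]
  refine Nat.card_le_card_of_injective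
    (fun p => (⟨(⟨m p.1.1 p.1.2, hm_mem _ _ p.2⟩,
        ⟨m (m p.1.1 p.1.2) p.1.1, hm_mem _ _ (hm_comm _ _ p.2).symm⟩),
        Subtype.ext (hm_comm _ _ (hm_comm _ _ p.2).symm)⟩,
      ⟨((p.1.1 : G ⧸ N), (p.1.2 : G ⧸ N)), p.2.map (QuotientGroup.mk' N)⟩)) ?_
  rintro ⟨⟨x, y⟩, hxy⟩ ⟨⟨x', y'⟩, hxy'⟩ h
  simp only [Subtype.ext_iff, Prod.ext_iff] at h
  obtain ⟨⟨h₁, h₂⟩, hx, hy⟩ := h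
  rw [h₁] at h₂
  obtain rfl := hm_inj _ _ _ hx h₂
  obtain rfl := hm_inj _ _ _ hy h₁
  rfl

/-- For a normal subgroup `N` of a finite group `G`, `k(G) ≤ k(N) · k(G/N)`. -/
theorem conjClasses_card_le_normal_mul_quotient (G : Type*) [Group G] [Finite G]
    (N : Subgroup G) (hN : N.Normal) :
    Nat.card (ConjClasses G) ≤ Nat.card (ConjClasses N) * Nat.card (ConjClasses (G ⧸ N)) := by
  have h := card_commute_le_normal_mul_quotient N
  simp only [card_comm_eq_card_conjClasses_mul_card] at h
  rw [mul_mul_mul_comm, mul_comm (Nat.card N), ← N.card_eq_card_quotient_mul_card_subgroup] at h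
  exact Nat.le_of_mul_le_mul_right h Nat.card_pos
end

section
/- For every integer n ≥ 1, the number of partitions p(n) of n satisfies e^(2.5·√n) / (13·n) < p(n). -/
section

open Finset

namespace Nat.Partition

/-- Adjoining `k` copies of `m` to a partition of `n - m * k`. -/
def addCopies {n m k : ℕ} (hm : 0 < m) (h : m * k ≤ n) (μ : Nat.Partition (n - m * k)) :
    Nat.Partition n where
  parts := μ.parts + Multiset.replicate k m
  parts_pos := by
    intro i hi
    rcases Multiset.mem_add.1 hi with hi | hi
    · exact μ.parts_pos hi
    · rwa [Multiset.eq_of_mem_replicate hi]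
  parts_sum := by
    rw [Multiset.sum_add, μ.parts_sum, Multiset.sum_replicate, smul_eq_mul, mul_comm k m]
    omega

theorem addCopies_injective {n m k : ℕ} (hm : 0 < m) (h : m * k ≤ n) :
    Function.Injective (addCopies hm h) := by
  intro μ ν hμν
  exact Nat.Partition.ext (add_right_cancel (congrArg Nat.Partition.parts hμν))

theorem card_sub_le_card_filter_count {n m k : ℕ} (hm : 0 < m) (h : m * k ≤ n) :
    Fintype.card (Nat.Partition (n - m * k)) ≤
      #{p : Nat.Partition n | k ≤ p.parts.count m} := by
  rw [← Finset.card_univ]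
  refine Finset.card_le_card_of_injOn (addCopies hm h) (fun μ _ ↦ ?_)
    (addCopies_injective hm h).injOn
  simp [addCopies]

theorem sum_card_sub_mul_le (n : ℕ) :
    ∑ m ∈ Icc 1 n, ∑ k ∈ Icc 1 n,
      (if m * k ≤ n then m * Fintype.card (Nat.Partition (n - m * k)) else 0) ≤
    n * Fintype.card (Nat.Partition n) := by
  have hsum (p : Nat.Partition n) : ∑ m ∈ Icc 1 n, p.parts.count m * m = n := by
    conv_rhs => rw [← p.parts_sum]
    rw [Finset.sum_multiset_count_of_subset p.parts (Icc 1 n)]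
    · simp
    · intro i hi
      have hi := Multiset.mem_toFinset.1 hi
      exact mem_Icc.2 ⟨p.parts_pos hi, p.le_of_mem_parts hi⟩
  have hcount (p : Nat.Partition n) (m : ℕ) :
      ∑ k ∈ Icc 1 n, (if k ≤ p.parts.count m then 1 else 0) ≤ p.parts.count m := by
    rw [← Finset.card_filter]
    calc _ ≤ #(Icc 1 (p.parts.count m)) := Finset.card_le_card fun k hk ↦ by
            simp only [mem_filter, mem_Icc] at hk ⊢
            omega
      _ = _ := by simp
  calc _ ≤ ∑ m ∈ Icc 1 n, ∑ k ∈ Icc 1 n, m * #{p : Nat.Partition n | k ≤ p.parts.count m} := by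
        refine sum_le_sum fun m hm ↦ sum_le_sum fun k _ ↦ ?_
        split_ifs with h
        · exact Nat.mul_le_mul_left m (card_sub_le_card_filter_count (mem_Icc.1 hm).1 h)
        · exact Nat.zero_le _
    _ = ∑ p : Nat.Partition n, ∑ m ∈ Icc 1 n,
          (∑ k ∈ Icc 1 n, if k ≤ p.parts.count m then 1 else 0) * m := by
        simp_rw [Finset.card_filter, Finset.mul_sum, Finset.sum_mul]
        rw [Finset.sum_comm (s := univ)]
        refine sum_congr rfl fun m _ ↦ ?_
        rw [Finset.sum_comm]
        exact sum_congr rfl fun p _ ↦ sum_congr rfl fun k _ ↦ mul_comm _ _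
    _ ≤ ∑ p : Nat.Partition n, ∑ m ∈ Icc 1 n, p.parts.count m * m :=
        sum_le_sum fun p _ ↦ sum_le_sum fun m _ ↦ Nat.mul_le_mul_right m (hcount p m)
    _ = _ := by simp_rw [hsum]; simp [mul_comm]

end Nat.Partition

theorem hasSum_moments {q : ℝ} (h0 : 0 < q) (h1 : q < 1) :
    HasSum (fun m : ℕ ↦ (m : ℝ) * q ^ m) (q / (1 - q) ^ 2) ∧
    HasSum (fun m : ℕ ↦ (m : ℝ) ^ 2 * q ^ m) (q * (1 + q) / (1 - q) ^ 3) ∧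
    HasSum (fun m : ℕ ↦ (m : ℝ) ^ 3 * q ^ m) (q * (1 + 4 * q + q ^ 2) / (1 - q) ^ 4) ∧
    HasSum (fun m : ℕ ↦ (m : ℝ) ^ 4 * q ^ m)
      (q * (1 + 11 * q + 11 * q ^ 2 + q ^ 3) / (1 - q) ^ 5) := by
  have hq : ‖q‖ < 1 := by rwa [Real.norm_of_nonneg h0.le]
  have hne : 1 - q ≠ 0 := by linarith
  have c (j m : ℕ) : (((m + 1).ascFactorial j : ℕ) : ℝ) = j.factorial * ((m + j).choose j : ℕ) := by
    rw [Nat.ascFactorial_eq_factorial_mul_choose]; push_cast; rfl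
  have g (j : ℕ) := hasSum_choose_mul_geometric_of_norm_lt_one j hq
  have c1 (m : ℕ) := c 1 m
  have c2 (m : ℕ) := c 2 m
  have c3 (m : ℕ) := c 3 m
  have c4 (m : ℕ) := c 4 m
  simp only [Nat.ascFactorial, Nat.factorial, Nat.cast_mul, mul_one,
    Nat.cast_ofNat, Nat.cast_succ, Nat.cast_zero, add_zero, one_mul, zero_add] at c1 c2 c3 c4
  have comb (c₀ c₁ c₂ c₃ c₄ : ℝ) {f : ℕ → ℝ} {s : ℝ}
      (hf : ∀ m, f m = (c₀ + c₁ * ((m + 1).choose 1 : ℕ) + c₂ * ((m + 2).choose 2 : ℕ) +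
        c₃ * ((m + 3).choose 3 : ℕ) + c₄ * ((m + 4).choose 4 : ℕ)) * q ^ m)
      (hs : s = c₀ / (1 - q) + c₁ / (1 - q) ^ 2 + c₂ / (1 - q) ^ 3 + c₃ / (1 - q) ^ 4 +
        c₄ / (1 - q) ^ 5) : HasSum f s := by
    have h := ((((g 0).mul_left c₀).add ((g 1).mul_left c₁)).add
      ((g 2).mul_left c₂)).add ((g 3).mul_left c₃) |>.add ((g 4).mul_left c₄)
    rw [funext hf, hs]
    simpa [div_eq_mul_inv, add_mul, mul_assoc] using h
  refine ⟨comb (-1) 1 0 0 0 (fun m ↦ ?_) ?_, comb 1 (-3) 2 0 0 (fun m ↦ ?_) ?_,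
    comb (-1) 7 (-12) 6 0 (fun m ↦ ?_) ?_, comb 1 (-15) 50 (-60) 24 (fun m ↦ ?_) ?_⟩
  · linear_combination q ^ m * c1 m
  · field_simp; ring
  · linear_combination q ^ m * (c2 m - 3 * c1 m)
  · field_simp; ring
  · linear_combination q ^ m * (c3 m - 6 * c2 m + 7 * c1 m)
  · field_simp; ring
  · linear_combination q ^ m * (c4 m - 10 * c3 m + 25 * c2 m - 15 * c1 m)
  · field_simp; ring

theorem sinh_le_self_mul_cosh {x : ℝ} (hx : 0 ≤ x) : Real.sinh x ≤ x * Real.cosh x := by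
  have hd (t : ℝ) : HasDerivAt (fun t ↦ t * Real.cosh t - Real.sinh t) (t * Real.sinh t) t := by
    exact (((hasDerivAt_id' t).mul (Real.hasDerivAt_cosh t)).sub
      (Real.hasDerivAt_sinh t)).congr_deriv (by ring)
  have hm : MonotoneOn (fun t ↦ t * Real.cosh t - Real.sinh t) (Set.Ici 0) := by
    refine monotoneOn_of_deriv_nonneg (convex_Ici 0) (by fun_prop) (by fun_prop) fun t ht ↦ ?_
    rw [(hd t).deriv]
    have ht : 0 < t := by simpa using ht
    exact mul_nonneg ht.le (Real.sinh_nonneg_iff.2 ht.le)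
  have := hm (Set.mem_Ici.2 le_rfl) (Set.mem_Ici.2 hx) hx
  simp at this
  linarith

theorem sinh_le_mul_exp {x : ℝ} (hx : 0 ≤ x) : Real.sinh x ≤ x * Real.exp (x ^ 2 / 6) := by
  have h := (NormedSpace.expSeries_div_hasSum_exp (x ^ 2 / 6)).mul_left x
  rw [← Real.exp_eq_exp_ℝ] at h
  have hfac (i : ℕ) : 6 ^ i * i.factorial ≤ (2 * i + 1).factorial := by
    induction i with
    | zero => simp
    | succ i ih =>
      rw [show 2 * (i + 1) + 1 = 2 * i + 1 + 1 + 1 by ring, Nat.factorial_succ (2 * i + 1 + 1),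
        Nat.factorial_succ (2 * i + 1), Nat.factorial_succ i]
      calc _ = 6 * (i + 1) * (6 ^ i * i.factorial) := by ring
        _ ≤ (2 * i + 1 + 1 + 1) * (2 * i + 1 + 1) * (2 * i + 1).factorial :=
          Nat.mul_le_mul (by nlinarith) ih
        _ = _ := by ring
  refine hasSum_le (fun i ↦ ?_) (Real.hasSum_sinh x) h
  have hi : (6 : ℝ) ^ i * i.factorial ≤ (2 * i + 1).factorial := by exact_mod_cast hfac i
  calc _ ≤ x ^ (2 * i + 1) / (6 ^ i * i.factorial) := by gcongr
    _ = _ := by rw [div_pow, ← pow_mul, pow_succ]; field_simp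

theorem inv_sinh_sq_ge {x : ℝ} (hx : 0 < x) : 1 / x ^ 2 - 1 / 3 ≤ 1 / Real.sinh x ^ 2 := by
  have hs := Real.sinh_pos_iff.2 hx
  rcases le_or_gt 3 (x ^ 2) with h | h
  · have : 1 / x ^ 2 ≤ 1 / 3 := by gcongr
    have : 0 < 1 / Real.sinh x ^ 2 := by positivity
    linarith
  have h1 : Real.sinh x ^ 2 ≤ x ^ 2 * Real.exp (x ^ 2 / 3) := by
    calc _ ≤ (x * Real.exp (x ^ 2 / 6)) ^ 2 := by gcongr; exact sinh_le_mul_exp hx.le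
      _ = _ := by rw [mul_pow, ← Real.exp_nat_mul]; congr 2; push_cast; ring
  have h2 : 1 - x ^ 2 / 3 ≤ Real.exp (-(x ^ 2 / 3)) := by
    have := Real.add_one_le_exp (-(x ^ 2 / 3)); linarith
  calc _ = (1 - x ^ 2 / 3) / x ^ 2 := by field_simp
    _ ≤ Real.exp (-(x ^ 2 / 3)) / x ^ 2 := by gcongr
    _ = 1 / (x ^ 2 * Real.exp (x ^ 2 / 3)) := by rw [Real.exp_neg]; field_simp
    _ ≤ _ := by gcongr

theorem sum_inv_sq_ge {K : ℕ} (hK : 0 < K) :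
    Real.pi ^ 2 / 6 - 1 / K ≤ ∑ k ∈ Icc 1 K, 1 / (k : ℝ) ^ 2 := by
  have hanti : Antitone fun j : ℕ ↦ ∑ k ∈ range (j + 2), 1 / (k : ℝ) ^ 2 + 1 / ((j : ℝ) + 1) := by
    refine antitone_nat_of_succ_le fun j ↦ ?_
    rw [sum_range_succ _ (j + 2)]
    have : 1 / (((j + 2 : ℕ) : ℝ)) ^ 2 + 1 / (((j + 1 : ℕ) : ℝ) + 1) ≤ 1 / ((j : ℝ) + 1) := by
      push_cast
      rw [div_add_div _ _ (by positivity) (by positivity), div_le_div_iff₀ (by positivity) (by positivity)]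
      nlinarith [(Nat.cast_nonneg j : (0:ℝ) ≤ j)]
    linarith
  have hlim := ((hasSum_zeta_two.tendsto_sum_nat.comp (Filter.tendsto_add_atTop_nat 2)).add
    (tendsto_one_div_add_atTop_nhds_zero_nat (𝕜 := ℝ)))
  have h := hanti.le_of_tendsto hlim (K - 1)
  obtain ⟨j, rfl⟩ : ∃ j, K = j + 1 := ⟨K - 1, by omega⟩
  rw [← Finset.sum_subset (s₁ := Icc 1 (j + 1)) (fun k hk ↦ by simp at hk ⊢; omega)] at h
  · push_cast
    simp at h ⊢
    linarith
  · intro k hk hk'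
    have : k = 0 := by simp at hk hk'; omega
    simp [this]

theorem exp_sqrt_div_ge {N x : ℝ} (hN : 0 < N) (hx : 0 ≤ x) (hxN : x < N ^ 2) :
    Real.exp (2.5 * N) / N ^ 2 * (Real.exp (-(5 / 4 / N * x)) *
      (1 + x / N ^ 2 - 5 / 16 * x ^ 2 / N ^ 3 - 15 / 16 * x ^ 3 / N ^ 5)) ≤
    Real.exp (2.5 * √(N ^ 2 - x)) / (N ^ 2 - x) := by
  set R := √(N ^ 2 - x) with hR
  have hR0 : 0 < R := Real.sqrt_pos.2 (by linarith)
  have hR2 : R ^ 2 = N ^ 2 - x := Real.sq_sqrt (by linarith)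
  have hRN : R ≤ N := by nlinarith
  obtain ⟨ρ, hρ⟩ : ∃ ρ, ρ = R / N := ⟨_, rfl⟩
  have hRρ : R = ρ * N := by rw [hρ]; field_simp
  have hρ0 : 0 < ρ := by rw [hρ]; positivity
  have hρ1 : ρ ≤ 1 := by rw [hρ]; exact (div_le_one hN).2 hRN
  have hx' : x = N ^ 2 * (1 - ρ ^ 2) := by rw [hRρ] at hR2; linarith
  have hr : (1 - ρ) / (1 + ρ) ≤ (1 - ρ ^ 2) / 4 + 3 * (1 - ρ ^ 2) ^ 2 / 4 := by
    rw [div_le_iff₀ (by linarith)]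
    have : 0 ≤ ρ * (8 + ρ - 6 * ρ ^ 2 - 3 * ρ ^ 3) := by
      refine mul_nonneg hρ0.le ?_
      nlinarith [pow_le_one₀ hρ0.le hρ1 (n := 2), pow_le_one₀ hρ0.le hρ1 (n := 3)]
    nlinarith [mul_nonneg (sub_nonneg.2 hρ1) this]
  have hP : 1 + x / N ^ 2 - 5 / 16 * x ^ 2 / N ^ 3 - 15 / 16 * x ^ 3 / N ^ 5 ≤
      Real.exp ((1 - ρ ^ 2) - 5 / 4 * (N * (1 - ρ ^ 2)) * ((1 - ρ) / (1 + ρ))) := by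
    refine le_trans ?_ (Real.add_one_le_exp _)
    have h1 : 0 ≤ 5 / 4 * (N * (1 - ρ ^ 2)) := by
      have : 0 ≤ 1 - ρ ^ 2 := by nlinarith
      positivity
    have h2 := mul_le_mul_of_nonneg_left hr h1
    have h3 : 1 + x / N ^ 2 - 5 / 16 * x ^ 2 / N ^ 3 - 15 / 16 * x ^ 3 / N ^ 5 =
      1 + (1 - ρ ^ 2) - 5 / 4 * (N * (1 - ρ ^ 2)) *
        ((1 - ρ ^ 2) / 4 + 3 * (1 - ρ ^ 2) ^ 2 / 4) := by
      rw [hx']; field_simp; ring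
    rw [h3]; linarith
  have hw : Real.exp (1 - ρ ^ 2) ≤ 1 / ρ ^ 2 := by
    have := Real.add_one_le_exp (-(1 - ρ ^ 2))
    rw [Real.exp_neg] at this
    rw [le_div_iff₀ (by positivity)]
    calc _ ≤ Real.exp (1 - ρ ^ 2) * (Real.exp (1 - ρ ^ 2))⁻¹ := by gcongr; linarith
      _ = 1 := mul_inv_cancel₀ (Real.exp_pos _).ne'
  rw [← hR2]
  calc _ ≤ Real.exp (2.5 * N) / N ^ 2 * (Real.exp (-(5 / 4 / N * x)) *
        Real.exp ((1 - ρ ^ 2) - 5 / 4 * (N * (1 - ρ ^ 2)) * ((1 - ρ) / (1 + ρ)))) := by gcongr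
    _ = Real.exp (2.5 * R) / N ^ 2 * Real.exp (1 - ρ ^ 2) := by
      simp only [div_mul_eq_mul_div, ← Real.exp_add]
      congr 2
      rw [hx', hRρ]; field_simp; ring
    _ ≤ Real.exp (2.5 * R) / N ^ 2 * (1 / ρ ^ 2) := by gcongr
    _ = _ := by rw [hRρ]; field_simp

theorem poly_nonpos {N x : ℝ} (hN : 2 ≤ N) (hx : N ^ 2 ≤ x) :
    1 + x / N ^ 2 - 5 / 16 * x ^ 2 / N ^ 3 - 15 / 16 * x ^ 3 / N ^ 5 ≤ 0 := by
  obtain ⟨w, rfl⟩ : ∃ w, x = w * N ^ 2 := ⟨x / N ^ 2, by field_simp⟩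
  have hw : 1 ≤ w := by
    have : 0 < N ^ 2 := by positivity
    nlinarith
  have : 1 + w * N ^ 2 / N ^ 2 - 5 / 16 * (w * N ^ 2) ^ 2 / N ^ 3 - 15 / 16 * (w * N ^ 2) ^ 3 / N ^ 5
     = 1 + w - 5 / 16 * N * w ^ 2 - 15 / 16 * N * w ^ 3 := by
    field_simp
  rw [this]
  nlinarith [mul_nonneg (sub_nonneg.2 hN) (by positivity : 0 ≤ w ^ 2),
    mul_nonneg (sub_nonneg.2 hN) (by positivity : 0 ≤ w ^ 3),
    mul_nonneg (sub_nonneg.2 hw) (by positivity : 0 ≤ w ^ 2),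
    mul_nonneg (sub_nonneg.2 hw) (by positivity : 0 ≤ w)]

theorem hasSum_moments_exp {a : ℝ} (ha : 0 < a) :
    HasSum (fun m : ℕ ↦ (m : ℝ) * Real.exp (-(a * m))) (1 / (4 * Real.sinh (a / 2) ^ 2)) ∧
    HasSum (fun m : ℕ ↦ (m : ℝ) ^ 2 * Real.exp (-(a * m)))
      (Real.cosh (a / 2) / (4 * Real.sinh (a / 2) ^ 3)) ∧
    HasSum (fun m : ℕ ↦ (m : ℝ) ^ 3 * Real.exp (-(a * m)))
      ((3 + 2 * Real.sinh (a / 2) ^ 2) / (8 * Real.sinh (a / 2) ^ 4)) ∧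
    HasSum (fun m : ℕ ↦ (m : ℝ) ^ 4 * Real.exp (-(a * m)))
      (Real.cosh (a / 2) * (3 + Real.sinh (a / 2) ^ 2) / (4 * Real.sinh (a / 2) ^ 5)) := by
  set E := Real.exp (a / 2) with hE
  have hE0 : 0 < E := Real.exp_pos _
  have hE1 : 1 < E := Real.one_lt_exp_iff.2 (by linarith)
  have hq : Real.exp (-a) = 1 / E ^ 2 := by
    rw [hE, ← Real.exp_nat_mul, Real.exp_neg, one_div]; congr 2; push_cast; ring
  have hpow (m : ℕ) : Real.exp (-(a * m)) = (1 / E ^ 2) ^ m := by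
    rw [← hq, ← Real.exp_nat_mul]; congr 1; ring
  have hE2 : 1 < E ^ 2 := one_lt_pow₀ hE1 two_ne_zero
  have hne : E ^ 2 - 1 ≠ 0 := by linarith
  have hsinh : Real.sinh (a / 2) = (E ^ 2 - 1) / (2 * E) := by
    rw [Real.sinh_eq, Real.exp_neg, ← hE]; field_simp
  have hcosh : Real.cosh (a / 2) = (E ^ 2 + 1) / (2 * E) := by
    rw [Real.cosh_eq, Real.exp_neg, ← hE]; field_simp
  have h1q : 1 - 1 / E ^ 2 = (E ^ 2 - 1) / E ^ 2 := by field_simp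
  obtain ⟨m1, m2, m3, m4⟩ := hasSum_moments (q := 1 / E ^ 2) (by positivity)
    (by rw [div_lt_one (by positivity)]; exact hE2)
  simp only [hpow, hsinh, hcosh]
  rw [h1q] at m1 m2 m3 m4
  refine ⟨?_, ?_, ?_, ?_⟩
  · convert m1 using 1
    field_simp
    ring
  · convert m2 using 1
    field_simp
    ring
  · convert m3 using 1
    field_simp
    ring
  · convert m4 using 1
    field_simp
    ring

/-- The Lambert-type sum over `m` is controlled from below by its leading behaviour as `a → 0`. -/
theorem moment_combination_ge {a N : ℝ} (ha : 0 < a) (ha' : a ≤ 15 / 4) (hN : 0 < N) :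
    1 / a ^ 2 * (1 + 2 / 5 / N - 336 / 25 / N ^ 2) - 1 / 12 - 1 / 3 / N - 36 / 5 / N ^ 2 ≤
    1 / (4 * Real.sinh (a / 2) ^ 2) +
      4 / 5 * a / N * (Real.cosh (a / 2) / (4 * Real.sinh (a / 2) ^ 3)) -
      1 / 5 * a ^ 2 / N * ((3 + 2 * Real.sinh (a / 2) ^ 2) / (8 * Real.sinh (a / 2) ^ 4)) -
      12 / 25 * a ^ 3 / N ^ 2 *
        (Real.cosh (a / 2) * (3 + Real.sinh (a / 2) ^ 2) / (4 * Real.sinh (a / 2) ^ 5)) := by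
  set S := Real.sinh (a / 2) with hS
  set C := Real.cosh (a / 2) with hC
  have hS0 : 0 < S := Real.sinh_pos_iff.2 (by linarith)
  have hC0 : 0 < C := Real.cosh_pos _
  have haS : a / 2 ≤ S := Real.self_le_sinh_iff.2 (by linarith)
  have hSC : S ≤ a / 2 * C := sinh_le_self_mul_cosh (by linarith)
  have hCS : a / 2 * C ≤ (1 + a / 2) * S := by
    have h1 : C - S = Real.exp (-(a / 2)) := by rw [hC, hS, Real.cosh_sub_sinh]
    have h2 : Real.exp (-(a / 2)) ≤ 1 := Real.exp_le_one_iff.2 (by linarith)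
    nlinarith
  have m1 : 1 / a ^ 2 - 1 / 12 ≤ 1 / (4 * S ^ 2) := by
    have h := inv_sinh_sq_ge (x := a / 2) (by linarith)
    rw [← hS] at h
    calc _ = 1 / 4 * (1 / (a / 2) ^ 2 - 1 / 3) := by field_simp; ring
      _ ≤ 1 / 4 * (1 / S ^ 2) := by gcongr
      _ = _ := by field_simp
  have m2 : 2 / a * (1 / a ^ 2 - 1 / 12) ≤ C / (4 * S ^ 3) := by
    calc _ ≤ 2 / a * (1 / (4 * S ^ 2)) := by gcongr
      _ ≤ C / S * (1 / (4 * S ^ 2)) := by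
        gcongr ?_ * _
        rw [div_le_div_iff₀ ha hS0]; linarith
      _ = _ := by field_simp
  have m3 : (3 + 2 * S ^ 2) / (8 * S ^ 4) ≤ 6 / a ^ 4 + 1 / a ^ 2 := by
    calc _ = 3 / (8 * S ^ 4) + 1 / (4 * S ^ 2) := by field_simp; ring
      _ ≤ 3 / (8 * (a / 2) ^ 4) + 1 / (4 * (a / 2) ^ 2) := by gcongr
      _ = _ := by field_simp; ring
  have m4 : C * (3 + S ^ 2) / (4 * S ^ 5) ≤ (2 / a + 1) * (12 / a ^ 4 + 1 / a ^ 2) := by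
    calc _ = C / S * (3 / (4 * S ^ 4) + 1 / (4 * S ^ 2)) := by field_simp
      _ ≤ (2 / a + 1) * (3 / (4 * (a / 2) ^ 4) + 1 / (4 * (a / 2) ^ 2)) := by
        gcongr
        rw [div_le_iff₀ hS0]
        field_simp
        linarith
      _ = _ := by field_simp; ring
  have m4' : a ^ 3 * ((2 / a + 1) * (12 / a ^ 4 + 1 / a ^ 2)) ≤ 28 / a ^ 2 + 15 := by
    have h := sq_nonneg (2 / a - 3)
    have h' : a ^ 3 * ((2 / a + 1) * (12 / a ^ 4 + 1 / a ^ 2)) =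
      28 / a ^ 2 + 11 + a - (2 / a - 3) ^ 2 := by field_simp; ring
    rw [h']; linarith
  calc _ = (1 / a ^ 2 - 1 / 12) + 4 / 5 * a / N * (2 / a * (1 / a ^ 2 - 1 / 12)) -
        1 / 5 * a ^ 2 / N * (6 / a ^ 4 + 1 / a ^ 2) - 12 / 25 / N ^ 2 * (28 / a ^ 2 + 15) := by
        field_simp; ring
    _ ≤ (1 / a ^ 2 - 1 / 12) + 4 / 5 * a / N * (2 / a * (1 / a ^ 2 - 1 / 12)) -
        1 / 5 * a ^ 2 / N * (6 / a ^ 4 + 1 / a ^ 2) -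
        12 / 25 / N ^ 2 * (a ^ 3 * ((2 / a + 1) * (12 / a ^ 4 + 1 / a ^ 2))) := by gcongr
    _ = (1 / a ^ 2 - 1 / 12) + 4 / 5 * a / N * (2 / a * (1 / a ^ 2 - 1 / 12)) -
        1 / 5 * a ^ 2 / N * (6 / a ^ 4 + 1 / a ^ 2) -
        12 / 25 * a ^ 3 / N ^ 2 * ((2 / a + 1) * (12 / a ^ 4 + 1 / a ^ 2)) := by ring
    _ ≤ _ := by gcongr

theorem truncated_sum_ge {N : ℝ} {n k : ℕ} (hN : 2 ≤ N) (hn : (n : ℝ) = N ^ 2) (hk : 0 < k)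
    (hkN : (k : ℝ) ≤ 3 * N) :
    1 / (5 / 4 / N * k) ^ 2 * (1 + 2 / 5 / N - 336 / 25 / N ^ 2) - 1 / 12 - 1 / 3 / N -
      36 / 5 / N ^ 2 ≤
    ∑ m ∈ Icc 1 n with m * k < n, (m : ℝ) * (Real.exp (-(5 / 4 / N * (m * k : ℕ))) *
      (1 + (m * k : ℕ) / N ^ 2 - 5 / 16 * (m * k : ℕ) ^ 2 / N ^ 3 -
        15 / 16 * (m * k : ℕ) ^ 3 / N ^ 5)) := by
  have hN0 : 0 < N := by linarith
  have hk0 : (0 : ℝ) < k := by exact_mod_cast hk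
  have ha : 0 < 5 / 4 / N * k := by positivity
  have ha' : 5 / 4 / N * k ≤ 15 / 4 := by
    rw [div_mul_eq_mul_div, div_le_iff₀ hN0]; linarith
  refine (moment_combination_ge ha ha' hN0).trans ?_
  obtain ⟨m1, m2, m3, m4⟩ := hasSum_moments_exp ha
  have h := ((m1.add (m2.mul_left (4 / 5 * (5 / 4 / N * k) / N))).sub
    (m3.mul_left (1 / 5 * (5 / 4 / N * k) ^ 2 / N))).sub
    (m4.mul_left (12 / 25 * (5 / 4 / N * k) ^ 3 / N ^ 2))
  refine neg_le_neg_iff.1 ?_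
  rw [← Finset.sum_neg_distrib]
  refine le_trans (le_of_eq (sum_congr rfl fun m _ ↦ ?_))
    (sum_le_hasSum ((Icc 1 n).filter fun m ↦ m * k < n) (fun m hm ↦ ?_) h.neg)
  · push_cast
    rw [show 5 / 4 / N * (m * k) = 5 / 4 / N * k * m by ring]
    field_simp
    ring
  · have hfac : (m : ℝ) * Real.exp (-(5 / 4 / N * k * m)) +
        4 / 5 * (5 / 4 / N * k) / N * (m ^ 2 * Real.exp (-(5 / 4 / N * k * m))) -
        1 / 5 * (5 / 4 / N * k) ^ 2 / N * (m ^ 3 * Real.exp (-(5 / 4 / N * k * m))) -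
        12 / 25 * (5 / 4 / N * k) ^ 3 / N ^ 2 * (m ^ 4 * Real.exp (-(5 / 4 / N * k * m))) =
        m * Real.exp (-(5 / 4 / N * k * m)) * (1 + (m * k) / N ^ 2 -
          5 / 16 * (m * k) ^ 2 / N ^ 3 - 15 / 16 * (m * k) ^ 3 / N ^ 5) := by
      field_simp
      ring
    rw [hfac, Left.nonneg_neg_iff]
    rcases Nat.eq_zero_or_pos m with rfl | hm0
    · simp
    refine mul_nonpos_of_nonneg_of_nonpos (by positivity) (poly_nonpos hN ?_)
    rw [← hn]
    have : n ≤ m * k := by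
      simp only [mem_filter, mem_Icc, not_and, not_lt] at hm
      by_cases hmn : m ≤ n
      · exact hm ⟨hm0, hmn⟩
      · nlinarith
    exact_mod_cast this

theorem truncated_double_sum_gt {N : ℝ} {n : ℕ} (hN : 20 ≤ N) (hn : (n : ℝ) = N ^ 2) :
    N ^ 2 < ∑ k ∈ Icc 1 ⌊3 * N⌋₊, ∑ m ∈ Icc 1 n with m * k < n, (m : ℝ) *
      (Real.exp (-(5 / 4 / N * (m * k : ℕ))) *
        (1 + (m * k : ℕ) / N ^ 2 - 5 / 16 * (m * k : ℕ) ^ 2 / N ^ 3 -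
          15 / 16 * (m * k : ℕ) ^ 3 / N ^ 5)) := by
  have hN0 : 0 < N := by linarith
  set K := ⌊3 * N⌋₊ with hK
  have hKle : (K : ℝ) ≤ 3 * N := Nat.floor_le (by positivity)
  have hKgt : 3 * N < K + 1 := Nat.lt_floor_add_one _
  have hK0 : 0 < K := by
    have : (0 : ℝ) < K := by linarith
    exact_mod_cast this
  refine lt_of_lt_of_le ?_ (sum_le_sum fun k hk ↦ truncated_sum_ge (by linarith) hn
    (mem_Icc.1 hk).1 (le_trans (by exact_mod_cast (mem_Icc.1 hk).2) hKle))
  obtain ⟨t, ht⟩ : ∃ t, t = 1 / N := ⟨_, rfl⟩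
  have hNt : N = 1 / t := by rw [ht]; simp
  have ht0 : 0 < t := by rw [ht]; positivity
  have ht1 : t ≤ 1 / 20 := by rw [ht]; gcongr
  have hzeta : 1.6449 - 0.339 * t ≤ ∑ k ∈ Icc 1 K, 1 / (k : ℝ) ^ 2 := by
    have h1 := sum_inv_sq_ge hK0
    have h2 : 1.6449 ≤ Real.pi ^ 2 / 6 := by nlinarith [Real.pi_gt_d6]
    have h3 : 1 / (K : ℝ) ≤ 0.339 * t := by
      rw [ht, mul_one_div, div_le_div_iff₀ (by exact_mod_cast hK0) hN0]
      linarith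
    linarith
  have hα : 0 ≤ 1 + 2 / 5 * t - 336 / 25 * t ^ 2 := by nlinarith
  have hsum : ∑ k ∈ Icc 1 K, (1 / (5 / 4 / N * k) ^ 2 * (1 + 2 / 5 / N - 336 / 25 / N ^ 2) -
      1 / 12 - 1 / 3 / N - 36 / 5 / N ^ 2) =
      N ^ 2 * (16 / 25 * (1 + 2 / 5 * t - 336 / 25 * t ^ 2) * ∑ k ∈ Icc 1 K, 1 / (k : ℝ) ^ 2) -
        K * (1 / 12 + 1 / 3 * t + 36 / 5 * t ^ 2) := by
    rw [Finset.mul_sum, Finset.mul_sum]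
    simp only [Finset.sum_sub_distrib, Finset.sum_const, Nat.card_Icc, nsmul_eq_mul]
    have : ∑ k ∈ Icc 1 K, 1 / (5 / 4 / N * k) ^ 2 * (1 + 2 / 5 / N - 336 / 25 / N ^ 2) =
      ∑ k ∈ Icc 1 K, N ^ 2 * (16 / 25 * (1 + 2 / 5 * t - 336 / 25 * t ^ 2) * (1 / (k : ℝ) ^ 2)) := by
      refine sum_congr rfl fun k hk ↦ ?_
      have hk : (k : ℝ) ≠ 0 := by
        have := (mem_Icc.1 hk).1
        positivity
      rw [ht]; field_simp; ring
    rw [this, ht, Nat.add_sub_cancel]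
    ring
  rw [hsum]
  have hKt : K * (1 / 12 + 1 / 3 * t + 36 / 5 * t ^ 2) ≤
      N ^ 2 * (3 * t * (1 / 12 + 1 / 3 * t + 36 / 5 * t ^ 2)) := by
    calc _ ≤ 3 * N * (1 / 12 + 1 / 3 * t + 36 / 5 * t ^ 2) := by gcongr
      _ = _ := by rw [ht]; field_simp
  have hmain : 1 < 16 / 25 * (1 + 2 / 5 * t - 336 / 25 * t ^ 2) * (1.6449 - 0.339 * t) -
      3 * t * (1 / 12 + 1 / 3 * t + 36 / 5 * t ^ 2) := by
    have h2 : t ^ 2 ≤ 1 / 400 := by nlinarith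
    have h3 : t ^ 3 ≤ 1 / 8000 := by nlinarith
    have h3' : 0 < t ^ 3 := by positivity
    nlinarith
  calc N ^ 2 = N ^ 2 * 1 := by ring
    _ < N ^ 2 * (16 / 25 * (1 + 2 / 5 * t - 336 / 25 * t ^ 2) * (1.6449 - 0.339 * t) -
      3 * t * (1 / 12 + 1 / 3 * t + 36 / 5 * t ^ 2)) := by gcongr
    _ ≤ N ^ 2 * (16 / 25 * (1 + 2 / 5 * t - 336 / 25 * t ^ 2) * ∑ k ∈ Icc 1 K, 1 / (k : ℝ) ^ 2 -
      3 * t * (1 / 12 + 1 / 3 * t + 36 / 5 * t ^ 2)) := by gcongr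
    _ ≤ _ := by linarith

theorem lower_bound_step {p : ℕ → ℕ} {n : ℕ} (hn : 400 ≤ n)
    (hrec : ∑ m ∈ Icc 1 n, ∑ k ∈ Icc 1 n, (if m * k ≤ n then m * p (n - m * k) else 0) ≤ n * p n)
    (hp : ∀ j, 1 ≤ j → j < n → Real.exp (2.5 * √j) / (13 * j) < p j) :
    Real.exp (2.5 * √n) / (13 * n) < p n := by
  have hn' : (400 : ℝ) ≤ n := by exact_mod_cast hn
  set N := √(n : ℝ) with hNdef
  have hN2 : (n : ℝ) = N ^ 2 := (Real.sq_sqrt (by linarith)).symm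
  have hN : 20 ≤ N := Real.le_sqrt_of_sq_le (by linarith)
  have hN0 : 0 < N := by linarith
  have hKn : ⌊3 * N⌋₊ ≤ n := by
    refine Nat.floor_le_of_le ?_
    rw [hN2]; nlinarith
  have hterm (m k : ℕ) (hm : 1 ≤ m) (hk : 1 ≤ k) (hmk : m * k < n) :
      Real.exp (2.5 * N) / (13 * N ^ 2) * ((m : ℝ) * (Real.exp (-(5 / 4 / N * (m * k : ℕ))) *
        (1 + (m * k : ℕ) / N ^ 2 - 5 / 16 * (m * k : ℕ) ^ 2 / N ^ 3 -
          15 / 16 * (m * k : ℕ) ^ 3 / N ^ 5))) ≤ m * p (n - m * k) := by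
    have hx : ((m * k : ℕ) : ℝ) < N ^ 2 := by rw [← hN2]; exact_mod_cast hmk
    have h1 := exp_sqrt_div_ge hN0 (Nat.cast_nonneg (m * k)) hx
    have hpos : 0 < m * k := Nat.mul_pos hm hk
    have h2 := hp (n - m * k) (by omega) (by omega)
    rw [Nat.cast_sub hmk.le, hN2] at h2
    calc _ = (m : ℝ) * (1 / 13 * (Real.exp (2.5 * N) / N ^ 2 *
          (Real.exp (-(5 / 4 / N * (m * k : ℕ))) *
          (1 + (m * k : ℕ) / N ^ 2 - 5 / 16 * (m * k : ℕ) ^ 2 / N ^ 3 -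
          15 / 16 * (m * k : ℕ) ^ 3 / N ^ 5)))) := by field_simp
      _ ≤ (m : ℝ) * (1 / 13 * (Real.exp (2.5 * √(N ^ 2 - (m * k : ℕ))) /
          (N ^ 2 - (m * k : ℕ)))) := by gcongr
      _ = (m : ℝ) * (Real.exp (2.5 * √(N ^ 2 - (m * k : ℕ))) /
          (13 * (N ^ 2 - (m * k : ℕ)))) := by
          congr 1
          rw [div_mul_div_comm, one_mul]
      _ ≤ _ := by gcongr
  have hdouble : ∑ k ∈ Icc 1 ⌊3 * N⌋₊, ∑ m ∈ Icc 1 n with m * k < n, m * p (n - m * k) ≤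
      n * p n := by
    refine le_trans ?_ hrec
    rw [Finset.sum_comm (s := Icc 1 n)]
    refine (sum_le_sum fun k _ ↦ ?_).trans
      (sum_le_sum_of_subset (Icc_subset_Icc_right hKn))
    rw [Finset.sum_filter]
    refine sum_le_sum fun m _ ↦ ?_
    split_ifs <;> first | exact le_rfl | omega
  have hreal : (∑ k ∈ Icc 1 ⌊3 * N⌋₊, ∑ m ∈ Icc 1 n with m * k < n,
      (m : ℝ) * p (n - m * k)) ≤ N ^ 2 * p n := by
    rw [← hN2]; exact_mod_cast hdouble
  have hfinal : Real.exp (2.5 * N) / (13 * N ^ 2) * N ^ 2 < N ^ 2 * p n := by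
    refine lt_of_lt_of_le (mul_lt_mul_of_pos_left (truncated_double_sum_gt hN hN2)
      (by positivity)) (le_trans ?_ hreal)
    rw [Finset.mul_sum]
    refine sum_le_sum fun k hk ↦ ?_
    rw [Finset.mul_sum]
    refine sum_le_sum fun m hm ↦ ?_
    simp only [mem_filter, mem_Icc] at hm hk
    exact hterm m k hm.1.1 hk.1 hm.2
  rw [hN2]
  have : 0 < N ^ 2 := by positivity
  nlinarith

/-- The sum of the divisors of `x` that are at most `d`. -/
def divisorSum (x : ℕ) : ℕ → ℕ
  | 0 => 0
  | d + 1 => bif Nat.beq (x % (d + 1)) 0 then divisorSum x d + (d + 1) else divisorSum x d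

/-- The divisor sums of `x, x + 1, …, x + l - 1`. -/
def divisorSumTable : ℕ → ℕ → List ℕ
  | 0, _ => []
  | l + 1, x => divisorSum x x :: divisorSumTable l (x + 1)

/-- The scalar product of two lists, added to `acc`. -/
def dotAcc : List ℕ → List ℕ → ℕ → ℕ
  | a :: l, b :: l', acc => dotAcc l l' (acc + a * b)
  | _, _, acc => acc

/-- Search upwards from `J`, in at most `f` steps, for `J` with `100 * √n ≤ J`. -/
def searchSqrt : ℕ → ℕ → ℕ → ℕ
  | 0, _, J => J
  | f + 1, n, J => bif Nat.ble (10000 * n) (J * J) then J else searchSqrt f n (J + 1)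

/-- Starting from the list `L` of partition numbers of `n - 1, …, 0`, compute the partition numbers
of `n, …, n + f - 1` from the divisor sums `S` and check the lower bound for them, with `√n` replaced
by a rational upper bound and `e ^ (1 / 40)` by `1.025315121`. -/
def checkBound (S : List ℕ) : ℕ → ℕ → ℕ → List ℕ → Bool
  | 0, _, _, _ => true
  | f + 1, n, J, L =>
    let J' := searchSqrt 50 n J
    let b := dotAcc L S 0 / n
    Nat.ble (10000 * n) (J' * J') && (Nat.blt (1025315121 ^ J') (13 * n * b * 1000000000 ^ J') &&
      checkBound S f (n + 1) J' (b :: L))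

/-- The entries of the list are lower bounds for `p (n - 1), p (n - 2), …`. -/
def IsLowerTable (p : ℕ → ℕ) : ℕ → List ℕ → Prop
  | _, [] => True
  | 0, _ :: _ => False
  | n + 1, b :: L => b ≤ p n ∧ IsLowerTable p n L

theorem divisorSum_eq (x d : ℕ) : divisorSum x d = ∑ m ∈ Icc 1 d, if m ∣ x then m else 0 := by
  induction d with
  | zero => rfl
  | succ d ih =>
    rw [sum_Icc_succ_top (by omega), ← ih, divisorSum]
    by_cases h : d + 1 ∣ x
    · simp [h, Nat.mod_eq_zero_of_dvd h]
    · have h' : x % (d + 1) ≠ 0 := fun h' ↦ h (Nat.dvd_of_mod_eq_zero h')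
      have h'' : Nat.beq (x % (d + 1)) 0 = false :=
        Bool.eq_false_iff.2 fun e ↦ h' (Nat.eq_of_beq_eq_true e)
      simp [h, h'']

theorem dotAcc_le {p : ℕ → ℕ} (L : List ℕ) (l x j acc : ℕ) (hL : IsLowerTable p j L) :
    dotAcc L (divisorSumTable l x) acc ≤
      acc + ∑ i ∈ range j, p (j - 1 - i) * divisorSum (x + i) (x + i) := by
  induction L generalizing l x j acc with
  | nil => simp [dotAcc]
  | cons b L ih =>
    cases l with
    | zero => simp [divisorSumTable, dotAcc]
    | succ l =>
      cases j with
      | zero => exact hL.elim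
      | succ j =>
        rw [divisorSumTable, dotAcc]
        refine (ih l (x + 1) j _ hL.2).trans ?_
        rw [sum_range_succ']
        have h0 : b * divisorSum x x ≤ p (j + 1 - 1 - 0) * divisorSum (x + 0) (x + 0) :=
          Nat.mul_le_mul_right _ hL.1
        have h1 : ∑ i ∈ range j, p (j - 1 - i) * divisorSum (x + 1 + i) (x + 1 + i) =
            ∑ i ∈ range j, p (j + 1 - 1 - (i + 1)) * divisorSum (x + (i + 1)) (x + (i + 1)) := by
          refine sum_congr rfl fun i _ ↦ ?_
          rw [show j + 1 - 1 - (i + 1) = j - 1 - i by omega, show x + (i + 1) = x + 1 + i by omega]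
        omega

theorem checkBound_spec {p : ℕ → ℕ}
    (hrec : ∀ n, ∑ i ∈ range n, p (n - 1 - i) * divisorSum (1 + i) (1 + i) ≤ n * p n)
    (l f n J : ℕ) (L : List ℕ) (hn : 0 < n) (hL : IsLowerTable p n L)
    (h : checkBound (divisorSumTable l 1) f n J L = true) (j : ℕ) (hnj : n ≤ j) (hj : j < n + f) :
    ∃ J', 10000 * j ≤ J' * J' ∧ 1025315121 ^ J' < 13 * j * p j * 1000000000 ^ J' := by
  induction f generalizing n J L with
  | zero => omega
  | succ f ih =>
    simp only [checkBound, Bool.and_eq_true, Nat.ble_eq, Nat.blt_eq] at h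
    obtain ⟨h1, h2, h3⟩ := h
    have hb : dotAcc L (divisorSumTable l 1) 0 / n ≤ p n := by
      refine Nat.div_le_of_le_mul (le_trans ?_ (hrec n))
      simpa using dotAcc_le L l 1 n 0 hL
    rcases hnj.eq_or_lt with rfl | hlt
    · exact ⟨_, h1, h2.trans_le (by gcongr)⟩
    · have hL' : IsLowerTable p (n + 1) (dotAcc L (divisorSumTable l 1) 0 / n :: L) := ⟨hb, hL⟩
      exact ih (n + 1) _ _ (by omega) hL' h3 hlt (by omega)

theorem exp_inv_forty_le : Real.exp (1 / 40) ≤ 1025315121 / 1000000000 := by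
  have h := Real.exp_bound' (x := 1 / 40) (by norm_num) (by norm_num) (n := 6) (by norm_num)
  refine h.trans ?_
  norm_num [Finset.sum_range_succ, Nat.factorial]

theorem lower_bound_of_certificate {n b J : ℕ} (hn : 0 < n) (h1 : 10000 * n ≤ J * J)
    (h2 : 1025315121 ^ J < 13 * n * b * 1000000000 ^ J) :
    Real.exp (2.5 * √n) / (13 * n) < b := by
  have hs : √(n : ℝ) ≤ J / 100 := by
    refine Real.sqrt_le_iff.2 ⟨by positivity, ?_⟩
    have : (10000 : ℝ) * n ≤ J * J := by exact_mod_cast h1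
    linarith
  have h3 : (1025315121 : ℝ) ^ J < 13 * n * b * 1000000000 ^ J := by exact_mod_cast h2
  rw [div_lt_iff₀ (by positivity)]
  calc Real.exp (2.5 * √n) ≤ Real.exp (J * (1 / 40)) := by
        refine Real.exp_le_exp.2 ?_
        linarith
    _ = Real.exp (1 / 40) ^ J := Real.exp_nat_mul _ _
    _ ≤ (1025315121 / 1000000000) ^ J := by gcongr; exact exp_inv_forty_le
    _ < _ := by
      rw [div_pow, div_lt_iff₀ (by positivity)]
      linarith

set_option maxRecDepth 100000 in
theorem checkBound_true : checkBound (divisorSumTable 400 1) 399 1 100 [1] = true := by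
  decide +kernel

theorem lower_bound_of_lt {p : ℕ → ℕ} (h0 : 1 ≤ p 0)
    (hrec : ∀ n, ∑ i ∈ range n, p (n - 1 - i) * divisorSum (1 + i) (1 + i) ≤ n * p n)
    {n : ℕ} (hn : 1 ≤ n) (h : n < 400) : Real.exp (2.5 * √n) / (13 * n) < p n := by
  have hL : IsLowerTable p 1 [1] := ⟨h0, trivial⟩
  obtain ⟨J, h1, h2⟩ := checkBound_spec hrec 400 399 1 100 [1] one_pos hL checkBound_true n hn
    (by omega)
  exact lower_bound_of_certificate hn h1 h2

/-- The convolution with the divisor sums, written as a double sum over `m * k ≤ n`. -/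
theorem sum_mul_divisorSum (p : ℕ → ℕ) (n : ℕ) :
    ∑ i ∈ range n, p (n - 1 - i) * divisorSum (1 + i) (1 + i) =
      ∑ m ∈ Icc 1 n, ∑ k ∈ Icc 1 n, (if m * k ≤ n then m * p (n - m * k) else 0) := by
  have hx : ∑ i ∈ range n, p (n - 1 - i) * divisorSum (1 + i) (1 + i) =
      ∑ x ∈ Icc 1 n, ∑ m ∈ Icc 1 n, if m ∣ x then m * p (n - x) else 0 := by
    rw [← Finset.Ico_add_one_right_eq_Icc, Finset.sum_Ico_eq_sum_range]
    refine sum_congr (by simp) fun i hi ↦ ?_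
    have hi := mem_range.1 hi
    rw [divisorSum_eq, mul_sum, Nat.sub_sub]
    refine sum_subset_zero_on_sdiff (fun m hm ↦ ?_) (fun m hm ↦ ?_) fun m _ ↦ ?_
    · simp at hm ⊢; omega
    · simp only [mem_sdiff, mem_Icc, mem_Ico, not_and, not_le] at hm
      rw [if_neg fun h ↦ ?_]
      have := Nat.le_of_dvd (by omega) h
      omega
    · split_ifs <;> ring
  rw [hx, sum_comm]
  refine sum_congr rfl fun m hm ↦ ?_
  have hm := (mem_Icc.1 hm).1
  rw [← sum_filter, ← sum_filter]
  refine sum_nbij' (· / m) (m * ·) ?_ ?_ ?_ ?_ ?_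
  · intro x hx
    simp only [mem_filter, mem_Icc] at hx ⊢
    obtain ⟨⟨h1, h2⟩, k, rfl⟩ := hx
    rw [Nat.mul_div_cancel_left _ hm]
    have : 0 < k := Nat.pos_of_mul_pos_left (show 0 < m * k by omega)
    exact ⟨⟨this, by nlinarith⟩, h2⟩
  · intro k hk
    simp only [mem_filter, mem_Icc] at hk ⊢
    exact ⟨⟨Nat.mul_pos hm hk.1.1, hk.2⟩, dvd_mul_right m k⟩
  · intro x hx
    exact Nat.mul_div_cancel' (mem_filter.1 hx).2
  · intro k _
    exact Nat.mul_div_cancel_left k hm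
  · intro x hx
    rw [Nat.mul_div_cancel' (mem_filter.1 hx).2]

theorem lower_bound_of_recurrence {p : ℕ → ℕ} (h0 : 1 ≤ p 0)
    (hrec : ∀ n, ∑ m ∈ Icc 1 n, ∑ k ∈ Icc 1 n, (if m * k ≤ n then m * p (n - m * k) else 0) ≤
      n * p n) {n : ℕ} (hn : 1 ≤ n) : Real.exp (2.5 * √n) / (13 * n) < p n := by
  induction n using Nat.strong_induction_on with
  | _ n ih =>
    rcases lt_or_ge n 400 with h | h
    · exact lower_bound_of_lt h0 (fun m ↦ (sum_mul_divisorSum p m).trans_le (hrec m)) hn h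
    · exact lower_bound_step h (hrec n) fun j hj hjn ↦ ih j hjn hj

end

/-- Lower bound on the partition function: for `n ≥ 1`,
`e^(2.5·√n) / (13·n) < p(n)`. -/
theorem partition_lower_bound (n : ℕ) (hn : 1 ≤ n) :
    Real.exp (2.5 * Real.sqrt n) / (13 * n) < Fintype.card (Nat.Partition n) :=
  lower_bound_of_recurrence (p := fun j ↦ Fintype.card (Nat.Partition j)) Fintype.card_pos
    Nat.Partition.sum_card_sub_mul_le hn
end

section
/- For every integer n ≥ 1, the number of partitions p(n) of n satisfies p(n) < e^(π·√(2n/3)). -/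
/-- The number of partitions of `n`, weighted by `x ^ n`, is at most the truncated Euler product
`∏ k ∈ {1, …, n}, ∑ j ≤ n, x ^ (k * j)`. -/
theorem card_partition_mul_pow_le_prod_sum (n : ℕ) {x : ℝ} (hx : 0 ≤ x) :
    (Fintype.card (Nat.Partition n) : ℝ) * x ^ n ≤
      ∏ i : Fin n, ∑ j ∈ Finset.range (n + 1), (x ^ (i.val + 1)) ^ j := by
  classical
  let c : Nat.Partition n → Fin n → ℕ := fun p i => p.parts.count (i.val + 1)
  have hc : Function.Injective c := by
    intro p q h
    ext a
    by_cases ha : 1 ≤ a ∧ a ≤ n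
    · have := congrFun h ⟨a - 1, by omega⟩
      simpa only [c, Nat.sub_add_cancel ha.1] using this
    · have key : ∀ r : Nat.Partition n, r.parts.count a = 0 := fun r =>
        Multiset.count_eq_zero.2 fun hr => ha ⟨r.parts_pos hr, r.le_of_mem_parts hr⟩
      rw [key, key]
  have hweight : ∀ p : Nat.Partition n, ∑ i : Fin n, (i.val + 1) * c p i = n := by
    intro p
    conv_rhs => rw [← p.parts_sum, Finset.sum_multiset_count_of_subset p.parts (Finset.range (n + 1))
      fun a ha => Finset.mem_range.2
        (Nat.lt_succ_of_le (p.le_of_mem_parts (Multiset.mem_toFinset.1 ha)))]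
    rw [Finset.sum_range_succ', Fin.sum_univ_eq_sum_range
      (fun i => (i + 1) * p.parts.count (i + 1)) n]
    simp [mul_comm]
  have hmem : ∀ p, c p ∈ Fintype.piFinset fun _ : Fin n => Finset.range (n + 1) := by
    intro p
    refine Fintype.mem_piFinset.2 fun i => Finset.mem_range.2 (Nat.lt_succ_of_le ?_)
    calc c p i ≤ (i.val + 1) * c p i := Nat.le_mul_of_pos_left _ (Nat.succ_pos _)
      _ ≤ ∑ i : Fin n, (i.val + 1) * c p i :=
        Finset.single_le_sum (f := fun i : Fin n => (i.val + 1) * c p i)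
          (fun _ _ => Nat.zero_le _) (Finset.mem_univ i)
      _ = n := hweight p
  rw [Finset.prod_univ_sum]
  calc (Fintype.card (Nat.Partition n) : ℝ) * x ^ n
      = ∑ p : Nat.Partition n, ∏ i, (x ^ (i.val + 1)) ^ c p i := by
        simp only [← pow_mul, Finset.prod_pow_eq_pow_sum, hweight]
        simp
    _ = ∑ f ∈ Finset.univ.image c, ∏ i, (x ^ (i.val + 1)) ^ f i :=
        (Finset.sum_image (f := fun f : Fin n → ℕ => ∏ i, (x ^ (i.val + 1)) ^ f i)
          fun _ _ _ _ h => hc h).symm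
    _ ≤ _ := Finset.sum_le_sum_of_subset_of_nonneg
        (Finset.image_subset_iff.2 fun p _ => hmem p)
        fun _ _ _ => Finset.prod_nonneg fun _ _ => by positivity

/-- Bound of `p(n) x ^ n` by the truncated Euler product in logarithmic form. -/
theorem card_partition_mul_pow_le_exp (n : ℕ) {x : ℝ} (hx : 0 ≤ x) (hx1 : x < 1) :
    (Fintype.card (Nat.Partition n) : ℝ) * x ^ n ≤
      Real.exp (∑ i : Fin n, -Real.log (1 - x ^ (i.val + 1))) := by
  refine (card_partition_mul_pow_le_prod_sum n hx).trans ?_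
  rw [Real.exp_sum]
  refine Finset.prod_le_prod (fun _ _ => by positivity) fun i _ => ?_
  have hlt : x ^ (i.val + 1) < 1 := pow_lt_one₀ hx hx1 (Nat.succ_ne_zero _)
  rw [Real.exp_neg, Real.exp_log (sub_pos.2 hlt),
    ← tsum_geometric_of_lt_one (by positivity) hlt]
  exact (summable_geometric_of_lt_one (by positivity) hlt).sum_le_tsum _
    fun _ _ => by positivity

theorem sum_exp_neg_pow_succ_lt_inv (n : ℕ) {v : ℝ} (hv : 0 < v) :
    ∑ i : Fin n, Real.exp (-v) ^ (i.val + 1) < v⁻¹ := by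
  have hpos := Real.exp_pos (-v)
  have hmul : Real.exp (-v) * Real.exp v = 1 := by rw [← Real.exp_add]; simp
  have hexp := Real.add_one_lt_exp hv.ne'
  rw [Fin.sum_univ_eq_sum_range (fun i => Real.exp (-v) ^ (i + 1)) n]
  simp only [pow_succ]
  rw [← Finset.sum_mul]
  have hgeom := geom_sum_mul_neg (Real.exp (-v)) n
  have hpow : 0 < Real.exp (-v) ^ n := by positivity
  set y := Real.exp (-v)
  set s := ∑ i ∈ Finset.range n, y ^ i
  have hs : 0 ≤ s := Finset.sum_nonneg fun _ _ => by positivity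
  have hyv : y * v ≤ 1 - y := by nlinarith
  rw [← one_div, lt_div_iff₀ hv]
  nlinarith [mul_le_mul_of_nonneg_left hyv hs]

theorem sum_neg_log_one_sub_exp_lt (n : ℕ) {u : ℝ} (hu : 0 < u) :
    ∑ i : Fin n, -Real.log (1 - Real.exp (-u) ^ (i.val + 1)) < u⁻¹ * (Real.pi ^ 2 / 6) := by
  have hlt : Real.exp (-u) < 1 := Real.exp_lt_one_iff.2 (by linarith)
  have hlog := hasSum_sum (s := (Finset.univ : Finset (Fin n))) fun i _ =>
    Real.hasSum_pow_div_log_of_abs_lt_one (x := Real.exp (-u) ^ (i.val + 1)) (by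
      rw [abs_of_pos (by positivity)]
      exact pow_lt_one₀ (Real.exp_pos _).le hlt (Nat.succ_ne_zero _))
  have hzeta : HasSum (fun m : ℕ => u⁻¹ * (1 / ((m : ℝ) + 1) ^ 2)) (u⁻¹ * (Real.pi ^ 2 / 6)) := by
    refine HasSum.mul_left _ ?_
    simpa using (hasSum_nat_add_iff' 1).2 hasSum_zeta_two
  have hterm : ∀ m : ℕ, ∑ i : Fin n, (Real.exp (-u) ^ (i.val + 1)) ^ (m + 1) / ((m : ℝ) + 1) <
      u⁻¹ * (1 / ((m : ℝ) + 1) ^ 2) := by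
    intro m
    have hm : (0 : ℝ) < m + 1 := by positivity
    have h := sum_exp_neg_pow_succ_lt_inv n (mul_pos hm hu)
    have hexp : Real.exp (-((m + 1) * u)) = Real.exp (-u) ^ (m + 1) := by
      rw [← Real.exp_nat_mul]; push_cast; ring_nf
    rw [← Finset.sum_div, div_lt_iff₀ hm]
    calc _ = ∑ i : Fin n, Real.exp (-((m + 1) * u)) ^ (i.val + 1) :=
          Finset.sum_congr rfl fun i _ => by rw [hexp, pow_right_comm]
      _ < ((m + 1) * u)⁻¹ := h
      _ = _ := by field_simp
  exact hasSum_lt (fun m => (hterm m).le) (hterm 0) hlog hzeta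

/-- Upper bound on the partition function: for `n ≥ 1`,
`p(n) < e^(π·√(2n/3))`. -/
theorem partition_upper_bound (n : ℕ) (hn : 1 ≤ n) :
    (Fintype.card (Nat.Partition n) : ℝ) < Real.exp (Real.pi * Real.sqrt (2 * n / 3)) := by
  have hn0 : (0 : ℝ) < n := by exact_mod_cast hn
  set s := Real.sqrt (2 * n / 3)
  have hs : 0 < s := Real.sqrt_pos.2 (by positivity)
  have hsq : s ^ 2 = 2 * n / 3 := Real.sq_sqrt (by positivity)
  have hπ := Real.pi_pos
  -- The saddle point minimising `π ^ 2 / (6 * u) + n * u`.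
  set u := Real.pi / (3 * s) with hu_def
  have hu : 0 < u := by positivity
  have hle := card_partition_mul_pow_le_exp n (Real.exp_pos (-u)).le
    (Real.exp_lt_one_iff.2 (by linarith))
  have hlt := Real.exp_lt_exp.2 (sum_neg_log_one_sub_exp_lt n hu)
  have hexponent : Real.pi * s = u⁻¹ * (Real.pi ^ 2 / 6) + n * u := by
    have hn_eq : (n : ℝ) = 3 * s ^ 2 / 2 := by linarith
    rw [hn_eq, hu_def]
    field_simp
    ring
  rw [← Real.exp_nat_mul, mul_neg, Real.exp_neg, ← div_eq_mul_inv] at hle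
  rw [hexponent, Real.exp_add]
  exact (div_lt_iff₀ (Real.exp_pos _)).1 (hle.trans_lt hlt)
end

section
/- For every integer n ≥ 1133, one has n^(1 + ⌊log₂(n)⌋) < p(n), where ⌊log₂(n)⌋ is the integer part of the base-2 logarithm of n and p is the partition function. -/
open Finset

namespace Nat.Partition

/-! ### Inequalities between partition numbers -/

theorem card_mono {m n : ℕ} (h : m ≤ n) :
    Fintype.card m.Partition ≤ Fintype.card n.Partition := by
  refine Fintype.card_le_of_injective
    (fun p => ⟨p.parts + Multiset.replicate (n - m) 1, ?_, ?_⟩) ?_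
  · intro i hi
    rcases Multiset.mem_add.1 hi with hi | hi
    · exact p.parts_pos hi
    · simp [Multiset.eq_of_mem_replicate hi]
  · simp [p.parts_sum, h]
  · intro p q hpq
    simpa [Nat.Partition.ext_iff] using hpq

/-- Send a pair `(p, q)` of partitions of `n` to the partition of `5 * n` with even parts `2 * p`,
odd parts greater than `1` given by `2 * q + 1`, and all other parts equal to `1`. -/
theorem card_sq_le_card_five_mul (n : ℕ) :
    Fintype.card n.Partition ^ 2 ≤ Fintype.card (5 * n).Partition := by
  rw [sq, ← Fintype.card_prod]
  have sum_even (p : n.Partition) : (p.parts.map (2 * ·)).sum = 2 * n := by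
    rw [Multiset.sum_map_mul_left, Multiset.map_id', p.parts_sum]
  have sum_odd (p : n.Partition) : (p.parts.map (2 * · + 1)).sum ≤ 3 * n := by
    calc (p.parts.map (2 * · + 1)).sum ≤ (p.parts.map (3 * ·)).sum := by
          refine Multiset.sum_map_le_sum_map _ _ fun i hi => ?_
          have := p.parts_pos hi
          lia
      _ = 3 * n := by rw [Multiset.sum_map_mul_left, Multiset.map_id', p.parts_sum]
  refine Fintype.card_le_of_injective
    (fun x => ⟨x.1.parts.map (2 * ·) + x.2.parts.map (2 * · + 1) +
      Multiset.replicate (3 * n - (x.2.parts.map (2 * · + 1)).sum) 1, ?_, ?_⟩) ?_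
  · intro i hi
    simp only [Multiset.mem_add, Multiset.mem_map, Multiset.mem_replicate] at hi
    rcases hi with (⟨j, hj, rfl⟩ | ⟨j, hj, rfl⟩) | ⟨_, rfl⟩
    · have := x.1.parts_pos hj
      lia
    · lia
    · lia
  · rw [Multiset.sum_add, Multiset.sum_add, sum_even, Multiset.sum_replicate, smul_eq_mul]
    have := sum_odd x.2
    lia
  · have even_part (p q : n.Partition) (r : ℕ) :
        (p.parts.map (2 * ·) + q.parts.map (2 * · + 1) + Multiset.replicate r 1).filter Even
          = p.parts.map (2 * ·) := by
      rw [Multiset.filter_add, Multiset.filter_add, Multiset.filter_eq_self.2,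
        Multiset.filter_eq_nil.2, Multiset.filter_eq_nil.2, add_zero, add_zero]
      · intro i hi
        simp [Multiset.eq_of_mem_replicate hi]
      · simp
      · simp
    have odd_part (p q : n.Partition) (r : ℕ) :
        (p.parts.map (2 * ·) + q.parts.map (2 * · + 1) + Multiset.replicate r 1).filter
          (fun i => ¬ Even i ∧ 1 < i) = q.parts.map (2 * · + 1) := by
      rw [Multiset.filter_add, Multiset.filter_add, Multiset.filter_eq_nil.2,
        Multiset.filter_eq_self.2, Multiset.filter_eq_nil.2, add_zero, zero_add]
      · intro i hi
        simp [Multiset.eq_of_mem_replicate hi]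
      · intro i hi
        obtain ⟨j, hj, rfl⟩ := Multiset.mem_map.1 hi
        have := q.parts_pos hj
        simp
        lia
      · simp
    rintro ⟨p, q⟩ ⟨p', q'⟩ h
    have h := congrArg Nat.Partition.parts h
    dsimp only at h
    have he := congrArg (Multiset.filter Even) h
    have ho := congrArg (Multiset.filter fun i => ¬ Even i ∧ 1 < i) h
    rw [even_part, even_part] at he
    rw [odd_part, odd_part] at ho
    have hp := Multiset.map_injective (fun a b (hab : 2 * a = 2 * b) => by lia) he
    have hq := Multiset.map_injective (fun a b (hab : 2 * a + 1 = 2 * b + 1) => by lia) ho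
    exact Prod.ext (Nat.Partition.ext hp) (Nat.Partition.ext hq)

/-- The number of partitions of `n` all of whose parts are at most `k`. -/
def countLE (k n : ℕ) : ℕ := Fintype.card {p : n.Partition // ∀ i ∈ p.parts, i ≤ k}

theorem countLE_le_card (k n : ℕ) : countLE k n ≤ Fintype.card n.Partition :=
  Fintype.card_subtype_le _

theorem one_le_countLE_one (n : ℕ) : 1 ≤ countLE 1 n :=
  Fintype.card_pos_iff.2
    ⟨⟨⟨Multiset.replicate n 1, fun hi => by simp [Multiset.eq_of_mem_replicate hi], by simp⟩,
      fun i hi => by simp [Multiset.eq_of_mem_replicate hi]⟩⟩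

theorem countLE_le_succ (k n : ℕ) : countLE k n ≤ countLE (k + 1) n :=
  Fintype.card_subtype_mono _ _ fun _ hp i hi => (hp i hi).trans k.le_succ

theorem countLE_add_countLE_sub_le {k n : ℕ} (h : k + 1 ≤ n) :
    countLE k n + countLE (k + 1) (n - (k + 1)) ≤ countLE (k + 1) n := by
  unfold countLE
  rw [← Fintype.card_sum]
  refine Fintype.card_le_of_injective (Sum.elim
    (fun p => ⟨p.1, fun i hi => (p.2 i hi).trans k.le_succ⟩)
    (fun p => ⟨⟨(k + 1) ::ₘ p.1.parts, ?_, ?_⟩, ?_⟩)) ?_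
  · intro i hi
    rcases Multiset.mem_cons.1 hi with rfl | hi
    · exact k.succ_pos
    · exact p.1.parts_pos hi
  · rw [Multiset.sum_cons, p.1.parts_sum]
    lia
  · intro i hi
    rcases Multiset.mem_cons.1 hi with rfl | hi
    · exact le_rfl
    · exact p.2 i hi
  · refine Function.Injective.sumElim ?_ ?_ ?_
    · intro p q hpq
      have := congrArg (fun r => r.1) hpq
      exact Subtype.ext this
    · intro p q hpq
      have := congrArg (fun r => r.1.parts) hpq
      exact Subtype.ext (Nat.Partition.ext ((Multiset.cons_inj_right _).1 this))
    · intro p q hpq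
      have := congrArg (fun r => r.1.parts) hpq
      have hk := p.2 (k + 1) (by rw [show p.1.parts = _ from this]; simp)
      lia

end Nat.Partition

/-! ### Truncated generating functions packed into a natural number

A sequence `f 0, …, f N` of numbers less than `B` is stored as `∑ i ≤ N, f i * B ^ i`. -/

namespace PackedSeries

/-- The coefficient sequence of `X ^ k * f`. -/
def shift (k : ℕ) (f : ℕ → ℕ) (i : ℕ) : ℕ := if k ≤ i then f (i - k) else 0

theorem shift_mono (k : ℕ) {f g : ℕ → ℕ} (h : f ≤ g) : shift k f ≤ shift k g := by
  intro i
  unfold shift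
  split_ifs
  · exact h _
  · exact le_rfl

theorem shift_add (k : ℕ) (f g : ℕ → ℕ) : shift k (f + g) = shift k f + shift k g := by
  ext i
  simp only [shift, Pi.add_apply]
  split_ifs <;> rfl

theorem shift_shift (k l : ℕ) (f : ℕ → ℕ) : shift k (shift l f) = shift (k + l) f := by
  ext i
  simp only [shift]
  split_ifs <;> first | rfl | lia

theorem monotone_shift (k : ℕ) {f : ℕ → ℕ} (hf : Monotone f) : Monotone (shift k f) := by
  intro i j hij
  unfold shift
  split_ifs
  · exact hf (by lia)
  · lia
  · exact Nat.zero_le _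
  · exact le_rfl

/-- If `g ≥ f + X ^ k * g`, then `g ≥ (1 + X ^ k) * f + X ^ (2 * k) * g`. -/
theorem add_shift_two_mul_le {k : ℕ} {f g : ℕ → ℕ} (h : f + shift k g ≤ g) :
    f + shift k f + shift (2 * k) g ≤ g := by
  calc f + shift k f + shift (2 * k) g = f + shift k (f + shift k g) := by
        rw [shift_add, shift_shift, two_mul, add_assoc]
    _ ≤ f + shift k g := add_le_add_right (shift_mono k h) f
    _ ≤ g := h

theorem sum_mul_pow_lt {B n : ℕ} {f : ℕ → ℕ} (h : ∀ i < n, f i < B) :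
    ∑ i ∈ range n, f i * B ^ i < B ^ n := by
  induction n with
  | zero => simp
  | succ n ih =>
    rw [sum_range_succ]
    have h₁ := ih fun i hi => h i (by lia)
    have h₂ : (f n + 1) * B ^ n ≤ B * B ^ n := Nat.mul_le_mul_right _ (h n n.lt_succ_self)
    rw [pow_succ']
    lia

/-- `A` stores the monotone sequence `f` up to index `N` in base `B`, without overflow. -/
structure Packs (B N A : ℕ) (f : ℕ → ℕ) : Prop where
  mono : Monotone f
  lt : f N < B
  eq : A = ∑ i ∈ range (N + 1), f i * B ^ i

namespace Packs

variable {B N A k : ℕ} {f : ℕ → ℕ}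

theorem zero (hB : 0 < B) : Packs B N 0 0 := ⟨monotone_const, hB, by simp⟩

theorem mul_pow_mod (h : Packs B N A f) :
    A * B ^ k % B ^ (N + 1) = ∑ i ∈ range (N + 1), shift k f i * B ^ i := by
  have hlt : ∑ i ∈ range (N + 1), shift k f i * B ^ i < B ^ (N + 1) := by
    refine sum_mul_pow_lt fun i hi => ?_
    have hB := h.lt
    unfold shift
    split_ifs
    · exact (h.mono (by lia)).trans_lt hB
    · lia
  have hshift : A * B ^ k = ∑ i ∈ range (N + 1 + k), shift k f i * B ^ i := by
    have hlow : ∑ i ∈ range k, shift k f i * B ^ i = 0 := by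
      refine sum_eq_zero fun i hi => ?_
      simp [shift, mem_range.1 hi]
    rw [add_comm, sum_range_add, hlow, zero_add, h.eq, sum_mul]
    refine sum_congr rfl fun i _ => ?_
    simp [shift, pow_add, mul_comm, mul_left_comm]
  rw [hshift, sum_range_add]
  have hdvd : B ^ (N + 1) ∣ ∑ i ∈ range k, shift k f (N + 1 + i) * B ^ (N + 1 + i) :=
    dvd_sum fun i _ => Dvd.dvd.mul_left (pow_dvd_pow B (by lia)) _
  obtain ⟨c, hc⟩ := hdvd
  rw [hc, Nat.add_mul_mod_self_left, Nat.mod_eq_of_lt hlt]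

theorem add_shift (h : Packs B N A f) (hlt : A + A * B ^ k % B ^ (N + 1) < B ^ (N + 1)) :
    Packs B N (A + A * B ^ k % B ^ (N + 1)) (f + shift k f) := by
  have heq : A + A * B ^ k % B ^ (N + 1) =
      ∑ i ∈ range (N + 1), (f + shift k f) i * B ^ i := by
    rw [h.mul_pow_mod]
    nth_rw 1 [h.eq]
    rw [← sum_add_distrib]
    exact sum_congr rfl fun i _ => by rw [Pi.add_apply, add_mul]
  refine ⟨h.mono.add (monotone_shift k h.mono), ?_, heq⟩
  rw [heq, sum_range_succ, pow_succ'] at hlt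
  exact Nat.lt_of_mul_lt_mul_right ((Nat.le_add_left _ _).trans_lt hlt)

theorem div_pow_mod (h : Packs B N A f) {n : ℕ} (hn : n ≤ N) : A / B ^ n % B = f n := by
  have hf (i : ℕ) (hi : i ≤ N) : f i < B := (h.mono hi).trans_lt h.lt
  have hB : 0 < B := Nat.zero_lt_of_lt h.lt
  obtain ⟨m, rfl⟩ := Nat.exists_eq_add_of_le hn
  have hdvd : B ^ (n + 1) ∣ ∑ i ∈ range m, f (n + 1 + i) * B ^ (n + 1 + i) :=
    dvd_sum fun i _ => Dvd.dvd.mul_left (pow_dvd_pow B (by lia)) _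
  obtain ⟨c, hc⟩ := hdvd
  have hA : A = ∑ i ∈ range n, f i * B ^ i + B ^ n * (f n + B * c) := by
    rw [h.eq, show n + m + 1 = n + 1 + m by lia, sum_range_add, hc, sum_range_succ]
    ring
  rw [hA, Nat.add_mul_div_left _ _ (pow_pos hB n),
    Nat.div_eq_of_lt (sum_mul_pow_lt fun i hi => hf i (by lia)), zero_add,
    Nat.add_mul_mod_self_left, Nat.mod_eq_of_lt (hf n hn)]

end Packs

/-- `force x f = f x`, arranged so that the kernel evaluates `x` before applying `f`. -/
def force {α : Type} (x : ℕ) (f : ℕ → α) : α := Nat.rec (f 0) (fun a _ => f (a + 1)) x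

theorem force_eq {α : Type} (x : ℕ) (f : ℕ → α) : force x f = f x := by
  cases x <;> rfl

/-- Multiply a packed series in base `2 ^ W` by `∏ i < j, (1 + X ^ (2 ^ i * k))`, truncating
after `X ^ N`; the result is `0` in case of overflow. -/
def mulGeom (W N : ℕ) : ℕ → ℕ → ℕ → ℕ
  | 0, _, A => A
  | j + 1, k, A =>
    force (A + A * 2 ^ (W * k) % 2 ^ (W * (N + 1))) fun A' =>
      bif Nat.blt A' (2 ^ (W * (N + 1))) then mulGeom W N j (2 * k) A' else 0

theorem exists_packs_mulGeom {W N : ℕ} {g : ℕ → ℕ} (j : ℕ) :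
    ∀ {k A : ℕ} {f : ℕ → ℕ}, Packs (2 ^ W) N A f → f + shift k g ≤ g →
      ∃ f', Packs (2 ^ W) N (mulGeom W N j k A) f' ∧ f' ≤ g := by
  induction j with
  | zero => exact fun {k A f} hA hg => ⟨f, hA, le_self_add.trans hg⟩
  | succ j ih =>
    intro k A f hA hg
    rw [mulGeom, force_eq]
    simp only [pow_mul]
    cases hb : Nat.blt (A + A * (2 ^ W) ^ k % (2 ^ W) ^ (N + 1)) ((2 ^ W) ^ (N + 1)) with
    | false => exact ⟨0, Packs.zero (by positivity), fun _ => Nat.zero_le _⟩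
    | true =>
      rw [Nat.blt_eq] at hb
      exact ih (hA.add_shift hb) (add_shift_two_mul_le hg)

/-- Packed lower bounds for the numbers of partitions with parts at most `k + 1`. -/
def partitionSeries (W N : ℕ) : ℕ → ℕ
  | 0 => (2 ^ (W * (N + 1)) - 1) / (2 ^ W - 1)
  | k + 1 => force (partitionSeries W N k) fun A =>
      mulGeom W N (Nat.log2 (N / (k + 2)) + 1) (k + 2) A

theorem exists_packs_partitionSeries {W : ℕ} (hW : 0 < W) (N k : ℕ) :
    ∃ f, Packs (2 ^ W) N (partitionSeries W N k) f ∧ f ≤ Nat.Partition.countLE (k + 1) := by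
  induction k with
  | zero =>
    have hB : 2 ≤ 2 ^ W := Nat.le_self_pow hW.ne' 2
    refine ⟨1, ⟨monotone_const, hB, ?_⟩, Nat.Partition.one_le_countLE_one⟩
    simp only [partitionSeries, Pi.one_apply, one_mul, pow_mul]
    exact (Nat.geomSum_eq hB _).symm
  | succ k ih =>
    obtain ⟨f, hf, hle⟩ := ih
    rw [partitionSeries, force_eq]
    refine exists_packs_mulGeom _ hf fun i => ?_
    simp only [Pi.add_apply, shift]
    split_ifs with hi
    · exact (Nat.add_le_add_right (hle i) _).trans
        (Nat.Partition.countLE_add_countLE_sub_le hi)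
    · exact (hle i).trans (Nat.Partition.countLE_le_succ _ _)

/-- Check that the `n`-th coefficient is at least `b` for all `(n, b)` in a list. -/
def checkBounds (W N k : ℕ) (l : List (ℕ × ℕ)) : Bool :=
  force (partitionSeries W N k) fun A =>
    l.all fun x => Nat.ble x.1 N && Nat.ble x.2 (A / 2 ^ (W * x.1) % 2 ^ W)

theorem le_card_partition_of_checkBounds {W N k : ℕ} {l : List (ℕ × ℕ)} (hW : 0 < W)
    (h : checkBounds W N k l = true) {n b : ℕ} (hnb : (n, b) ∈ l) :
    b ≤ Fintype.card n.Partition := by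
  rw [checkBounds, force_eq, List.all_eq_true] at h
  have h := h _ hnb
  rw [Bool.and_eq_true, Nat.ble_eq, Nat.ble_eq, pow_mul] at h
  obtain ⟨f, hf, hle⟩ := exists_packs_partitionSeries hW N k
  rw [hf.div_pow_mod h.1] at h
  exact h.2.trans ((hle n).trans (Nat.Partition.countLE_le_card _ _))

end PackedSeries

/-! ### The main estimate -/

/-- Lower bounds `(n, b)` for the number of partitions of `n`. -/
def partitionBounds : List (ℕ × ℕ) :=
  [(819, 2 ^ 85), (1024, 2 ^ 98), (1133, 1133 ^ 11 + 1), (1134, 1136 ^ 11 + 1),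
    (1137, 1148 ^ 11 + 1), (1149, 1195 ^ 11 + 1), (1196, 1398 ^ 11 + 1), (1399, 2047 ^ 11 + 1),
    (2048, 2 ^ 144)]

theorem le_card_partition_of_mem_partitionBounds {n b : ℕ} (h : (n, b) ∈ partitionBounds) :
    b ≤ Fintype.card n.Partition :=
  PackedSeries.le_card_partition_of_checkBounds (W := 160) (N := 2048) (k := 259) (by norm_num)
    (by decide +kernel) h

theorem pow_eleven_lt_card_partition {n : ℕ} (h₁ : 1133 ≤ n) (h₂ : n ≤ 2047) :
    n ^ 11 < Fintype.card n.Partition := by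
  have key {a c : ℕ} (hac : (a, c ^ 11 + 1) ∈ partitionBounds) (ha : a ≤ n) (hc : n ≤ c) :
      n ^ 11 < Fintype.card n.Partition :=
    (Nat.pow_le_pow_left hc 11).trans_lt
      ((le_card_partition_of_mem_partitionBounds hac).trans (Nat.Partition.card_mono ha))
  by_cases hn : n ≤ 1133
  · exact key (a := 1133) (c := 1133) (by simp [partitionBounds]) h₁ hn
  by_cases hn : n ≤ 1136
  · exact key (a := 1134) (c := 1136) (by simp [partitionBounds]) (by lia) hn
  by_cases hn : n ≤ 1148
  · exact key (a := 1137) (c := 1148) (by simp [partitionBounds]) (by lia) hn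
  by_cases hn : n ≤ 1195
  · exact key (a := 1149) (c := 1195) (by simp [partitionBounds]) (by lia) hn
  by_cases hn : n ≤ 1398
  · exact key (a := 1196) (c := 1398) (by simp [partitionBounds]) (by lia) hn
  · exact key (a := 1399) (c := 2047) (by simp [partitionBounds]) (by lia) h₂

theorem sq_le_card_partition {m n b : ℕ} (hb : b ≤ Fintype.card m.Partition) (h : 5 * m ≤ n) :
    b ^ 2 ≤ Fintype.card n.Partition :=
  (Nat.pow_le_pow_left hb 2).trans
    ((Nat.Partition.card_sq_le_card_five_mul m).trans (Nat.Partition.card_mono h))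

theorem two_pow_sq_le_card_partition_two_pow :
    ∀ m : ℕ, 11 ≤ m → 2 ^ (m + 1) ^ 2 ≤ Fintype.card (2 ^ m).Partition
  | m + 3, hm => by
    by_cases h : 11 ≤ m
    · have hexp : (m + 3 + 1) ^ 2 ≤ (m + 1) ^ 2 * 2 := by nlinarith
      refine (Nat.pow_le_pow_right two_pos hexp).trans ?_
      rw [pow_mul]
      exact sq_le_card_partition (two_pow_sq_le_card_partition_two_pow m h) (by rw [pow_add]; lia)
    · obtain rfl | rfl | rfl : m = 8 ∨ m = 9 ∨ m = 10 := by lia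
      · exact le_card_partition_of_mem_partitionBounds (by simp [partitionBounds])
      · exact le_trans (by norm_num) (sq_le_card_partition (m := 819) (b := 2 ^ 85)
          (le_card_partition_of_mem_partitionBounds (by simp [partitionBounds])) (by norm_num))
      · exact le_trans (by norm_num) (sq_le_card_partition (m := 1024) (b := 2 ^ 98)
          (le_card_partition_of_mem_partitionBounds (by simp [partitionBounds])) (by norm_num))

/-- For every `n ≥ 1133`, `n^(1 + ⌊log₂ n⌋) < p(n)`. -/
theorem pow_log_lt_partition (n : ℕ) (hn : 1133 ≤ n) :
    n ^ (1 + Nat.log 2 n) < Fintype.card (Nat.Partition n) := by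
  have hn₀ : n ≠ 0 := by lia
  by_cases h : n ≤ 2047
  · have hlog : Nat.log 2 n = 10 :=
      (Nat.log_eq_iff (by norm_num)).2 ⟨by norm_num; lia, by norm_num; lia⟩
    rw [hlog]
    exact pow_eleven_lt_card_partition hn h
  · have hlog : 11 ≤ Nat.log 2 n := Nat.le_log_of_pow_le one_lt_two (by norm_num; lia)
    calc n ^ (1 + Nat.log 2 n) < (2 ^ (Nat.log 2 n + 1)) ^ (1 + Nat.log 2 n) :=
          Nat.pow_lt_pow_left (Nat.lt_pow_succ_log_self one_lt_two n) (by lia)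
      _ = 2 ^ (Nat.log 2 n + 1) ^ 2 := by rw [← pow_mul]; ring_nf
      _ ≤ Fintype.card (2 ^ Nat.log 2 n).Partition :=
          two_pow_sq_le_card_partition_two_pow _ hlog
      _ ≤ Fintype.card n.Partition := Nat.Partition.card_mono (Nat.pow_log_le_self 2 hn₀)
end

section
/- Let a ≥ 24 be an integer and let b ∈ {2, 3}. Then p(a)^b · b ≤ 5^((a·b − 1)/3); equivalently, (p(a)^b · b)^3 ≤ 5^(a·b − 1). -/
/-- Remove a part equal to `1` if there is one; otherwise trade some part `m ≥ 2` for
`m - 2` parts equal to `1`. -/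
theorem Nat.Partition.exists_injective_sum (n : ℕ) :
    ∃ f : Nat.Partition (n + 2) → Nat.Partition (n + 1) ⊕ Nat.Partition n,
      Function.Injective f := by
  have with_one (P : Nat.Partition (n + 2)) (h : 1 ∈ P.parts) :
      ∃ Q : Nat.Partition (n + 1), P.parts = 1 ::ₘ Q.parts := by
    refine ⟨⟨P.parts.erase 1, fun hi ↦ P.parts_pos (Multiset.mem_of_mem_erase hi), ?_⟩,
      (Multiset.cons_erase h).symm⟩
    have hs := P.parts_sum
    rw [← Multiset.cons_erase h, Multiset.sum_cons] at hs
    omega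
  have without_one (P : Nat.Partition (n + 2)) (h : 1 ∉ P.parts) :
      ∃ Q : Nat.Partition n,
        P.parts = (Q.parts.count 1 + 2) ::ₘ Q.parts.filter (· ≠ 1) := by
    obtain ⟨m, hm⟩ : ∃ m, m ∈ P.parts := by
      refine Multiset.exists_mem_of_ne_zero fun h0 ↦ ?_
      have hs := P.parts_sum
      simp [h0] at hs
    have hm0 : 0 < m := P.parts_pos hm
    have hm1 : m ≠ 1 := fun e ↦ h (e ▸ hm)
    have hone : 1 ∉ P.parts.erase m := fun hi ↦ h (Multiset.mem_of_mem_erase hi)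
    refine ⟨⟨P.parts.erase m + Multiset.replicate (m - 2) 1, ?_, ?_⟩, ?_⟩
    · intro i hi
      rcases Multiset.mem_add.1 hi with hi | hi
      · exact P.parts_pos (Multiset.mem_of_mem_erase hi)
      · simp [Multiset.eq_of_mem_replicate hi]
    · have hs := P.parts_sum
      rw [← Multiset.cons_erase hm, Multiset.sum_cons] at hs
      simp only [Multiset.sum_add, Multiset.sum_replicate, smul_eq_mul, mul_one]
      omega
    · have hcount : (P.parts.erase m + Multiset.replicate (m - 2) 1).count 1 + 2 = m := by
        rw [Multiset.count_add, Multiset.count_eq_zero_of_notMem hone,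
          Multiset.count_replicate_self]
        omega
      have hfilter : (P.parts.erase m + Multiset.replicate (m - 2) 1).filter (· ≠ 1) =
          P.parts.erase m := by
        rw [Multiset.filter_add, Multiset.filter_eq_self.2 fun i hi ↦ ne_of_mem_of_not_mem hi hone,
          Multiset.filter_eq_nil.2 fun i hi ↦ by simp [Multiset.eq_of_mem_replicate hi],
          add_zero]
      rw [hcount, hfilter, Multiset.cons_erase hm]
  choose g hg using with_one
  choose k hk using without_one
  refine ⟨fun P ↦ if h : 1 ∈ P.parts then .inl (g P h) else .inr (k P h), fun P Q hPQ ↦ ?_⟩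
  by_cases hP : 1 ∈ P.parts <;> by_cases hQ : 1 ∈ Q.parts <;> simp [hP, hQ] at hPQ
  · exact Nat.Partition.ext (by rw [hg P hP, hg Q hQ, hPQ])
  · exact Nat.Partition.ext (by rw [hk P hP, hk Q hQ, hPQ])

theorem Nat.Partition.card_le_fib (n : ℕ) :
    Fintype.card (Nat.Partition n) ≤ Nat.fib (n + 1) := by
  induction n using Nat.twoStepInduction with
  | zero => simp
  | one => simp
  | more n h0 h1 =>
    obtain ⟨f, hf⟩ := Nat.Partition.exists_injective_sum n
    have h := Fintype.card_le_of_injective f hf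
    rw [Fintype.card_sum] at h
    rw [Nat.fib_add_two (n := n + 1)]
    omega

theorem four_mul_fib_succ_mul_ten_pow_le {n : ℕ} (hn : 24 ≤ n) :
    4 * Nat.fib (n + 1) * 10 ^ n ≤ 17 ^ n := by
  obtain ⟨m, rfl⟩ := Nat.exists_eq_add_of_le hn
  clear hn
  induction m using Nat.twoStepInduction with
  | zero => norm_num
  | one => norm_num
  | more m h0 h1 =>
    have hfib : Nat.fib (24 + (m + 2) + 1) = Nat.fib (24 + m + 1) + Nat.fib (24 + (m + 1) + 1) :=
      Nat.fib_add_two (n := 24 + m + 1)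
    rw [hfib]
    rw [show 24 + (m + 1) = 24 + m + 1 from rfl] at h1 ⊢
    rw [show 24 + (m + 2) = 24 + m + 1 + 1 from rfl]
    simp only [pow_succ (10 : ℕ), pow_succ (17 : ℕ)] at h1 ⊢
    generalize 10 ^ (24 + m) = s at h0 h1 ⊢
    generalize 17 ^ (24 + m) = t at h0 h1 ⊢
    linarith [Nat.zero_le t]

theorem Nat.Partition.card_pow_three_le {n : ℕ} (hn : 24 ≤ n) :
    64 * Fintype.card (Nat.Partition n) ^ 3 ≤ 5 ^ n := by
  have h : 4 * Fintype.card (Nat.Partition n) * 10 ^ n ≤ 17 ^ n :=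
    le_trans (by gcongr; exact Nat.Partition.card_le_fib n) (four_mul_fib_succ_mul_ten_pow_le hn)
  refine Nat.le_of_mul_le_mul_right (c := 1000 ^ n) ?_ (by positivity)
  calc 64 * Fintype.card (Nat.Partition n) ^ 3 * 1000 ^ n
      = (4 * Fintype.card (Nat.Partition n) * 10 ^ n) ^ 3 := by
        rw [show (1000 : ℕ) = 10 ^ 3 by norm_num, ← pow_mul, mul_comm 3 n, pow_mul]; ring
    _ ≤ (17 ^ n) ^ 3 := by gcongr
    _ = 4913 ^ n := by rw [← pow_mul, mul_comm n 3, pow_mul]; norm_num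
    _ ≤ 5000 ^ n := by gcongr; norm_num
    _ = 5 ^ n * 1000 ^ n := by rw [← mul_pow]; norm_num

/-- For `a ≥ 24` and `b ∈ {2, 3}`, `p(a)^b · b ≤ 5^((a·b − 1)/3)`;
equivalently, `(p(a)^b · b)^3 ≤ 5^(a·b − 1)`. -/
theorem partition_pow_mul_le (a b : ℕ) (ha : 24 ≤ a) (hb : b = 2 ∨ b = 3) :
    (Fintype.card (Nat.Partition a) ^ b * b) ^ 3 ≤ 5 ^ (a * b - 1) := by
  have h := Nat.pow_le_pow_left (Nat.Partition.card_pow_three_le ha) b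
  rw [← pow_mul] at h
  have hsucc : 5 ^ (a * b) = 5 ^ (a * b - 1) * 5 := by
    rw [← pow_succ]
    congr 1
    rcases hb with rfl | rfl <;> omega
  rw [hsucc] at h
  generalize Fintype.card (Nat.Partition a) = p at h ⊢
  generalize 5 ^ (a * b - 1) = N at h ⊢
  rcases hb with rfl | rfl
  · ring_nf at h ⊢
    omega
  · ring_nf at h ⊢
    omega
end

section
/- For every integer b ≥ 8, one has p(b) ≤ (5^((3 − 1/b)/3) / 3)^b; in particular (and equivalently for all b ≥ 8 via 1/b ≤ 1/8), 27^b · p(b)^3 ≤ 5^(3b − 1). -/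
namespace Nat.Partition

/-- Every partition of `n + 2` either contains the part `1`, or arises from a partition of `n` by
merging all its `1`s into a single part and increasing that part by `2`. -/
theorem card_add_two_le (n : ℕ) :
    Fintype.card (Nat.Partition (n + 2)) ≤
      Fintype.card (Nat.Partition (n + 1)) + Fintype.card (Nat.Partition n) := by
  have hsum (s : Multiset ℕ) : (s.filter (· ≠ 1)).sum + s.count 1 = s.sum := by
    conv_rhs => rw [← Multiset.filter_add_not (· = 1) s]
    rw [Multiset.sum_add, Multiset.filter_eq', Multiset.sum_replicate, smul_eq_mul, mul_one,
      add_comm]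
  let f : Nat.Partition (n + 1) ⊕ Nat.Partition n → Nat.Partition (n + 2) :=
    Sum.elim
      (fun μ => ⟨1 ::ₘ μ.parts, by
        intro i hi
        rcases Multiset.mem_cons.1 hi with rfl | hi
        · exact one_pos
        · exact μ.parts_pos hi, by
        rw [Multiset.sum_cons, μ.parts_sum]
        ring⟩)
      (fun μ => ⟨(μ.parts.count 1 + 2) ::ₘ μ.parts.filter (· ≠ 1), by
        intro i hi
        rcases Multiset.mem_cons.1 hi with rfl | hi
        · omega
        · exact μ.parts_pos (Multiset.mem_of_mem_filter hi), by
        have h := hsum μ.parts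
        rw [μ.parts_sum] at h
        rw [Multiset.sum_cons]
        omega⟩)
  have hf : Function.Surjective f := by
    intro l
    have hl := l.parts_sum
    by_cases h1 : 1 ∈ l.parts
    · obtain ⟨t, ht⟩ := Multiset.exists_cons_of_mem h1
      refine ⟨Sum.inl ⟨t, fun {i} hi => l.parts_pos (by simp [ht, hi]), ?_⟩, ?_⟩
      · rw [ht, Multiset.sum_cons] at hl
        omega
      · exact Nat.Partition.ext ht.symm
    · have hne : l.parts ≠ 0 := by
        intro h
        simp [h] at hl
      obtain ⟨k, hk⟩ := Multiset.exists_mem_of_ne_zero hne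
      obtain ⟨t, ht⟩ := Multiset.exists_cons_of_mem hk
      have hk0 := l.parts_pos hk
      have hk1 : k ≠ 1 := fun h => h1 (h ▸ hk)
      have ht1 : 1 ∉ t := fun h => h1 (by simp [ht, h])
      refine ⟨Sum.inr ⟨t + Multiset.replicate (k - 2) 1, fun {i} hi => ?_, ?_⟩, ?_⟩
      · rcases Multiset.mem_add.1 hi with hi | hi
        · exact l.parts_pos (by simp [ht, hi])
        · rw [Multiset.eq_of_mem_replicate hi]
          exact one_pos
      · rw [ht, Multiset.sum_cons] at hl
        rw [Multiset.sum_add, Multiset.sum_replicate, smul_eq_mul, mul_one]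
        omega
      · apply Nat.Partition.ext
        have hfilter : t.filter (· ≠ 1) = t :=
          Multiset.filter_eq_self.2 fun a ha h => ht1 (h ▸ ha)
        have hrep : (Multiset.replicate (k - 2) 1).filter (· ≠ 1) = 0 :=
          Multiset.filter_eq_nil.2 fun a ha h => h (Multiset.eq_of_mem_replicate ha)
        change (Multiset.count 1 (t + Multiset.replicate (k - 2) 1) + 2) ::ₘ
          (t + Multiset.replicate (k - 2) 1).filter (· ≠ 1) = l.parts
        rw [Multiset.filter_add, hfilter, hrep, add_zero, Multiset.count_add,
          Multiset.count_eq_zero_of_notMem ht1, Multiset.count_replicate_self, ht]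
        congr 1
        omega
  simpa using Fintype.card_le_of_surjective f hf

theorem card_le_fib_s14 (n : ℕ) : Fintype.card (Nat.Partition n) ≤ Nat.fib (n + 1) := by
  induction n using Nat.twoStepInduction with
  | zero => simp
  | one => simp
  | more n ih₀ ih₁ =>
    rw [show n + 2 + 1 = n + 1 + 2 by ring, Nat.fib_add_two, add_comm (Nat.fib _)]
    exact (card_add_two_le n).trans (add_le_add ih₁ ih₀)

end Nat.Partition

/-- The Fibonacci numbers grow more slowly than `(5 / 3) ^ n`, and `171 / 100` slightly exceeds
the cube root of `5`. -/
theorem fib_mul_three_pow_le (n : ℕ) :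
    171 * (Nat.fib (n + 9) * 3 ^ (n + 8)) ≤ 100 * 5 ^ (n + 8) := by
  induction n using Nat.twoStepInduction with
  | zero => norm_num [Nat.fib_add_two]
  | one => norm_num [Nat.fib_add_two]
  | more n ih₀ ih₁ =>
    rw [show n + 2 + 9 = n + 9 + 2 by ring, Nat.fib_add_two]
    rw [show n + 1 + 9 = n + 9 + 1 by ring] at ih₁
    simp only [pow_add, pow_one] at ih₀ ih₁ ⊢
    linarith [Nat.zero_le (5 ^ n)]

theorem five_mul_pow_mul_card_partition_le (b : ℕ) (hb : 8 ≤ b) :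
    5 * (27 ^ b * Fintype.card (Nat.Partition b) ^ 3) ≤ 5 ^ (3 * b) := by
  have h : 171 * (Fintype.card (Nat.Partition b) * 3 ^ b) ≤ 100 * 5 ^ b := by
    obtain ⟨n, rfl⟩ := Nat.exists_eq_add_of_le' hb
    refine le_trans ?_ (fib_mul_three_pow_le n)
    gcongr
    exact Nat.Partition.card_le_fib_s14 (n + 8)
  have h3 := Nat.pow_le_pow_left h 3
  have h27 : (27 : ℕ) ^ b = (3 ^ b) ^ 3 := by rw [← pow_mul, mul_comm, pow_mul]; norm_num
  rw [mul_comm 3 b, pow_mul, h27]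
  simp only [mul_pow] at h3
  linarith [Nat.zero_le (Fintype.card (Nat.Partition b) ^ 3 * (3 ^ b) ^ 3)]

/-- For every `b ≥ 8`, `p(b) ≤ (5^((3 − 1/b)/3) / 3)^b`; in particular
(and equivalently) `27^b · p(b)^3 ≤ 5^(3b − 1)`. -/
theorem partition_le_case_a_eq_three (b : ℕ) (hb : 8 ≤ b) :
    (Fintype.card (Nat.Partition b) : ℝ) ≤
        ((5 : ℝ) ^ (((3 : ℝ) - 1 / b) / 3) / 3) ^ b ∧
      27 ^ b * Fintype.card (Nat.Partition b) ^ 3 ≤ 5 ^ (3 * b - 1) := by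
  have hnat : 27 ^ b * Fintype.card (Nat.Partition b) ^ 3 ≤ 5 ^ (3 * b - 1) := by
    have h := five_mul_pow_mul_card_partition_le b hb
    rw [show 3 * b = 3 * b - 1 + 1 by omega, pow_succ' 5] at h
    exact Nat.le_of_mul_le_mul_left h (by norm_num)
  refine ⟨?_, hnat⟩
  have hb0 : (b : ℝ) ≠ 0 := by
    have : b ≠ 0 := by omega
    exact_mod_cast this
  have hcast : (27 : ℝ) ^ b * (Fintype.card (Nat.Partition b) : ℝ) ^ 3 ≤ 5 ^ (3 * b - 1) := by
    exact_mod_cast hnat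
  have hcube : (((5 : ℝ) ^ (((3 : ℝ) - 1 / b) / 3) / 3) ^ b) ^ 3 = 5 ^ (3 * b - 1) / 27 ^ b := by
    rw [← pow_mul, div_pow, ← Real.rpow_mul_natCast (by norm_num), mul_comm b 3, pow_mul (3 : ℝ),
      ← Real.rpow_natCast 5 (3 * b - 1)]
    congr 2
    · rw [Nat.cast_sub (by omega)]
      push_cast
      field_simp
    · norm_num
  refine le_of_pow_le_pow_left₀ three_ne_zero (by positivity) ?_
  rw [hcube, le_div_iff₀ (by positivity), mul_comm]
  exact hcast
end

section
/- For every integer b ≥ 16, one has p(b) ≤ (5^((2 − 1/b)/3) / 2)^b; in particular (and equivalently for all b ≥ 16), 8^b · p(b)^3 ≤ 5^(2b − 1). -/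
open Finset

namespace Nat.Partition

/-- The number of partitions of `n` all of whose parts are at most `k`. -/
def cardPartsLE (n k : ℕ) : ℕ := #(restricted n (· ≤ k))

theorem mem_restricted {n : ℕ} {P : ℕ → Prop} [DecidablePred P] {p : n.Partition} :
    p ∈ restricted n P ↔ ∀ i ∈ p.parts, P i := by
  simp [restricted]

theorem card_le_cardPartsLE {n k : ℕ} (h : n ≤ k) :
    Fintype.card n.Partition ≤ cardPartsLE n k := by
  rw [← Finset.card_univ]
  exact Finset.card_le_card fun p _ ↦ mem_restricted.2 fun i hi ↦ (le_of_mem_parts hi).trans h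

theorem cardPartsLE_zero_right (n : ℕ) : cardPartsLE n 0 ≤ if n = 0 then 1 else 0 := by
  split_ifs with h
  · subst h
    exact Finset.card_le_one_of_subsingleton _
  · rw [cardPartsLE, Nat.le_zero, Finset.card_eq_zero, Finset.eq_empty_iff_forall_notMem]
    intro p hp
    refine h ?_
    rw [← p.parts_sum, Multiset.sum_eq_zero_iff]
    exact fun i hi ↦ Nat.le_zero.1 (mem_restricted.1 hp i hi)

theorem cardPartsLE_succ_le (n k : ℕ) :
    cardPartsLE n (k + 1) ≤
      cardPartsLE n k + if k + 1 ≤ n then cardPartsLE (n - (k + 1)) (k + 1) else 0 := by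
  rw [cardPartsLE, ← Finset.card_filter_add_card_filter_not (fun p ↦ k + 1 ∉ p.parts)]
  refine Nat.add_le_add (Finset.card_le_card fun p hp ↦ ?_) ?_
  · rw [Finset.mem_filter, mem_restricted] at hp
    refine mem_restricted.2 fun i hi ↦ ?_
    have hne : i ≠ k + 1 := fun h ↦ hp.2 (h ▸ hi)
    have := hp.1 i hi
    omega
  · split_ifs with h
    · refine (Finset.card_le_card (t := (restricted (n - (k + 1)) (· ≤ k + 1)).image
        fun q ↦ ((partitionWithPartEquiv (by omega) h).symm q).1) fun p hp ↦ ?_).trans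
        Finset.card_image_le
      rw [Finset.mem_filter, mem_restricted, not_not] at hp
      refine Finset.mem_image.2 ⟨partitionWithPartEquiv (by omega) h ⟨p, hp.2⟩, ?_, by simp⟩
      refine mem_restricted.2 fun i hi ↦ hp.1 i ?_
      rw [partitionWithPartEquiv_apply_parts] at hi
      exact Multiset.mem_of_mem_erase hi
    · rw [Nat.le_zero, Finset.card_eq_zero, Finset.eq_empty_iff_forall_notMem]
      intro p hp
      rw [Finset.mem_filter, not_not] at hp
      exact h (le_of_mem_parts hp.2)

/-- Given the coefficients `l` of a polynomial `f`, the coefficients of `f / (1 - X ^ (d + 1))`,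
truncated to the same length; `acc` holds those already computed, in reverse order.
The pattern match makes the kernel normalise each coefficient before going on. -/
def divOneSubPow (d : ℕ) : List ℕ → List ℕ → List ℕ
  | [], acc => acc.reverse
  | x :: l, acc =>
    match x + acc.getD d 0 with
    | 0 => divOneSubPow d l (0 :: acc)
    | m + 1 => divOneSubPow d l ((m + 1) :: acc)

theorem divOneSubPow_cons (d x : ℕ) (l acc : List ℕ) :
    divOneSubPow d (x :: l) acc = divOneSubPow d l ((x + acc.getD d 0) :: acc) := by
  rw [divOneSubPow]
  split <;> simp_all

/-- The numbers of partitions of `0, …, N` into parts of size at most `k`. -/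
def cardPartsLERow (N : ℕ) : ℕ → List ℕ
  | 0 => 1 :: List.replicate N 0
  | k + 1 => divOneSubPow k (cardPartsLERow N k) []

theorem length_divOneSubPow (d : ℕ) (l acc : List ℕ) :
    (divOneSubPow d l acc).length = acc.length + l.length := by
  induction l generalizing acc with
  | nil => simp [divOneSubPow]
  | cons x l ih => rw [divOneSubPow_cons, ih]; simp; omega

theorem length_cardPartsLERow (N k : ℕ) : (cardPartsLERow N k).length = N + 1 := by
  induction k with
  | zero => simp [cardPartsLERow]
  | succ k ih => rw [cardPartsLERow, length_divOneSubPow, ih]; simp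

theorem cardPartsLE_le_divOneSubPow (k : ℕ) (l acc : List ℕ)
    (hacc : ∀ i < acc.length, cardPartsLE (acc.length - 1 - i) (k + 1) ≤ acc.getD i 0)
    (hl : ∀ i < l.length, cardPartsLE (acc.length + i) k ≤ l.getD i 0)
    (n : ℕ) (hn : n < acc.length + l.length) :
    cardPartsLE n (k + 1) ≤ (divOneSubPow k l acc).getD n 0 := by
  induction l generalizing acc with
  | nil =>
    simp only [List.length_nil, Nat.add_zero] at hn
    have := hacc (acc.length - 1 - n) (by omega)
    rw [show acc.length - 1 - (acc.length - 1 - n) = n by omega] at this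
    rw [divOneSubPow]
    simpa [List.getD_eq_getElem?_getD, List.getElem?_reverse hn] using this
  | cons x l ih =>
    rw [divOneSubPow_cons]
    refine ih _ ?_ ?_ (by simp at hn ⊢; omega)
    · rintro (_ | i) hi
      · have h0 := hl 0 (by simp)
        have h1 := cardPartsLE_succ_le acc.length k
        simp only [List.length_cons, List.getD_cons_zero, Nat.add_sub_cancel, Nat.sub_zero,
          Nat.add_zero] at h0 ⊢
        split_ifs at h1 with h
        · have h2 := hacc k h
          rw [show acc.length - 1 - k = acc.length - (k + 1) by omega] at h2
          omega
        · omega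
      · have := hacc i (by simpa using hi)
        simp only [List.length_cons, List.getD_cons_succ, Nat.add_sub_cancel]
        rwa [show acc.length - (i + 1) = acc.length - 1 - i by omega]
    · intro i hi
      have := hl (i + 1) (by simpa using hi)
      simp only [List.length_cons, List.getD_cons_succ] at this ⊢
      rwa [show acc.length + 1 + i = acc.length + (i + 1) by omega]

theorem cardPartsLE_le_row {N n : ℕ} (hn : n ≤ N) (k : ℕ) :
    cardPartsLE n k ≤ (cardPartsLERow N k).getD n 0 := by
  induction k generalizing n with
  | zero =>
    refine (cardPartsLE_zero_right n).trans ?_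
    split_ifs with h
    · simp [h, cardPartsLERow]
    · exact Nat.zero_le _
  | succ k ih =>
    refine cardPartsLE_le_divOneSubPow k _ [] (by simp) (fun i hi ↦ ?_) n ?_
    · rw [length_cardPartsLERow] at hi
      simpa using ih (show i ≤ N by omega)
    · rw [length_cardPartsLERow]
      simp
      omega

theorem cardPartsLERow_forty_four : cardPartsLERow 44 44 =
    [1, 1, 2, 3, 5, 7, 11, 15, 22, 30, 42, 56, 77, 101, 135, 176, 231, 297, 385, 490, 627, 792,
      1002, 1255, 1575, 1958, 2436, 3010, 3718, 4565, 5604, 6842, 8349, 10143, 12310, 14883,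
      17977, 21637, 26015, 31185, 37338, 44583, 53174, 63261, 75175] := by
  decide +kernel

/-- The value at `x` of the generating function of partitions into parts of size at most `k`
bounds each of its terms. -/
theorem cardPartsLE_mul_prod_mul_pow_le_one {x : ℝ} (hx₀ : 0 ≤ x) (hx₁ : x ≤ 1) (n k : ℕ) :
    cardPartsLE n k * (∏ j ∈ range k, (1 - x ^ (j + 1))) * x ^ n ≤ 1 := by
  induction k generalizing n with
  | zero =>
    have h : (cardPartsLE n 0 : ℝ) ≤ 1 := by
      exact_mod_cast (cardPartsLE_zero_right n).trans (by split_ifs <;> simp)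
    simpa using mul_le_one₀ h (pow_nonneg hx₀ n) (pow_le_one₀ hx₀ hx₁)
  | succ k ihk =>
    induction n using Nat.strong_induction_on with
    | _ n ihn =>
      have hP : 0 ≤ ∏ j ∈ range k, (1 - x ^ (j + 1)) :=
        Finset.prod_nonneg fun j _ ↦ sub_nonneg.2 (pow_le_one₀ hx₀ hx₁)
      have hy₀ : 0 ≤ x ^ (k + 1) := pow_nonneg hx₀ _
      have hy₁ : 0 ≤ 1 - x ^ (k + 1) := sub_nonneg.2 (pow_le_one₀ hx₀ hx₁)
      have hrec := cardPartsLE_succ_le n k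
      have hk := mul_le_mul_of_nonneg_right (ihk n) hy₁
      rw [Finset.prod_range_succ] at ihn ⊢
      split_ifs at hrec with h
      · have hn := mul_le_mul_of_nonneg_right (ihn (n - (k + 1)) (by omega)) hy₀
        have hpow : x ^ n = x ^ (n - (k + 1)) * x ^ (k + 1) := by
          rw [← pow_add, Nat.sub_add_cancel h]
        have hrec' : (cardPartsLE n (k + 1) : ℝ) ≤
            cardPartsLE n k + cardPartsLE (n - (k + 1)) (k + 1) := by exact_mod_cast hrec
        calc _ ≤ (cardPartsLE n k + cardPartsLE (n - (k + 1)) (k + 1) : ℝ) *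
              ((∏ j ∈ range k, (1 - x ^ (j + 1))) * (1 - x ^ (k + 1))) * x ^ n := by gcongr
          _ ≤ 1 := by rw [hpow] at hk ⊢; linarith
      · have hrec' : (cardPartsLE n (k + 1) : ℝ) ≤ cardPartsLE n k := by exact_mod_cast hrec
        calc _ ≤ (cardPartsLE n k : ℝ) *
              ((∏ j ∈ range k, (1 - x ^ (j + 1))) * (1 - x ^ (k + 1))) * x ^ n := by gcongr
          _ ≤ 1 := by linarith

/-- The factor `1 + 8 (4 / 5) ^ k` makes the bound stable under multiplication by
`1 - (4 / 5) ^ (k + 1)` for `10 ≤ k`. -/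
theorem le_prod_one_sub_four_fifths_pow {k : ℕ} (hk : 10 ≤ k) :
    (1 / 500 : ℝ) * (1 + 8 * (4 / 5) ^ k) ≤ ∏ j ∈ range k, (1 - (4 / 5 : ℝ) ^ (j + 1)) := by
  induction k, hk using Nat.le_induction with
  | base => norm_num [Finset.prod_range_succ]
  | succ k hk ih =>
    rw [Finset.prod_range_succ]
    have h₀ : (0 : ℝ) < (4 / 5) ^ k := by positivity
    have h₁ : (4 / 5 : ℝ) ^ k ≤ (4 / 5) ^ 10 :=
      pow_le_pow_of_le_one (by norm_num) (by norm_num) hk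
    have h₂ : (4 / 5 : ℝ) ^ 10 ≤ 1 / 8 := by norm_num
    have h₃ : (0 : ℝ) ≤ 1 - (4 / 5) ^ (k + 1) := by rw [pow_succ]; linarith
    refine le_trans ?_ (mul_le_mul_of_nonneg_right ih h₃)
    rw [pow_succ]
    nlinarith

theorem card_le_mul_five_fourths_pow {n : ℕ} (hn : 10 ≤ n) :
    (Fintype.card n.Partition : ℝ) ≤ 500 * (5 / 4) ^ n := by
  have h := cardPartsLE_mul_prod_mul_pow_le_one (x := 4 / 5) (by norm_num) (by norm_num) n n
  have hc : (Fintype.card n.Partition : ℝ) ≤ cardPartsLE n n := by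
    exact_mod_cast card_le_cardPartsLE le_rfl
  have hP : (1 / 500 : ℝ) ≤ ∏ j ∈ range n, (1 - (4 / 5 : ℝ) ^ (j + 1)) := by
    refine le_trans ?_ (le_prod_one_sub_four_fifths_pow hn)
    have : (0 : ℝ) < (4 / 5) ^ n := by positivity
    linarith
  have hle : (Fintype.card n.Partition : ℝ) * (1 / 500) * (4 / 5) ^ n ≤ 1 :=
    le_trans (by gcongr) h
  have hpow : (4 / 5 : ℝ) ^ n * (5 / 4) ^ n = 1 := by rw [← mul_pow]; norm_num
  have := mul_le_mul_of_nonneg_right hle (show (0 : ℝ) ≤ (5 / 4) ^ n by positivity)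
  rw [mul_assoc _ ((4 / 5 : ℝ) ^ n), hpow] at this
  linarith

theorem eight_pow_mul_card_pow_three_le {b : ℕ} (hb : 16 ≤ b) :
    8 ^ b * Fintype.card b.Partition ^ 3 ≤ 5 ^ (2 * b - 1) := by
  obtain h | h := Nat.lt_or_ge b 45
  · have hc := (card_le_cardPartsLE (show b ≤ 44 by omega)).trans
      (cardPartsLE_le_row (show b ≤ 44 by omega) 44)
    rw [cardPartsLERow_forty_four] at hc
    refine (Nat.mul_le_mul_left _ (Nat.pow_le_pow_left hc 3)).trans ?_
    clear hc
    interval_cases b <;> norm_num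
  · have hc := card_le_mul_five_fourths_pow (show 10 ≤ b by omega)
    have hbase : (5 * 500 ^ 3 : ℝ) ≤ (8 / 5) ^ b :=
      le_trans (by norm_num) (pow_le_pow_right₀ (show (1 : ℝ) ≤ 8 / 5 by norm_num) h)
    have hpow : (5 : ℝ) ^ (2 * b - 1) * 5 = (8 / 5) ^ b * (8 ^ b * ((5 / 4) ^ b) ^ 3) := by
      rw [← pow_succ, show 2 * b - 1 + 1 = 2 * b by omega, pow_mul, ← pow_mul (5 / 4) b, mul_comm b 3,
        pow_mul (5 / 4), ← mul_pow, ← mul_pow]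
      norm_num
    have hcast : (8 : ℝ) ^ b * (Fintype.card b.Partition : ℝ) ^ 3 ≤ 5 ^ (2 * b - 1) := by
      calc (8 : ℝ) ^ b * (Fintype.card b.Partition : ℝ) ^ 3
          ≤ 8 ^ b * (500 * (5 / 4) ^ b) ^ 3 := by gcongr
        _ = 5 * 500 ^ 3 * (8 ^ b * ((5 / 4) ^ b) ^ 3) / 5 := by ring
        _ ≤ (8 / 5) ^ b * (8 ^ b * ((5 / 4) ^ b) ^ 3) / 5 := by gcongr
        _ = 5 ^ (2 * b - 1) := by rw [← hpow]; ring
    exact_mod_cast hcast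

end Nat.Partition

/-- For every `b ≥ 16`, `p(b) ≤ (5^((2 − 1/b)/3) / 2)^b`; in particular
(and equivalently) `8^b · p(b)^3 ≤ 5^(2b − 1)`. -/
theorem partition_le_case_a_eq_two (b : ℕ) (hb : 16 ≤ b) :
    (Fintype.card (Nat.Partition b) : ℝ) ≤
        ((5 : ℝ) ^ (((2 : ℝ) - 1 / b) / 3) / 2) ^ b ∧
      8 ^ b * Fintype.card (Nat.Partition b) ^ 3 ≤ 5 ^ (2 * b - 1) := by
  have h := Nat.Partition.eight_pow_mul_card_pow_three_le hb
  refine ⟨?_, h⟩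
  have hcast : (8 : ℝ) ^ b * (Fintype.card b.Partition : ℝ) ^ 3 ≤ 5 ^ (2 * b - 1) := by
    exact_mod_cast h
  have hb0 : (b : ℝ) ≠ 0 := by
    have : b ≠ 0 := by omega
    exact_mod_cast this
  refine le_of_pow_le_pow_left₀ (n := 3) (by norm_num) (by positivity) ?_
  have hpow : (((5 : ℝ) ^ (((2 : ℝ) - 1 / b) / 3) / 2) ^ b) ^ 3 = 5 ^ (2 * b - 1) / 8 ^ b := by
    rw [← pow_mul, div_pow, ← Real.rpow_mul_natCast (by norm_num), mul_comm b 3, pow_mul 2]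
    congr 1
    · rw [← Real.rpow_natCast]
      congr 1
      rw [Nat.cast_sub (by omega)]
      push_cast
      field_simp
    · norm_num
  rw [hpow, le_div_iff₀ (by positivity)]
  linarith
end

section
/- Let q ≥ 8 be an integer and let c ∈ {2, 3}. Then 3^(q·c) · p(q)^c · c ≤ 5^((3·q·c − 1)/3); equivalently, (3^(q·c) · p(q)^c · c)^3 ≤ 5^(3·q·c − 1). -/
namespace Nat.Partition

theorem card_five_le : Fintype.card (Nat.Partition 5) ≤ 7 := by
  let S : Finset (Multiset ℕ) :=
    {{5}, {4, 1}, {3, 2}, {3, 1, 1}, {2, 2, 1}, {2, 1, 1, 1}, {1, 1, 1, 1, 1}}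
  have hS (P : Nat.Partition 5) : P.parts ∈ S := by
    obtain ⟨⟨l⟩, hpos, hsum⟩ := P
    change (l : Multiset ℕ) ∈ S
    replace hsum : l.sum = 5 := hsum
    replace hpos : ∀ x ∈ l, 0 < x := fun x hx => hpos hx
    rcases l with _ | ⟨a, _ | ⟨b, _ | ⟨c, _ | ⟨d, _ | ⟨e, _ | ⟨f, t⟩⟩⟩⟩⟩⟩ <;>
      simp only [List.mem_cons, List.not_mem_nil, forall_eq_or_imp, List.sum_cons,
        List.sum_nil, false_imp_iff, implies_true, and_true] at hpos hsum
    · omega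
    · obtain rfl : a = 5 := by omega
      decide
    · obtain rfl : b = 5 - a := by omega
      have : a ≤ 4 := by omega
      obtain ⟨ha, -⟩ := hpos
      interval_cases a <;> decide
    · obtain rfl : c = 5 - a - b := by omega
      have : a ≤ 3 := by omega
      have : b ≤ 3 := by omega
      obtain ⟨ha, hb, hc⟩ := hpos
      interval_cases a <;> interval_cases b <;> first | omega | decide
    · obtain rfl : d = 5 - a - b - c := by omega
      have : a ≤ 2 := by omega
      have : b ≤ 2 := by omega
      have : c ≤ 2 := by omega
      obtain ⟨ha, hb, hc, hd⟩ := hpos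
      interval_cases a <;> interval_cases b <;> interval_cases c <;> first | omega | decide
    · obtain ⟨rfl, rfl, rfl, rfl, rfl⟩ : a = 1 ∧ b = 1 ∧ c = 1 ∧ d = 1 ∧ e = 1 := by omega
      decide
    · omega
  calc Fintype.card (Nat.Partition 5) ≤ S.card :=
        Finset.card_le_card_of_injOn parts (fun P _ => hS P) fun _ _ _ _ h => Partition.ext h
    _ = 7 := by decide

theorem fifty_mul_three_pow_mul_card_le (k : ℕ) :
    50 * (3 ^ (k + 8) * Fintype.card (Nat.Partition (k + 8))) ≤ 27 * 5 ^ (k + 8) := by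
  have card_eight_nine : Fintype.card (Nat.Partition 8) ≤ 31 ∧
      Fintype.card (Nat.Partition 9) ≤ 50 := by
    have h0 : Fintype.card (Nat.Partition 0) = 1 := Fintype.card_unique
    have h1 : Fintype.card (Nat.Partition 1) = 1 := Fintype.card_unique
    have h2 := card_add_two_le 0
    have h3 := card_add_two_le 1
    have h4 := card_add_two_le 2
    have h5 := card_five_le
    have h6 := card_add_two_le 4
    have h7 := card_add_two_le 5
    have h8 := card_add_two_le 6
    have h9 := card_add_two_le 7
    norm_num only at *
    omega
  induction k using Nat.twoStepInduction with
  | zero => norm_num; omega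
  | one => norm_num; omega
  | more k ih₀ ih₁ =>
    have h := Nat.mul_le_mul_left (3 ^ k) (card_add_two_le (k + 8))
    rw [show k + 1 + 8 = k + 8 + 1 by ring] at ih₁
    rw [show k + 2 + 8 = k + 8 + 2 by ring]
    simp only [pow_add, mul_add] at h ih₀ ih₁ ⊢
    have : 0 < 5 ^ k := by positivity
    linarith

end Nat.Partition

/-- For `q ≥ 8` and `c ∈ {2, 3}`, `3^(q·c) · p(q)^c · c ≤ 5^((3·q·c − 1)/3)`;
equivalently, `(3^(q·c) · p(q)^c · c)^3 ≤ 5^(3·q·c − 1)`. -/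
theorem three_pow_mul_partition_pow_le (q c : ℕ) (hq : 8 ≤ q)
    (hc : c = 2 ∨ c = 3) :
    (3 ^ (q * c) * Fintype.card (Nat.Partition q) ^ c * c) ^ 3 ≤
      5 ^ (3 * q * c - 1) := by
  obtain ⟨k, rfl⟩ := Nat.exists_eq_add_of_le' hq
  have key := Nat.Partition.fifty_mul_three_pow_mul_card_le k
  have hpow : 5 * 5 ^ (3 * (k + 8) * c - 1) = (5 ^ (k + 8)) ^ (3 * c) := by
    rw [← pow_succ', ← pow_mul]
    congr 1
    rcases hc with rfl | rfl <;> omega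
  rw [pow_mul, ← mul_pow]
  generalize 3 ^ (k + 8) * Fintype.card (Nat.Partition (k + 8)) = x at *
  generalize 5 ^ (k + 8) = y at *
  have hxy := Nat.pow_le_pow_left key (3 * c)
  rw [mul_pow, mul_pow, ← hpow] at hxy
  rcases hc with rfl | rfl <;> norm_num [mul_pow, ← pow_mul] at hxy ⊢ <;> omega
end
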